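/- There exist real sequences (A_k)_{k≥2} and (B_k)_{k≥2} such that the recurrence coefficients admit the full asymptotic expansions a_n ∼ 1/2 + Σ_{k≥2} A_k/n^k and b_n ∼ Σ_{k≥2} B_k/n^k as n → ∞ (in particular the 1/n terms vanish); precisely, for every ℓ ≥ 1 there is a constant C > 0 such that for all n ≥ 1, | a_n − 1/2 − Σ_{k=2}^{ℓ} A_k n^{−k} | ≤ C n^{−(ℓ+1)} and | b_n − Σ_{k=2}^{ℓ} B_k n^{−k} | ≤ C n^{−(ℓ+1)}. -/

import Mathlib

open Complex Filter Set MeasureTheory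

noncomputable section

/-- The segment [-1,1] regarded as a subset of the complex plane. -/
def seg : Set ℂ := Complex.ofReal '' Set.Icc (-1) 1


/-- Bound classes: a set of nonnegative-valued control functions closed under sums. -/
structure BCl {X : Type} (B : (X → ℝ) → Prop) : Prop where
  add : ∀ b c, B b → B c → B (fun x => b x + c x)
  smul : ∀ (r : ℝ) b, 0 ≤ r → B b → B (fun x => r * b x)
  nonneg : ∀ b, B b → ∀ x, 0 ≤ b x
  ne : ∃ b, B b

/-- `HExp B K f`: `f n x` has an expansion in powers of `1/n` to order `K`, controlled by `B`. -/
def HExp {X : Type} (B : (X → ℝ) → Prop) : ℕ → (ℕ → X → ℝ) → Prop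
  | 0, f => ∃ b, B b ∧ ∀ n, 1 ≤ n → ∀ x, |f n x| ≤ b x
  | K + 1, f => ∃ c : X → ℝ, (∃ b, B b ∧ ∀ x, |c x| ≤ b x) ∧
      HExp B K (fun n x => (n : ℝ) * (f n x - c x))

section generic
variable {X : Type} {B : (X → ℝ) → Prop}

theorem HExp.congr {K : ℕ} : ∀ {f g : ℕ → X → ℝ}, HExp B K f →
    (∀ n, 1 ≤ n → ∀ x, f n x = g n x) → HExp B K g := by
  induction K with
  | zero =>
    rintro f g ⟨b, hb, h⟩ hfg
    exact ⟨b, hb, fun n hn x => by rw [← hfg n hn x]; exact h n hn x⟩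
  | succ K ih =>
    rintro f g ⟨c, hc, h⟩ hfg
    exact ⟨c, hc, ih h (fun n hn x => by rw [hfg n hn x])⟩

theorem HExp.add (hB : BCl B) {K : ℕ} : ∀ {f g : ℕ → X → ℝ}, HExp B K f → HExp B K g →
    HExp B K (fun n x => f n x + g n x) := by
  induction K with
  | zero =>
    rintro f g ⟨b, hb, h⟩ ⟨b', hb', h'⟩
    exact ⟨_, hB.add _ _ hb hb', fun n hn x =>
      (abs_add_le _ _).trans (add_le_add (h n hn x) (h' n hn x))⟩
  | succ K ih =>
    rintro f g ⟨c, ⟨b, hb, hc⟩, h⟩ ⟨c', ⟨b', hb', hc'⟩, h'⟩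
    refine ⟨fun x => c x + c' x, ⟨_, hB.add _ _ hb hb', fun x =>
      (abs_add_le _ _).trans (add_le_add (hc x) (hc' x))⟩, ?_⟩
    exact (ih h h').congr (fun n hn x => by ring)

theorem HExp.smul (hB : BCl B) (r : ℝ) {K : ℕ} : ∀ {f : ℕ → X → ℝ}, HExp B K f →
    HExp B K (fun n x => r * f n x) := by
  induction K with
  | zero =>
    rintro f ⟨b, hb, h⟩
    refine ⟨_, hB.smul |r| _ (abs_nonneg r) hb, fun n hn x => ?_⟩
    rw [abs_mul]
    exact mul_le_mul_of_nonneg_left (h n hn x) (abs_nonneg r)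
  | succ K ih =>
    rintro f ⟨c, ⟨b, hb, hc⟩, h⟩
    refine ⟨fun x => r * c x, ⟨_, hB.smul |r| _ (abs_nonneg r) hb, fun x => ?_⟩, ?_⟩
    · rw [abs_mul]
      exact mul_le_mul_of_nonneg_left (hc x) (abs_nonneg r)
    · exact (ih h).congr (fun n hn x => by ring)

theorem HExp.sub (hB : BCl B) {K : ℕ} {f g : ℕ → X → ℝ} (hf : HExp B K f) (hg : HExp B K g) :
    HExp B K (fun n x => f n x - g n x) :=
  (hf.add hB (hg.smul hB (-1))).congr (fun n hn x => by ring)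

theorem HExp.zero (hB : BCl B) : ∀ K : ℕ, HExp B K (fun _ _ => 0) := by
  obtain ⟨b, hb⟩ := hB.ne
  intro K
  induction K with
  | zero => exact ⟨b, hb, fun n hn x => by simpa using hB.nonneg b hb x⟩
  | succ K ih =>
    exact ⟨fun _ => 0, ⟨b, hb, fun x => by simpa using hB.nonneg b hb x⟩,
      ih.congr (fun n hn x => by simp)⟩

theorem HExp.const (hB : BCl B) {c b : X → ℝ} (hb : B b) (hc : ∀ x, |c x| ≤ b x) :
    ∀ K : ℕ, HExp B K (fun _ x => c x) := by
  intro K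
  cases K with
  | zero => exact ⟨b, hb, fun n hn x => hc x⟩
  | succ K =>
    exact ⟨c, ⟨b, hb, hc⟩, (HExp.zero hB K).congr (fun n hn x => by simp)⟩

/-- if `n * f` has an expansion to order `K` then `f` has one to order `K+1`. -/
theorem HExp.of_mul (hB : BCl B) {K : ℕ} {f : ℕ → X → ℝ}
    (h : HExp B K (fun n x => (n : ℝ) * f n x)) : HExp B (K + 1) f := by
  obtain ⟨b, hb⟩ := hB.ne
  exact ⟨fun _ => 0, ⟨b, hb, fun x => by simpa using hB.nonneg b hb x⟩,
    h.congr (fun n hn x => by simp)⟩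

theorem HExp.pred (hB : BCl B) {K : ℕ} : ∀ {f : ℕ → X → ℝ}, HExp B (K + 1) f → HExp B K f := by
  induction K with
  | zero =>
    rintro f ⟨c, ⟨b, hb, hc⟩, b', hb', h⟩
    refine ⟨_, hB.add _ _ hb hb', fun n hn x => ?_⟩
    have h1 := h n hn x
    have hn' : (1:ℝ) ≤ n := by exact_mod_cast hn
    have h2 : |f n x - c x| ≤ b' x := by
      refine le_trans ?_ h1
      rw [abs_mul, abs_of_nonneg (by linarith : (0:ℝ) ≤ n)]
      exact le_mul_of_one_le_left (abs_nonneg _) hn'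
    calc |f n x| = |c x + (f n x - c x)| := by ring_nf
      _ ≤ _ := (abs_add_le _ _).trans (add_le_add (hc x) h2)
  | succ K ih =>
    rintro f ⟨c, hc, h⟩
    exact ⟨c, hc, ih h⟩

theorem HExp.toZero (hB : BCl B) {K : ℕ} {f : ℕ → X → ℝ} (h : HExp B K f) : HExp B 0 f := by
  induction K with
  | zero => exact h
  | succ K ih => exact ih (h.pred hB)

theorem HExp.mono (hB : BCl B) {K L : ℕ} (hKL : L ≤ K) {f : ℕ → X → ℝ} (h : HExp B K f) :
    HExp B L f := by
  induction hKL with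
  | refl => exact h
  | step _ ih => exact ih (h.pred hB)

theorem HExp.div_nat (hB : BCl B) {K : ℕ} {f : ℕ → X → ℝ} (h : HExp B K f) :
    HExp B (K + 1) (fun n x => f n x / n) :=
  HExp.of_mul hB (h.congr (fun n hn x => by
    have : (n:ℝ) ≠ 0 := by positivity
    field_simp))

theorem HExp.tendsto_of (hB : BCl B) {K : ℕ} {f : ℕ → X → ℝ} {c : X → ℝ}
    (h : HExp B K (fun n x => (n : ℝ) * (f n x - c x))) (x : X) :
    Tendsto (fun n => f n x) atTop (nhds (c x)) := by
  obtain ⟨b, hb, h⟩ := h.toZero hB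
  rw [tendsto_iff_norm_sub_tendsto_zero]
  refine squeeze_zero' (Eventually.of_forall fun _ => norm_nonneg _) ?_
    (tendsto_const_div_atTop_nhds_zero_nat (b x))
  filter_upwards [eventually_ge_atTop 1] with n hn
  have hn' : (0:ℝ) < n := by exact_mod_cast hn
  rw [le_div_iff₀ hn', Real.norm_eq_abs, mul_comm]
  have := h n hn x
  rwa [abs_mul, abs_of_pos hn'] at this

theorem HExp.shift_of_tendsto (hB : BCl B) {K : ℕ} {f : ℕ → X → ℝ} {c : X → ℝ}
    (h : HExp B (K+1) f) (hc : ∀ x, Tendsto (fun n => f n x) atTop (nhds (c x))) :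
    HExp B K (fun n x => (n : ℝ) * (f n x - c x)) := by
  obtain ⟨c', _, h⟩ := h
  have : c' = c := funext fun x => tendsto_nhds_unique (HExp.tendsto_of hB h x) (hc x)
  rwa [this] at h

/-- transfer along a linear map. -/
theorem HExp.map {Y : Type} {B' : (Y → ℝ) → Prop} (hB : BCl B)
    (T : (X → ℝ) → (Y → ℝ))
    (hT : ∀ b, B b → ∃ b', B' b' ∧ ∀ f : X → ℝ, (∀ x, |f x| ≤ b x) → ∀ y, |T f y| ≤ b' y)
    (hlin : ∀ (r : ℝ) (b : X → ℝ) (f c : X → ℝ), B b → (∀ x, |f x| ≤ b x) → (∀ x, |c x| ≤ b x) →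
      ∀ y, T (fun x => r * (f x - c x)) y = r * (T f y - T c y))
    {K : ℕ} : ∀ {f : ℕ → X → ℝ}, HExp B K f → HExp B' K (fun n => T (f n)) := by
  induction K with
  | zero =>
    rintro f ⟨b, hb, h⟩
    obtain ⟨b', hb', h'⟩ := hT b hb
    exact ⟨b', hb', fun n hn x => h' (f n) (h n hn) x⟩
  | succ K ih =>
    rintro f hf
    obtain ⟨b1, hb1, h1⟩ := hf.toZero hB
    obtain ⟨c, ⟨b, hb, hc⟩, h⟩ := hf
    obtain ⟨b', hb', h'⟩ := hT b hb
    refine ⟨T c, ⟨b', hb', fun y => h' c hc y⟩, ?_⟩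
    refine (ih h).congr (fun n hn y => ?_)
    refine hlin n _ (f n) c (hB.add _ _ hb hb1) (fun x => ?_) (fun x => ?_) y
    · exact (h1 n hn x).trans (le_add_of_nonneg_left (hB.nonneg b hb x))
    · exact (hc x).trans (le_add_of_nonneg_right (hB.nonneg b1 hb1 x))

/-- multiplication -/
theorem HExp.mul (hB : BCl B) (hmul : ∀ b c, B b → B c → B (fun x => b x * c x)) {K : ℕ} :
    ∀ {f g : ℕ → X → ℝ}, HExp B K f → HExp B K g → HExp B K (fun n x => f n x * g n x) := by
  induction K with
  | zero =>
    rintro f g ⟨b, hb, h⟩ ⟨b', hb', h'⟩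
    refine ⟨_, hmul _ _ hb hb', fun n hn x => ?_⟩
    rw [abs_mul]
    exact mul_le_mul (h n hn x) (h' n hn x) (abs_nonneg _) (hB.nonneg b hb x)
  | succ K ih =>
    rintro f g hf hg
    have hf' := hf.pred hB
    obtain ⟨c, ⟨b, hb, hc⟩, h⟩ := hf
    obtain ⟨c', ⟨b', hb', hc'⟩, h'⟩ := hg
    refine ⟨fun x => c x * c' x, ⟨_, hmul _ _ hb hb', fun x => ?_⟩, ?_⟩
    · rw [abs_mul]
      exact mul_le_mul (hc x) (hc' x) (abs_nonneg _) (hB.nonneg b hb x)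
    · exact ((ih hf' h').add hB (ih h (HExp.const hB hb' hc' K))).congr
        (fun n hn x => by ring)

end generic

/-! ### polynomial control -/

/-- bounded by a polynomial class -/
def PBB {X : Type} (φ : X → ℝ) (b : X → ℝ) : Prop :=
  (∀ x, 0 ≤ b x) ∧ ∃ (C : ℝ) (d : ℕ), 0 ≤ C ∧ ∀ x, b x ≤ C * φ x ^ d

theorem PBB.bcl {X : Type} {φ : X → ℝ} (hφ : ∀ x, 1 ≤ φ x) : BCl (PBB φ) where
  add := by
    rintro b c ⟨hb0, C, d, hC, hb⟩ ⟨hc0, C', d', hC', hc⟩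
    refine ⟨fun x => add_nonneg (hb0 x) (hc0 x), C + C', d + d', by positivity, fun x => ?_⟩
    have h1 : φ x ^ d ≤ φ x ^ (d + d') := pow_le_pow_right₀ (hφ x) (by omega)
    have h2 : φ x ^ d' ≤ φ x ^ (d + d') := pow_le_pow_right₀ (hφ x) (by omega)
    rw [add_mul]
    exact add_le_add ((hb x).trans (mul_le_mul_of_nonneg_left h1 hC))
      ((hc x).trans (mul_le_mul_of_nonneg_left h2 hC'))
  smul := by
    rintro r b hr ⟨hb0, C, d, hC, hb⟩
    refine ⟨fun x => mul_nonneg hr (hb0 x), r * C, d, by positivity, fun x => ?_⟩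
    rw [mul_assoc]
    exact mul_le_mul_of_nonneg_left (hb x) hr
  nonneg := fun b hb => hb.1
  ne := ⟨fun _ => 0, fun _ => le_rfl, 0, 0, le_rfl, fun _ => by simp⟩

theorem PBB.mul {X : Type} {φ : X → ℝ} (hφ : ∀ x, 1 ≤ φ x) :
    ∀ b c, PBB φ b → PBB φ c → PBB φ (fun x => b x * c x) := by
  rintro b c ⟨hb0, C, d, hC, hb⟩ ⟨hc0, C', d', hC', hc⟩
  refine ⟨fun x => mul_nonneg (hb0 x) (hc0 x), C * C', d + d', by positivity, fun x => ?_⟩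
  have h0 : 0 ≤ φ x := by linarith [hφ x]
  calc b x * c x ≤ (C * φ x ^ d) * (C' * φ x ^ d') :=
        mul_le_mul (hb x) (hc x) (hc0 x) (by positivity)
    _ = _ := by rw [pow_add]; ring

/-- expansions only matter for `n` large, polynomially in the parameter -/
theorem HExp.congr_large {X : Type} {φ : X → ℝ} (hφ : ∀ x, 1 ≤ φ x) {M : X → ℝ} (hM : PBB φ M)
    {K : ℕ} : ∀ {f g : ℕ → X → ℝ}, HExp (PBB φ) K g → HExp (PBB φ) 0 f →
      (∀ (n : ℕ) x, 1 ≤ n → M x < n → f n x = g n x) → HExp (PBB φ) K f := by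
  have hB := PBB.bcl hφ
  induction K with
  | zero => intro f g hg hf _; exact hf
  | succ K ih =>
    rintro f g ⟨c, ⟨b, hb, hc⟩, h⟩ ⟨b', hb', hf⟩ hfg
    refine ⟨c, ⟨b, hb, hc⟩, ih h ?_ (fun n x hn hx => by rw [hfg n x hn hx])⟩
    obtain ⟨b2, hb2, h2⟩ := h.toZero hB
    refine ⟨_, hB.add _ _ hb2 (PBB.mul hφ _ _ hM (hB.add _ _ hb' hb)), fun n hn x => ?_⟩
    have hM0 := hM.1 x
    have hb0 := hb.1 x
    have hb0' := hb'.1 x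
    by_cases hx : M x < n
    · show |(n:ℝ) * (f n x - c x)| ≤ _
      rw [hfg n x hn hx]
      refine (h2 n hn x).trans (le_add_of_nonneg_right (by positivity))
    · push Not at hx
      refine le_trans ?_ (le_add_of_nonneg_left (hb2.1 x))
      rw [abs_mul, abs_of_nonneg (by positivity : (0:ℝ) ≤ n)]
      refine mul_le_mul hx ?_ (abs_nonneg _) hM0
      exact (abs_sub _ _).trans (add_le_add (hf n hn x) (hc x))

theorem HExp.subst {X Y : Type} {φ : X → ℝ} {ψ : Y → ℝ} (hφ : ∀ x, 1 ≤ φ x)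
    (σ : Y → X) (hσ : ∃ A : ℝ, 0 ≤ A ∧ ∀ y, φ (σ y) ≤ A * ψ y) {K : ℕ} {f : ℕ → X → ℝ}
    (h : HExp (PBB φ) K f) : HExp (PBB ψ) K (fun n y => f n (σ y)) := by
  refine HExp.map (B' := PBB ψ) (PBB.bcl hφ) (fun f y => f (σ y)) ?_ (by intros; rfl) h
  rintro b ⟨hb0, C, d, hC, hb⟩
  obtain ⟨A, hA0, hA⟩ := hσ
  refine ⟨fun y => b (σ y), ⟨fun y => hb0 _, C * A ^ d, d, ?_, fun y => ?_⟩, fun f hf y => hf _⟩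
  · positivity
  · refine (hb _).trans ?_
    rw [mul_assoc, ← mul_pow]
    exact mul_le_mul_of_nonneg_left (pow_le_pow_left₀ (by linarith [hφ (σ y)]) (hA y) d) hC

/-- finite sums with polynomially many terms -/
theorem HExp.sum {X Y : Type} {φ : X → ℝ} {ψ : Y → ℝ} (hφ : ∀ x, 1 ≤ φ x) (hψ : ∀ x, 1 ≤ ψ x)
    (σ : Y → ℕ → X) (N : Y → ℕ) (hN : ∀ y, (N y : ℝ) ≤ ψ y)
    (hσ : ∃ A : ℝ, 0 ≤ A ∧ ∀ y, ∀ l < N y, φ (σ y l) ≤ A * ψ y) {K : ℕ} {f : ℕ → X → ℝ}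
    (h : HExp (PBB φ) K f) :
    HExp (PBB ψ) K (fun n y => ∑ l ∈ Finset.range (N y), f n (σ y l)) := by
  refine HExp.map (B' := PBB ψ) (PBB.bcl hφ) (fun f y => ∑ l ∈ Finset.range (N y), f (σ y l))
    ?_ ?_ h
  · rintro b ⟨hb0, C, d, hC, hb⟩
    obtain ⟨A, hA0, hA⟩ := hσ
    refine ⟨fun y => ψ y * (C * (A * ψ y) ^ d), ⟨fun y => ?_, C * A ^ d, d + 1, by positivity,
      fun y => ?_⟩, fun f hf y => ?_⟩
    · have := hψ y
      have : 0 ≤ ψ y := by linarith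
      positivity
    · show ψ y * (C * (A * ψ y) ^ d) ≤ _
      rw [mul_pow, pow_succ]
      apply le_of_eq; ring
    · have hy0 : 0 ≤ ψ y := by linarith [hψ y]
      calc |∑ l ∈ Finset.range (N y), f (σ y l)| ≤ ∑ l ∈ Finset.range (N y), |f (σ y l)| :=
            Finset.abs_sum_le_sum_abs _ _
        _ ≤ ∑ l ∈ Finset.range (N y), C * (A * ψ y) ^ d := by
            refine Finset.sum_le_sum fun l hl => ?_
            refine (hf _).trans ((hb _).trans ?_)
            exact mul_le_mul_of_nonneg_left (pow_le_pow_left₀ (by linarith [hφ (σ y l)])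
              (hA y l (Finset.mem_range.1 hl)) d) hC
        _ = N y * (C * (A * ψ y) ^ d) := by simp
        _ ≤ _ := mul_le_mul_of_nonneg_right (hN y) (by positivity)
  · intro r b f c _ _ _ y
    simp only [Finset.mul_sum, Finset.sum_sub_distrib, mul_sub]

/-! ### scalar sequences -/

/-- scalar sequences with expansion to order `K` -/
def SExp (K : ℕ) (f : ℕ → ℝ) : Prop := HExp (PBB (fun _ : Unit => (1:ℝ))) K (fun n _ => f n)

theorem sB : BCl (PBB (fun _ : Unit => (1:ℝ))) := PBB.bcl (fun _ => le_rfl)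

theorem sB_const (M : ℝ) (hM : 0 ≤ M) : PBB (fun _ : Unit => (1:ℝ)) (fun _ => M) :=
  ⟨fun _ => hM, M, 0, hM, fun _ => by simp⟩

theorem SExp.zero_iff {f : ℕ → ℝ} : SExp 0 f ↔ ∃ M : ℝ, ∀ n, 1 ≤ n → |f n| ≤ M := by
  constructor
  · rintro ⟨b, hb, h⟩
    exact ⟨b (), fun n hn => h n hn ()⟩
  · rintro ⟨M, h⟩
    exact ⟨fun _ => |M|, sB_const _ (abs_nonneg _), fun n hn _ => (h n hn).trans (le_abs_self _)⟩

theorem SExp.succ_iff {K : ℕ} {f : ℕ → ℝ} :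
    SExp (K + 1) f ↔ ∃ c : ℝ, SExp K (fun n => (n:ℝ) * (f n - c)) := by
  constructor
  · rintro ⟨c, _, h⟩
    exact ⟨c (), h⟩
  · rintro ⟨c, h⟩
    exact ⟨fun _ => c, ⟨fun _ => |c|, sB_const _ (abs_nonneg _), fun _ => le_rfl⟩, h⟩

theorem SExp.congr {K : ℕ} {f g : ℕ → ℝ} (h : SExp K f) (hfg : ∀ n, 1 ≤ n → f n = g n) :
    SExp K g := HExp.congr h (fun n hn _ => hfg n hn)

theorem SExp.add {K : ℕ} {f g : ℕ → ℝ} (hf : SExp K f) (hg : SExp K g) :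
    SExp K (fun n => f n + g n) := HExp.add sB hf hg

theorem SExp.sub {K : ℕ} {f g : ℕ → ℝ} (hf : SExp K f) (hg : SExp K g) :
    SExp K (fun n => f n - g n) := HExp.sub sB hf hg

theorem SExp.smul {K : ℕ} {f : ℕ → ℝ} (r : ℝ) (hf : SExp K f) :
    SExp K (fun n => r * f n) := HExp.smul sB r hf

theorem SExp.const (K : ℕ) (c : ℝ) : SExp K (fun _ => c) :=
  HExp.const sB (sB_const |c| (abs_nonneg _)) (fun _ => le_rfl) K

theorem SExp.mul {K : ℕ} {f g : ℕ → ℝ} (hf : SExp K f) (hg : SExp K g) :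
    SExp K (fun n => f n * g n) := HExp.mul sB (PBB.mul fun _ => le_rfl) hf hg

theorem SExp.div_nat {K : ℕ} {f : ℕ → ℝ} (hf : SExp K f) :
    SExp (K + 1) (fun n => f n / n) := HExp.div_nat sB hf

theorem SExp.pred {K : ℕ} {f : ℕ → ℝ} (hf : SExp (K + 1) f) : SExp K f := HExp.pred sB hf

theorem SExp.mono {K L : ℕ} (h : L ≤ K) {f : ℕ → ℝ} (hf : SExp K f) : SExp L f :=
  HExp.mono sB h hf

theorem SExp.tendsto {K : ℕ} {f : ℕ → ℝ} {c : ℝ} (h : SExp K (fun n => (n:ℝ) * (f n - c))) :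
    Tendsto f atTop (nhds c) := HExp.tendsto_of (c := fun _ => c) sB h ()

theorem SExp.shift_of_tendsto {K : ℕ} {f : ℕ → ℝ} {c : ℝ} (h : SExp (K + 1) f)
    (hc : Tendsto f atTop (nhds c)) : SExp K (fun n => (n:ℝ) * (f n - c)) :=
  HExp.shift_of_tendsto (c := fun _ => c) sB h (fun _ => hc)

theorem SExp.congr_large {K : ℕ} (m : ℕ) {f g : ℕ → ℝ} (hg : SExp K g)
    (h : ∀ n, m < n → f n = g n) : SExp K f := by
  obtain ⟨M, hM⟩ := SExp.zero_iff.1 (HExp.toZero sB hg)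
  refine HExp.congr_large (M := fun _ => (m:ℝ)) (fun _ => le_rfl)
    ⟨fun _ => by positivity, m, 0, by positivity, fun _ => by simp⟩ hg ?_
    (fun n _ _ hn => h n (by exact_mod_cast hn))
  show SExp 0 f
  rw [SExp.zero_iff]
  refine ⟨|M| + ∑ k ∈ Finset.range (m + 1), |f k|, fun n hn => ?_⟩
  by_cases hmn : m < n
  · rw [h n hmn]
    exact ((hM n hn).trans (le_abs_self _)).trans
      (le_add_of_nonneg_right (Finset.sum_nonneg fun _ _ => abs_nonneg _))
  · refine le_trans ?_ (le_add_of_nonneg_left (abs_nonneg _))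
    exact Finset.single_le_sum (f := fun k => |f k|) (fun _ _ => abs_nonneg _)
      (Finset.mem_range.2 (by omega))

theorem SExp.inv {δ : ℝ} (hδ : 0 < δ) {K : ℕ} : ∀ {f : ℕ → ℝ}, SExp K f →
    (∀ n, 1 ≤ n → δ ≤ f n) → SExp K (fun n => (f n)⁻¹) := by
  induction K with
  | zero =>
    intro f _ h
    rw [SExp.zero_iff]
    refine ⟨δ⁻¹, fun n hn => ?_⟩
    have h1 := h n hn
    rw [abs_of_pos (inv_pos.2 (by linarith))]
    exact inv_anti₀ hδ h1
  | succ K ih =>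
    intro f hf h
    have hi := ih hf.pred h
    obtain ⟨c, hc⟩ := SExp.succ_iff.1 hf
    have hc0 : δ ≤ c := ge_of_tendsto (SExp.tendsto hc)
      (by filter_upwards [eventually_ge_atTop 1] with n hn using h n hn)
    refine SExp.succ_iff.2 ⟨c⁻¹, ?_⟩
    refine ((hc.mul hi).smul (-c⁻¹)).congr fun n hn => ?_
    have h1 := h n hn
    have h2 : f n ≠ 0 := by linarith
    have h3 : c ≠ 0 := by linarith
    field_simp
    ring

theorem SExp.sqrt {δ : ℝ} (hδ : 0 < δ) {K : ℕ} : ∀ {f : ℕ → ℝ}, SExp K f →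
    (∀ n, 1 ≤ n → δ ≤ f n) → SExp K (fun n => √(f n)) := by
  induction K with
  | zero =>
    intro f hf h
    rw [SExp.zero_iff] at hf ⊢
    obtain ⟨M, hM⟩ := hf
    refine ⟨√M, fun n hn => ?_⟩
    rw [abs_of_nonneg (Real.sqrt_nonneg _)]
    exact Real.sqrt_le_sqrt ((le_abs_self _).trans (hM n hn))
  | succ K ih =>
    intro f hf h
    have hi := ih hf.pred h
    obtain ⟨c, hc⟩ := SExp.succ_iff.1 hf
    have hc0 : δ ≤ c := ge_of_tendsto (SExp.tendsto hc)
      (by filter_upwards [eventually_ge_atTop 1] with n hn using h n hn)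
    refine SExp.succ_iff.2 ⟨√c, ?_⟩
    have hs : 0 < √c := Real.sqrt_pos.2 (by linarith)
    have hinv := (hi.add (SExp.const K (√c))).inv hs
      (fun n hn => le_add_of_nonneg_left (Real.sqrt_nonneg _))
    refine (hc.mul hinv).congr fun n hn => ?_
    have h1 := h n hn
    have h2 : √(f n) + √c ≠ 0 := by have := Real.sqrt_nonneg (f n); positivity
    have e1 : √(f n) ^ 2 = f n := Real.sq_sqrt (by linarith)
    have e2 : √c ^ 2 = c := Real.sq_sqrt (by linarith)
    rw [mul_inv_eq_iff_eq_mul₀ h2]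
    have : f n - c = (√(f n) - √c) * (√(f n) + √c) := by linear_combination -e1 + e2
    rw [this]; ring

theorem one_le_phiZ : ∀ i : ℤ, (1:ℝ) ≤ 1 + |(i:ℝ)| := fun i => by
  have := abs_nonneg (i:ℝ); linarith

theorem ratio_exp (K : ℕ) :
    HExp (PBB (fun i : ℤ => 1 + |(i:ℝ)|)) K (fun n i => (n:ℝ) / ((n:ℝ) - i)) := by
  have hB := PBB.bcl one_le_phiZ
  have h0 : HExp (PBB (fun i : ℤ => 1 + |(i:ℝ)|)) 0 (fun n i => (n:ℝ) / ((n:ℝ) - i)) := by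
    refine ⟨fun i => 1 + |(i:ℝ)|, ⟨fun i => by positivity, 1, 1, by norm_num, fun i => by simp⟩, ?_⟩
    intro n hn i
    show |(n:ℝ) / ((n:ℝ) - i)| ≤ 1 + |(i:ℝ)|
    by_cases hni : (n:ℤ) = i
    · have : (n:ℝ) - i = 0 := by rw [← hni]; simp
      rw [this]; simp; positivity
    · have h1 : (1:ℝ) ≤ |(n:ℝ) - i| := by
        have : 1 ≤ |(n:ℤ) - i| := Int.one_le_abs (by omega)
        exact_mod_cast this
      rw [abs_div, div_le_iff₀ (by linarith)]
      have h2 : |(n:ℝ)| ≤ |(n:ℝ) - i| + |(i:ℝ)| := by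
        calc |(n:ℝ)| = |((n:ℝ) - i) + i| := by ring_nf
          _ ≤ _ := abs_add_le _ _
      nlinarith [abs_nonneg (i:ℝ)]
  induction K with
  | zero => exact h0
  | succ K ih =>
    have hI : HExp (PBB (fun i : ℤ => 1 + |(i:ℝ)|)) K (fun _ i => (i:ℝ)) :=
      HExp.const hB (b := fun i => 1 + |(i:ℝ)|)
        ⟨fun i => by positivity, 1, 1, by norm_num, fun i => by simp⟩ (fun i => by linarith) K
    have h1 := HExp.div_nat hB (HExp.mul hB (PBB.mul one_le_phiZ) hI ih)
    have h2 : HExp (PBB (fun i : ℤ => 1 + |(i:ℝ)|)) (K+1) (fun _ _ => (1:ℝ)) :=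
      HExp.const hB (b := fun i => 1)
        ⟨fun i => by positivity, 1, 0, by norm_num, fun i => by simp⟩ (fun i => by simp) _
    refine HExp.congr_large (M := fun i : ℤ => |(i:ℝ)|) one_le_phiZ
      ⟨fun i => by positivity, 1, 1, by norm_num, fun i => by simp⟩ (h2.add hB h1) h0 ?_
    intro n i hn hi
    have : (n:ℝ) - i ≠ 0 := by have := le_abs_self (i:ℝ); linarith
    have hn0 : (n:ℝ) ≠ 0 := by positivity
    field_simp
    ring

theorem shiftZ {K : ℕ} : ∀ {f : ℤ → ℝ}, SExp K (fun n => f n) → (∃ M, ∀ p ≤ 0, |f p| ≤ M) →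
    HExp (PBB (fun i : ℤ => 1 + |(i:ℝ)|)) K (fun n i => f ((n:ℤ) - i)) := by
  have hB := PBB.bcl one_le_phiZ
  have key : ∀ {f : ℤ → ℝ}, SExp 0 (fun n => f n) → (∃ M, ∀ p ≤ 0, |f p| ≤ M) →
    HExp (PBB (fun i : ℤ => 1 + |(i:ℝ)|)) 0 (fun n i => f ((n:ℤ) - i)) := by
    rintro f h ⟨M, hM⟩
    obtain ⟨M', hM'⟩ := SExp.zero_iff.1 h
    refine ⟨fun _ => |M| + |M'|, ⟨fun i => by positivity, |M| + |M'|, 0, by positivity,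
      fun i => by simp⟩, fun n hn i => ?_⟩
    by_cases hp : (n:ℤ) - i ≤ 0
    · exact ((hM _ hp).trans (le_abs_self _)).trans (le_add_of_nonneg_right (abs_nonneg _))
    · have := hM' ((n:ℤ) - i).toNat (by omega)
      rw [Int.toNat_of_nonneg (by omega)] at this
      exact (this.trans (le_abs_self _)).trans (le_add_of_nonneg_left (abs_nonneg _))
  induction K with
  | zero => exact key
  | succ K ih =>
    intro f hf hM
    have h0 := key (HExp.toZero sB hf) hM
    obtain ⟨c, hc⟩ := SExp.succ_iff.1 hf
    set f1 : ℤ → ℝ := fun p => if 1 ≤ p then (p:ℝ) * (f p - c) else 0 with hf1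
    have h1 : SExp K (fun n => f1 n) := hc.congr (fun n hn => by
      have : (1:ℤ) ≤ n := by exact_mod_cast hn
      simp [hf1, this])
    have h2 := ih h1 ⟨0, fun p hp => by
      have : ¬ (1 ≤ p) := by omega
      simp [hf1, this]⟩
    have hcb : PBB (fun i : ℤ => 1 + |(i:ℝ)|) (fun _ => |c|) :=
      ⟨fun i => by positivity, |c|, 0, by positivity, fun i => by simp⟩
    refine ⟨fun _ => c, ⟨fun _ => |c|, hcb, fun _ => le_rfl⟩, ?_⟩
    have h3 := HExp.mul hB (PBB.mul one_le_phiZ) h2 (ratio_exp K)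
    have hbI : PBB (fun i : ℤ => 1 + |(i:ℝ)|) (fun i => |(i:ℝ)|) :=
      ⟨fun i => by positivity, 1, 1, by norm_num, fun i => by simp⟩
    have hlg : HExp (PBB (fun i : ℤ => 1 + |(i:ℝ)|)) (K+1) (fun n i => f ((n:ℤ) - i)) := by
      have h4 := (HExp.const hB hcb (c := fun _ => c) (fun _ => le_rfl) (K+1)).add hB
        (HExp.div_nat hB h3)
      refine HExp.congr_large (M := fun i : ℤ => |(i:ℝ)|) one_le_phiZ hbI h4 h0 ?_
      intro n i hn hi
      have hlt : (i:ℝ) < n := (le_abs_self _).trans_lt hi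
      have : (n:ℝ) - i ≠ 0 := by linarith
      have hn0 : (n:ℝ) ≠ 0 := by positivity
      have hi' : i < n := by exact_mod_cast hlt
      have : (1:ℤ) ≤ n - i := by omega
      simp only [hf1, if_pos this]
      push_cast
      field_simp
      ring
    refine HExp.shift_of_tendsto hB hlg (fun i => ?_)
    have ht : Tendsto (fun n : ℕ => f n) atTop (nhds c) := SExp.tendsto hc
    have hsub : Tendsto (fun n : ℕ => ((n:ℤ) - i).toNat) atTop atTop := by
      refine tendsto_atTop.2 fun b => ?_
      filter_upwards [eventually_ge_atTop ((b:ℤ) + i).toNat] with n hn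
      omega
    refine (ht.comp hsub).congr' ?_
    filter_upwards [eventually_ge_atTop i.toNat] with n hn
    simp only [Function.comp]
    rw [Int.toNat_of_nonneg (by omega)]

theorem SExp.succ_shift {K : ℕ} {f : ℕ → ℝ} (h : SExp K f) : SExp K (fun n => f (n + 1)) := by
  have h1 := shiftZ (f := fun p : ℤ => f p.toNat) (by simpa using h)
    ⟨|f 0|, fun p hp => by rw [Int.toNat_of_nonpos hp]⟩
  have h2 := HExp.subst (ψ := fun _ : Unit => (1:ℝ)) one_le_phiZ (fun _ => -1) ⟨2, by norm_num, by
    intro _; norm_num⟩ h1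
  refine HExp.congr h2 fun n hn _ => ?_
  have : ((n:ℤ) - -1).toNat = n + 1 := by omega
  simp [this]

theorem SExp.pred_shift {K : ℕ} {f : ℕ → ℝ} (h : SExp K f) : SExp K (fun n => f (n - 1)) := by
  have h1 := shiftZ (f := fun p : ℤ => f p.toNat) (by simpa using h)
    ⟨|f 0|, fun p hp => by rw [Int.toNat_of_nonpos hp]⟩
  have h2 := HExp.subst (ψ := fun _ : Unit => (1:ℝ)) one_le_phiZ (fun _ => 1) ⟨2, by norm_num, by
    intro _; norm_num⟩ h1
  refine HExp.congr h2 fun n hn _ => ?_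
  have : ((n:ℤ) - 1).toNat = n - 1 := by omega
  simp [this]

/-- differences of expandable sequences are `O(n^{-2})` -/
theorem SExp.diff {f : ℕ → ℝ} (h : SExp 2 f) : ∃ C, ∀ n : ℕ, 1 ≤ n →
    |f n - f (n + 1)| ≤ C / (n:ℝ) ^ 2 := by
  obtain ⟨c, h1⟩ := SExp.succ_iff.1 h
  obtain ⟨c1, h2⟩ := SExp.succ_iff.1 h1
  obtain ⟨M, hM⟩ := SExp.zero_iff.1 h2
  refine ⟨|c1| + 2 * M, fun n hn => ?_⟩
  have a1 := hM n hn
  have a2 := hM (n + 1) (by omega)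
  have hn0 : (0:ℝ) < n := by exact_mod_cast hn
  have hM0 : 0 ≤ M := (abs_nonneg _).trans a1
  set g : ℕ → ℝ := fun n => (n:ℝ) * ((n:ℝ) * (f n - c) - c1) with hg
  have e : ∀ m : ℕ, 1 ≤ m → f m = c + c1 / m + g m / (m:ℝ)^2 := by
    intro m hm
    have : (m:ℝ) ≠ 0 := by positivity
    simp only [hg]; field_simp; ring
  rw [e n hn, e (n + 1) (by omega)]
  have e1 : c + c1 / (n:ℝ) + g n / (n:ℝ) ^ 2 - (c + c1 / ((n + 1 : ℕ):ℝ) + g (n + 1) / ((n + 1 : ℕ):ℝ) ^ 2)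
      = c1 / (n * (n + 1)) + g n / (n:ℝ)^2 - g (n + 1) / ((n + 1 : ℕ):ℝ) ^ 2 := by
    push_cast; field_simp; ring
  rw [e1]
  have b1 : |c1 / ((n:ℝ) * (n + 1))| ≤ |c1| / (n:ℝ)^2 := by
    rw [abs_div, abs_of_pos (by positivity : 0 < (n:ℝ) * (n+1))]
    gcongr
    nlinarith
  have b2 : |g n / (n:ℝ)^2| ≤ M / (n:ℝ)^2 := by
    rw [abs_div, abs_of_pos (by positivity : 0 < (n:ℝ)^2)]
    gcongr
  have b3 : |g (n + 1) / ((n + 1 : ℕ):ℝ) ^ 2| ≤ M / (n:ℝ)^2 := by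
    rw [abs_div, abs_of_pos (by positivity : 0 < ((n + 1 : ℕ):ℝ) ^ 2)]
    refine div_le_div₀ hM0 a2 (by positivity) ?_
    gcongr; simp
  calc _ ≤ |c1| / (n:ℝ)^2 + M / (n:ℝ)^2 + M / (n:ℝ)^2 :=
        (abs_sub _ _).trans (add_le_add ((abs_add_le _ _).trans (add_le_add b1 b2)) b3)
    _ = _ := by ring

theorem SExp.all_succ {f : ℕ → ℝ} (h : ∀ K, SExp K f) :
    ∃ c, ∀ K, SExp K (fun n => (n:ℝ) * (f n - c)) := by
  obtain ⟨c, hc⟩ := SExp.succ_iff.1 (h 1)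
  exact ⟨c, fun K => (h (K+1)).shift_of_tendsto (SExp.tendsto hc)⟩

/-- the full expansion -/
theorem SExp.full {f : ℕ → ℝ} (h : ∀ K, SExp K f) :
    ∃ c : ℕ → ℝ, ∀ K, ∃ C, ∀ n : ℕ, 1 ≤ n →
      |f n - ∑ k ∈ Finset.range K, c k / (n:ℝ) ^ k| ≤ C / (n:ℝ) ^ K := by
  have hex : ∀ f : ℕ → ℝ, (∀ K, SExp K f) → ∃ c, ∀ K, SExp K (fun n => (n:ℝ) * (f n - c)) :=
    fun f hf => SExp.all_succ hf
  choose! nx hnx using hex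
  let F : ℕ → (ℕ → ℝ) := fun k => Nat.rec f (fun _ g => fun n => (n:ℝ) * (g n - nx g)) k
  have hF : ∀ k, ∀ K, SExp K (F k) := by
    intro k
    induction k with
    | zero => exact h
    | succ k ih => exact hnx _ ih
  have hs : ∀ K, ∀ n : ℕ, 1 ≤ n →
      f n - ∑ k ∈ Finset.range K, nx (F k) / (n:ℝ) ^ k = F K n / (n:ℝ) ^ K := by
    intro K n hn
    have hn0 : (n:ℝ) ≠ 0 := by positivity
    induction K with
    | zero => simp [F]
    | succ K ih =>
      have e : F (K+1) n = (n:ℝ) * (F K n - nx (F K)) := rfl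
      rw [Finset.sum_range_succ, ← sub_sub, ih, e]
      field_simp
      try ring
  refine ⟨fun k => nx (F k), fun K => ?_⟩
  obtain ⟨M, hM⟩ := SExp.zero_iff.1 (hF K 0)
  refine ⟨M, fun n hn => ?_⟩
  rw [hs K n hn, abs_div, abs_of_pos (by positivity : (0:ℝ) < (n:ℝ)^K)]
  gcongr
  exact hM n hn

/-- the form used in the theorem -/
theorem SExp.final {f : ℕ → ℝ} (h : ∀ K, SExp K f) {L : ℝ}
    (hL : ∃ C, ∀ n : ℕ, 1 ≤ n → |f n - L| ≤ C / (n:ℝ) ^ 2) :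
    ∃ A : ℕ → ℝ, ∀ l : ℕ, 1 ≤ l → ∃ C, ∀ n : ℕ, 1 ≤ n →
      |f n - L - ∑ k ∈ Finset.Icc 2 l, A k / (n:ℝ) ^ k| ≤ C / (n:ℝ) ^ (l + 1) := by
  obtain ⟨c, hc⟩ := SExp.full h
  obtain ⟨C0, hC0⟩ := hL
  obtain ⟨C2, hC2⟩ := hc 2
  have key : ∀ n : ℕ, 1 ≤ n → |(n:ℝ) * (L - c 0) - c 1| ≤ (C0 + C2) / n := by
    intro n hn
    have hn0 : (0:ℝ) < n := by exact_mod_cast hn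
    have a := hC0 n hn
    have b := hC2 n hn
    simp only [Finset.sum_range_succ, Finset.sum_range_zero, pow_zero, pow_one, zero_add] at b
    have : |L - c 0 - c 1 / n| ≤ (C0 + C2) / (n:ℝ)^2 := by
      calc |L - c 0 - c 1 / n| = |(f n - (c 0 / 1 + c 1 / n)) - (f n - L)| := by ring_nf
        _ ≤ C2 / (n:ℝ)^2 + C0 / (n:ℝ)^2 := (abs_sub _ _).trans (add_le_add b a)
        _ = _ := by ring
    have e : (n:ℝ) * (L - c 0) - c 1 = n * (L - c 0 - c 1 / n) := by field_simp
    rw [e, abs_mul, abs_of_pos hn0]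
    calc (n:ℝ) * |L - c 0 - c 1 / n| ≤ n * ((C0 + C2) / (n:ℝ)^2) := by gcongr
      _ = _ := by field_simp
  have t1 : Tendsto (fun n : ℕ => (n:ℝ) * (L - c 0) - c 1) atTop (nhds 0) := by
    refine squeeze_zero_norm' ?_ (tendsto_const_div_atTop_nhds_zero_nat (C0 + C2))
    filter_upwards [eventually_ge_atTop 1] with n hn using key n hn
  have t2 : Tendsto (fun n : ℕ => (L - c 0)) atTop (nhds 0) := by
    have := (t1.add_const (c 1)).mul (tendsto_one_div_atTop_nhds_zero_nat (𝕜 := ℝ))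
    rw [mul_zero] at this
    refine this.congr' ?_
    filter_upwards [eventually_ge_atTop 1] with n hn
    have hn0 : (n:ℝ) ≠ 0 := by positivity
    field_simp
    ring
  have e0 : L - c 0 = 0 := tendsto_nhds_unique tendsto_const_nhds t2
  have e1 : c 1 = 0 := by
    rw [e0] at t1
    have : Tendsto (fun n : ℕ => -c 1) atTop (nhds 0) := by simpa using t1
    have := tendsto_nhds_unique tendsto_const_nhds this
    linarith
  refine ⟨c, fun l hl => ?_⟩
  obtain ⟨C, hC⟩ := hc (l + 1)
  refine ⟨C, fun n hn => ?_⟩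
  have := hC n hn
  have hsum : ∑ k ∈ Finset.range (l + 1), c k / (n:ℝ) ^ k
      = L + ∑ k ∈ Finset.Icc 2 l, c k / (n:ℝ) ^ k := by
    rw [Finset.range_eq_Ico, Finset.sum_eq_sum_Ico_succ_bot (by omega),
      Finset.sum_eq_sum_Ico_succ_bot (by omega), e1]
    have : Finset.Ico (0 + 1 + 1) (l + 1) = Finset.Icc 2 l := by
      ext k; simp only [Finset.mem_Ico, Finset.mem_Icc]; omega
    rw [this]
    have : c 0 = L := by linarith
    simp [this]
  rw [hsum] at this
  rwa [sub_sub]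


/-! ### the discrete wave equation -/

/-- sum over the domain of dependence -/
def waveW (N : ℕ) (f : ℤ → ℝ) (p : ℤ) : ℝ := ∑ l ∈ Finset.range N, f (p + N - 1 - 2 * l)

theorem waveW_zero (f : ℤ → ℝ) (p : ℤ) : waveW 0 f p = 0 := by simp [waveW]

theorem waveW_one (f : ℤ → ℝ) (p : ℤ) : waveW 1 f p = f p := by simp [waveW]

theorem waveW_rec (N : ℕ) (f : ℤ → ℝ) (p : ℤ) :
    waveW (N + 2) f p + waveW N f p = waveW (N + 1) f (p + 1) + waveW (N + 1) f (p - 1) := by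
  have h1 : waveW (N + 2) f p = waveW (N + 1) f (p + 1) + f (p - N - 1) := by
    unfold waveW
    rw [Finset.sum_range_succ _ (N + 1)]
    congr 1
    · refine Finset.sum_congr rfl fun l _ => ?_
      congr 1; push_cast; ring
    · congr 1; push_cast; ring
  have h2 : waveW (N + 1) f (p - 1) = waveW N f p + f (p - N - 1) := by
    unfold waveW
    rw [Finset.sum_range_succ]
    congr 1
    · refine Finset.sum_congr rfl fun l _ => ?_
      congr 1; push_cast; ring
    · congr 1; push_cast; ring
  rw [h1, h2]; ring

theorem duhamel (t S : ℕ → ℤ → ℝ)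
    (h : ∀ m p, t (m + 2) p = t (m + 1) (p + 1) + t (m + 1) (p - 1) + S (m + 1) p - t m p) (m : ℕ) :
    ∀ p, t (m + 1) p = waveW (m + 1) (t 1) p - waveW m (t 0) p
      + ∑ s ∈ Finset.range m, waveW (m - s) (S (s + 1)) p := by
  induction m using Nat.strong_induction_on with
  | _ m ih =>
    intro p
    match m, ih with
    | 0, _ => simp [waveW_zero, waveW_one]
    | 1, _ =>
      have := waveW_rec 0 (t 1) p
      simp only [zero_add, waveW_one, waveW_zero] at this
      simp only [Finset.sum_range_one, waveW_one, Nat.sub_zero]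
      have h0 := h 0 p
      simp only [zero_add] at h0
      rw [h0]; linarith
    | (m + 2), ih =>
      have h0 := h (m + 1) p
      rw [h0, ih (m + 1) (by omega) (p + 1), ih (m + 1) (by omega) (p - 1), ih m (by omega) p]
      have e1 := waveW_rec (m + 1) (t 1) p
      have e2 := waveW_rec m (t 0) p
      rw [Finset.sum_range_succ _ (m + 1), Finset.sum_range_succ _ m, Finset.sum_range_succ _ m,
        Finset.sum_range_succ _ m]
      have e3 : ∑ s ∈ Finset.range m, waveW (m + 2 - s) (S (s + 1)) p
          + ∑ s ∈ Finset.range m, waveW (m - s) (S (s + 1)) p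
          = ∑ s ∈ Finset.range m, waveW (m + 1 - s) (S (s + 1)) (p + 1)
          + ∑ s ∈ Finset.range m, waveW (m + 1 - s) (S (s + 1)) (p - 1) := by
        rw [← Finset.sum_add_distrib, ← Finset.sum_add_distrib]
        refine Finset.sum_congr rfl fun s hs => ?_
        have hs' := Finset.mem_range.1 hs
        have := waveW_rec (m - s) (S (s + 1)) p
        rw [show m + 2 - s = m - s + 2 by omega, show m + 1 - s = m - s + 1 by omega]
        exact this
      have e4 := waveW_rec 0 (S (m + 1)) p
      simp only [zero_add, waveW_zero] at e4
      rw [show m + 2 - (m + 1) = 1 by omega, show m + 2 - m = 2 by omega,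
        show m + 1 - m = 1 by omega, waveW_one (S (m + 1 + 1))]
      linarith

/-- parameters `(m,i,j)` -/
abbrev X3 := ℕ × ℤ × ℤ

/-- the weight on the parameters -/
def phi3 (x : X3) : ℝ := 1 + x.1 + |(x.2.1 : ℝ)| + |(x.2.2 : ℝ)|

theorem one_le_phi3 (x : X3) : 1 ≤ phi3 x := by
  unfold phi3
  have := abs_nonneg (x.2.1:ℝ)
  have := abs_nonneg (x.2.2:ℝ)
  have : (0:ℝ) ≤ x.1 := by positivity
  linarith

theorem wave_exp (a b : ℤ → ℝ) (t : ℕ → ℤ → ℤ → ℝ)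
    (ha : ∀ K, SExp K (fun n => a n)) (ha0 : ∀ p ≤ 0, a p = 0)
    (hb : ∀ K, SExp K (fun n => b n)) (hb0 : ∃ M, ∀ p ≤ 0, |b p| ≤ M)
    (hal : Tendsto (fun n : ℕ => a n) atTop (nhds (1/2)))
    (hbl : Tendsto (fun n : ℕ => b n) atTop (nhds 0))
    (ht0 : ∀ p q, t 0 p q = if p = q ∧ 0 ≤ p then 1 else 0)
    (ht1 : ∀ p q, t 1 p q = a (p + 1) * t 0 (p + 1) q + b p * t 0 p q + a p * t 0 (p - 1) q)
    (hrec : ∀ m p q, t (m + 2) p q = 2 * a (p + 1) * t (m + 1) (p + 1) q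
      + 2 * b p * t (m + 1) p q + 2 * a p * t (m + 1) (p - 1) q - t m p q)
    (hbd : ∀ m p q, |t m p q| ≤ 1) (K : ℕ) :
    HExp (PBB phi3) K (fun n (x : X3) => t x.1 ((n:ℤ) - x.2.1) ((n:ℤ) - x.2.2)) := by
  have hB := PBB.bcl one_le_phi3
  have hBZ := PBB.bcl one_le_phiZ
  have hone : PBB phi3 (fun _ => 1) := ⟨fun _ => by norm_num, 1, 0, by norm_num, fun _ => by simp⟩
  -- coefficients
  have hAZ : ∀ K, HExp (PBB (fun i : ℤ => 1 + |(i:ℝ)|)) K (fun n i => a ((n:ℤ) - i)) :=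
    fun K => shiftZ (ha K) ⟨0, fun p hp => by simp [ha0 p hp]⟩
  have hBZ' : ∀ K, HExp (PBB (fun i : ℤ => 1 + |(i:ℝ)|)) K (fun n i => b ((n:ℤ) - i)) :=
    fun K => shiftZ (hb K) hb0
  have hsub : ∀ i : ℤ, Tendsto (fun n : ℕ => ((n:ℤ) - i).toNat) atTop atTop := by
    intro i
    refine tendsto_atTop.2 fun b => ?_
    filter_upwards [eventually_ge_atTop ((b:ℤ) + i).toNat] with n hn
    omega
  have hshl : ∀ (f : ℤ → ℝ) (L : ℝ), Tendsto (fun n : ℕ => f n) atTop (nhds L) → ∀ i : ℤ,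
      Tendsto (fun n : ℕ => f ((n:ℤ) - i)) atTop (nhds L) := by
    intro f L hf i
    refine (hf.comp (hsub i)).congr' ?_
    filter_upwards [eventually_ge_atTop i.toNat] with n hn
    simp only [Function.comp]
    rw [Int.toNat_of_nonneg (by omega)]
  have hA1 : ∀ K, HExp (PBB (fun i : ℤ => 1 + |(i:ℝ)|)) K
      (fun n i => (n:ℝ) * (a ((n:ℤ) - i) - 1/2)) := fun K =>
    HExp.shift_of_tendsto (c := fun _ => 1/2) hBZ (hAZ (K+1)) (hshl a _ hal)
  have hB1 : ∀ K, HExp (PBB (fun i : ℤ => 1 + |(i:ℝ)|)) K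
      (fun n i => (n:ℝ) * (b ((n:ℤ) - i) - 0)) := fun K =>
    HExp.shift_of_tendsto (c := fun _ => 0) hBZ (hBZ' (K+1)) (hshl b _ hbl)
  -- substitution helper
  have hsubZ : ∀ {K : ℕ} {f : ℕ → ℤ → ℝ}, HExp (PBB (fun i : ℤ => 1 + |(i:ℝ)|)) K f → ∀ r : ℤ,
      |(r:ℝ)| ≤ 1 → HExp (PBB phi3) K (fun n (x : X3) => f n (x.2.1 + r)) := by
    intro K f hf r hr
    refine HExp.subst one_le_phiZ (fun x : X3 => x.2.1 + r) ⟨2, by norm_num, fun x => ?_⟩ hf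
    unfold phi3
    push_cast
    have h1 := abs_add_le (x.2.1:ℝ) r
    have := abs_nonneg (x.2.1:ℝ)
    have := abs_nonneg (x.2.2:ℝ)
    have : (0:ℝ) ≤ x.1 := by positivity
    linarith
  have hsub3 : ∀ {K : ℕ} {f : ℕ → X3 → ℝ}, HExp (PBB phi3) K f → ∀ r : ℤ,
      |(r:ℝ)| ≤ 1 → HExp (PBB phi3) K (fun n (x : X3) => f n (x.1, x.2.1 + r, x.2.2)) := by
    intro K f hf r hr
    refine HExp.subst one_le_phi3 (fun x : X3 => (x.1, x.2.1 + r, x.2.2))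
      ⟨2, by norm_num, fun x => ?_⟩ hf
    unfold phi3
    push_cast
    have h1 := abs_add_le (x.2.1:ℝ) r
    have := abs_nonneg (x.2.1:ℝ)
    have := abs_nonneg (x.2.2:ℝ)
    have : (0:ℝ) ≤ x.1 := by positivity
    linarith
  have r0 : |((0:ℤ):ℝ)| ≤ 1 := by simp
  have r1 : |((1:ℤ):ℝ)| ≤ 1 := by simp
  have rm : |((-1:ℤ):ℝ)| ≤ 1 := by simp
  -- t 0
  have hT0 : ∀ K, HExp (PBB phi3) K (fun n (x : X3) => t 0 ((n:ℤ) - x.2.1) ((n:ℤ) - x.2.2)) := by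
    intro K
    have hc : HExp (PBB phi3) K (fun _ (x : X3) => if x.2.1 = x.2.2 then 1 else 0) :=
      HExp.const hB hone (c := fun x : X3 => if x.2.1 = x.2.2 then 1 else 0)
        (fun x => by by_cases h : x.2.1 = x.2.2 <;> simp [h]) K
    refine HExp.congr_large (M := fun x : X3 => |(x.2.1:ℝ)|) one_le_phi3 ⟨fun x => abs_nonneg _, 1, 1,
      by norm_num, fun x => ?_⟩ hc ⟨_, hone, fun n hn x => hbd _ _ _⟩ ?_
    · unfold phi3
      have := abs_nonneg (x.2.2:ℝ)
      have : (0:ℝ) ≤ x.1 := by positivity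
      simp only [pow_one, one_mul]
      linarith
    · intro n x hn hx
      have h1 : (x.2.1:ℝ) < n := (le_abs_self _).trans_lt hx
      have h2 : x.2.1 < n := by exact_mod_cast h1
      rw [ht0]
      by_cases h : x.2.1 = x.2.2
      · rw [if_pos h, if_pos ⟨by rw [h], by omega⟩]
      · rw [if_neg h, if_neg]
        rintro ⟨h3, _⟩
        apply h; omega
  have hmul := fun {K : ℕ} {f g : ℕ → X3 → ℝ} (hf : HExp (PBB phi3) K f) (hg : HExp (PBB phi3) K g) =>
    HExp.mul hB (PBB.mul one_le_phi3) hf hg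
  have hT1 : ∀ K, HExp (PBB phi3) K (fun n (x : X3) => t 1 ((n:ℤ) - x.2.1) ((n:ℤ) - x.2.2)) := by
    intro K
    have h1 := hmul (hsubZ (hAZ K) (-1) rm) (hsub3 (hT0 K) (-1) rm)
    have h2 := hmul (hsubZ (hBZ' K) 0 r0) (hsub3 (hT0 K) 0 r0)
    have h3 := hmul (hsubZ (hAZ K) 0 r0) (hsub3 (hT0 K) 1 r1)
    refine ((h1.add hB h2).add hB h3).congr fun n hn x => ?_
    rw [ht1]
    simp only [add_zero]
    rw [show (n:ℤ) - (x.2.1 + -1) = n - x.2.1 + 1 by ring,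
      show (n:ℤ) - (x.2.1 + 1) = n - x.2.1 - 1 by ring]
  -- the source
  set S : ℕ → ℤ → ℤ → ℝ := fun m p q => 2 * (a (p + 1) - 1/2) * t m (p + 1) q
      + 2 * b p * t m p q + 2 * (a p - 1/2) * t m (p - 1) q with hS
  have hD : ∀ m p q, t (m + 1) p q = waveW (m + 1) (fun p => t 1 p q) p - waveW m (fun p => t 0 p q) p
      + ∑ s ∈ Finset.range m, waveW (m - s) (fun p => S (s + 1) p q) p := by
    intro m p q
    refine duhamel (fun m p => t m p q) (fun m p => S m p q) (fun m p => ?_) m p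
    simp only [hS]
    rw [hrec]; ring
  -- first two Duhamel terms
  have hW : ∀ K (f : ℕ → X3 → ℝ), HExp (PBB phi3) K f →
      HExp (PBB phi3) K (fun n (x : X3) => ∑ l ∈ Finset.range x.1,
        f n (0, x.2.1 - x.1 + 1 + 2 * l, x.2.2)) := by
    intro K f hf
    refine HExp.sum one_le_phi3 one_le_phi3 (fun (x : X3) (l : ℕ) => ((0, x.2.1 - x.1 + 1 + 2 * l, x.2.2) : X3))
      (fun x => x.1) (fun x => ?_) ⟨6, by norm_num, fun x l hl => ?_⟩ hf
    · unfold phi3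
      have := abs_nonneg (x.2.1:ℝ)
      have := abs_nonneg (x.2.2:ℝ)
      linarith
    · unfold phi3
      have hl' : (l:ℝ) ≤ x.1 := by exact_mod_cast hl.le
      have := abs_nonneg (x.2.1:ℝ)
      have := abs_nonneg (x.2.2:ℝ)
      have hx0 : (0:ℝ) ≤ x.1 := by positivity
      have hl0 : (0:ℝ) ≤ l := by positivity
      have : |((x.2.1 - x.1 + 1 + 2 * l : ℤ) : ℝ)| ≤ |(x.2.1:ℝ)| + x.1 + 1 + 2 * l := by
        push_cast
        rw [abs_le]
        have := neg_abs_le (x.2.1:ℝ)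
        have := le_abs_self (x.2.1:ℝ)
        constructor <;> linarith
      simp only [Nat.cast_zero]
      linarith
  have hSucc : ∀ {K : ℕ} {f : ℕ → X3 → ℝ}, HExp (PBB phi3) K f →
      HExp (PBB phi3) K (fun n (x : X3) => f n (x.1 + 1, x.2.1, x.2.2)) := by
    intro K f hf
    refine HExp.subst one_le_phi3 (fun x : X3 => (x.1 + 1, x.2.1, x.2.2))
      ⟨2, by norm_num, fun x => ?_⟩ hf
    unfold phi3
    push_cast
    have := abs_nonneg (x.2.1:ℝ)
    have := abs_nonneg (x.2.2:ℝ)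
    have : (0:ℝ) ≤ x.1 := by positivity
    linarith
  induction K with
  | zero => exact ⟨_, hone, fun n hn x => hbd _ _ _⟩
  | succ K ih =>
    -- source expansion
    have hSrc : HExp (PBB phi3) (K + 1)
        (fun n (x : X3) => S x.1 ((n:ℤ) - x.2.1) ((n:ℤ) - x.2.2)) := by
      apply HExp.of_mul hB
      have h1 := hmul (hsubZ (hA1 K) (-1) rm) (hsub3 ih (-1) rm)
      have h2 := hmul (hsubZ (hB1 K) 0 r0) (hsub3 ih 0 r0)
      have h3 := hmul (hsubZ (hA1 K) 0 r0) (hsub3 ih 1 r1)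
      refine (((h1.add hB h2).add hB h3).smul hB 2).congr fun n hn x => ?_
      simp only [add_zero, hS]
      rw [show (n:ℤ) - (x.2.1 + -1) = n - x.2.1 + 1 by ring,
        show (n:ℤ) - (x.2.1 + 1) = n - x.2.1 - 1 by ring]
      ring
    have hSrc1 := hSucc hSrc
    -- inner sum
    let psi : X3 × ℕ → ℝ := fun z => phi3 z.1 + z.2
    have hpsi : ∀ z, 1 ≤ psi z := fun z => by
      have := one_le_phi3 z.1
      have : (0:ℝ) ≤ z.2 := by positivity
      simp only [psi]; linarith
    have hin := HExp.sum one_le_phi3 hpsi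
      (fun (z : X3 × ℕ) (l : ℕ) => ((z.2, z.1.2.1 - ((z.1.1 - z.2 : ℕ) : ℤ) + 1 + 2 * l, z.1.2.2) : X3))
      (fun z => z.1.1 - z.2) (fun z => by
        have h1 : ((z.1.1 - z.2 : ℕ):ℝ) ≤ z.1.1 := by exact_mod_cast Nat.sub_le _ _
        have := abs_nonneg (z.1.2.1:ℝ)
        have := abs_nonneg (z.1.2.2:ℝ)
        have : (0:ℝ) ≤ z.2 := by positivity
        simp only [psi, phi3]; linarith)
      ⟨6, by norm_num, fun z l hl => by
        have hl' : (l:ℝ) ≤ ((z.1.1 - z.2 : ℕ):ℝ) := by exact_mod_cast hl.le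
        have h1 : ((z.1.1 - z.2 : ℕ):ℝ) ≤ z.1.1 := by exact_mod_cast Nat.sub_le _ _
        have := abs_nonneg (z.1.2.1:ℝ)
        have := abs_nonneg (z.1.2.2:ℝ)
        have hx0 : (0:ℝ) ≤ z.1.1 := by positivity
        have hx1 : (0:ℝ) ≤ z.2 := by positivity
        have hl0 : (0:ℝ) ≤ l := by positivity
        have : |((z.1.2.1 - ((z.1.1 - z.2 : ℕ) : ℤ) + 1 + 2 * l : ℤ) : ℝ)|
            ≤ |(z.1.2.1:ℝ)| + ((z.1.1 - z.2 : ℕ):ℝ) + 1 + 2 * l := by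
          rw [Int.cast_add, Int.cast_add, Int.cast_sub, Int.cast_natCast]
          push_cast
          rw [abs_le]
          have := neg_abs_le (z.1.2.1:ℝ)
          have := le_abs_self (z.1.2.1:ℝ)
          constructor <;> linarith
        simp only [psi, phi3]
        linarith⟩ hSrc1
    have hout := HExp.sum hpsi one_le_phi3 (fun (x : X3) (s : ℕ) => ((x, s) : X3 × ℕ))
      (fun x => x.1) (fun x => by
        unfold phi3
        have := abs_nonneg (x.2.1:ℝ)
        have := abs_nonneg (x.2.2:ℝ)
        linarith) ⟨2, by norm_num, fun x s hs => by
        have hs' : (s:ℝ) ≤ x.1 := by exact_mod_cast hs.le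
        have := abs_nonneg (x.2.1:ℝ)
        have := abs_nonneg (x.2.2:ℝ)
        simp only [psi, phi3]; linarith⟩ hin
    have hsum := (((hSucc (hW (K+1) _ (hT1 (K+1)))).sub hB (hW (K+1) _ (hT0 (K+1)))).add hB hout)
    have hg : HExp (PBB phi3) (K+1)
        (fun n (x : X3) => t (x.1 + 1) ((n:ℤ) - x.2.1) ((n:ℤ) - x.2.2)) := by
      refine hsum.congr fun n hn x => ?_
      rw [hD]
      unfold waveW
      congr 1
      · congr 1
        · refine Finset.sum_congr rfl fun l _ => ?_
          congr 1; push_cast; ring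
        · refine Finset.sum_congr rfl fun l _ => ?_
          congr 1; ring
      · refine Finset.sum_congr rfl fun s _ => Finset.sum_congr rfl fun l _ => ?_
        simp only
        congr 1; ring
    have hp : HExp (PBB phi3) (K+1)
        (fun n (x : X3) => t (x.1 - 1 + 1) ((n:ℤ) - x.2.1) ((n:ℤ) - x.2.2)) := by
      refine HExp.subst one_le_phi3 (fun x : X3 => ((x.1 - 1, x.2.1, x.2.2) : X3))
        ⟨1, by norm_num, fun x => ?_⟩ hg
      unfold phi3
      have h1 : ((x.1 - 1 : ℕ):ℝ) ≤ x.1 := by exact_mod_cast Nat.sub_le _ _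
      simp only
      linarith
    have i0 : HExp (PBB phi3) (K+1) (fun _ (x : X3) => if x.1 = 0 then (1:ℝ) else 0) :=
      HExp.const hB hone (c := fun x : X3 => if x.1 = 0 then 1 else 0)
        (fun x => by by_cases h : x.1 = 0 <;> simp [h]) _
    have i1 : HExp (PBB phi3) (K+1) (fun _ (x : X3) => if x.1 = 0 then (0:ℝ) else 1) :=
      HExp.const hB hone (c := fun x : X3 => if x.1 = 0 then 0 else 1)
        (fun x => by by_cases h : x.1 = 0 <;> simp [h]) _
    refine ((hmul i0 (hT0 (K+1))).add hB (hmul i1 hp)).congr fun n hn x => ?_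
    by_cases h : x.1 = 0
    · simp [h]
    · have : x.1 - 1 + 1 = x.1 := by omega
      simp [h, this]


theorem polyexp_bdd {σ : ℝ} (h0 : 0 < σ) (h1 : σ < 1) (d : ℕ) :
    ∃ D : ℝ, 0 ≤ D ∧ ∀ j : ℕ, (1 + (j:ℝ)) ^ d * σ ^ j ≤ D := by
  have ht := tendsto_pow_const_mul_const_pow_of_abs_lt_one d (r := σ) (by rw [abs_of_pos h0]; exact h1)
  obtain ⟨M, hM⟩ := ht.bddAbove_range
  refine ⟨M / σ, ?_, fun j => ?_⟩
  · have := hM ⟨1, rfl⟩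
    have h2 : (0:ℝ) ≤ ((1:ℕ):ℝ) ^ d * σ ^ 1 := by positivity
    have : 0 ≤ M := h2.trans this
    positivity
  · rw [le_div_iff₀ h0]
    have := hM ⟨j + 1, rfl⟩
    simp only [pow_succ] at this
    push_cast at this
    rw [add_comm (1:ℝ)]
    linarith

theorem exists_sqrt_lt {σ : ℝ} (h0 : 0 < σ) (h1 : σ < 1) : ∃ r : ℝ, 0 < r ∧ r < 1 ∧ r * r = σ :=
  ⟨√σ, by positivity, by rw [Real.sqrt_lt' (by norm_num)]; simpa using h1,
    Real.mul_self_sqrt h0.le⟩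

theorem polyexp {σ : ℝ} (h0 : 0 < σ) (h1 : σ < 1) (d : ℕ) :
    ∃ D τ : ℝ, 0 ≤ D ∧ 0 < τ ∧ τ < 1 ∧ ∀ j : ℕ, (1 + (j:ℝ)) ^ d * σ ^ j ≤ D * τ ^ j := by
  obtain ⟨r, r0, r1, hr⟩ := exists_sqrt_lt h0 h1
  obtain ⟨D, hD, h⟩ := polyexp_bdd r0 r1 d
  refine ⟨D, r, hD, r0, r1, fun j => ?_⟩
  rw [← hr, mul_pow, ← mul_assoc]
  exact mul_le_mul_of_nonneg_right (h j) (by positivity)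

/-- exponentially decaying bounds -/
def VB (b : ℕ → ℝ) : Prop :=
  (∀ x, 0 ≤ b x) ∧ ∃ C σ : ℝ, 0 ≤ C ∧ 0 < σ ∧ σ < 1 ∧ ∀ i, b i ≤ C * σ ^ i

theorem VB.exp (C σ : ℝ) (hC : 0 ≤ C) (h0 : 0 < σ) (h1 : σ < 1) : VB (fun i => C * σ ^ i) :=
  ⟨fun _ => by positivity, C, σ, hC, h0, h1, fun _ => le_rfl⟩

theorem VB.bcl : BCl VB where
  add := by
    rintro b c ⟨hb0, C, σ, hC, h0, h1, hb⟩ ⟨hc0, C', σ', hC', h0', h1', hc⟩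
    refine ⟨fun x => add_nonneg (hb0 x) (hc0 x), C + C', max σ σ', by positivity, lt_max_of_lt_left h0,
      max_lt h1 h1', fun i => ?_⟩
    have e1 : σ ^ i ≤ max σ σ' ^ i := pow_le_pow_left₀ h0.le (le_max_left _ _) i
    have e2 : σ' ^ i ≤ max σ σ' ^ i := pow_le_pow_left₀ h0'.le (le_max_right _ _) i
    nlinarith [hb i, hc i, mul_le_mul_of_nonneg_left e1 hC, mul_le_mul_of_nonneg_left e2 hC']
  smul := by
    rintro r b hr ⟨hb0, C, σ, hC, h0, h1, hb⟩
    refine ⟨fun x => mul_nonneg hr (hb0 x), r * C, σ, by positivity, h0, h1, fun i => ?_⟩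
    rw [mul_assoc]
    exact mul_le_mul_of_nonneg_left (hb i) hr
  nonneg := fun b hb => hb.1
  ne := ⟨_, VB.exp 1 (1/2) (by norm_num) (by norm_num) (by norm_num)⟩

theorem VB.mul_nat {b : ℕ → ℝ} (hb : VB b) : VB (fun i => (1 + (i:ℝ)) * b i) := by
  obtain ⟨hb0, C, σ, hC, h0, h1, hb⟩ := hb
  obtain ⟨D, τ, hD, t0, t1, h⟩ := polyexp h0 h1 1
  refine ⟨fun x => mul_nonneg (by positivity) (hb0 x), C * D, τ, by positivity, t0, t1, fun i => ?_⟩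
  have := h i
  rw [pow_one] at this
  calc (1 + (i:ℝ)) * b i ≤ (1 + (i:ℝ)) * (C * σ ^ i) := mul_le_mul_of_nonneg_left (hb i) (by positivity)
    _ = C * ((1 + (i:ℝ)) * σ ^ i) := by ring
    _ ≤ C * (D * τ ^ i) := mul_le_mul_of_nonneg_left this hC
    _ = _ := by ring

/-- off-diagonal decaying kernels -/
def KB (θ : ℝ) (b : ℕ × ℕ → ℝ) : Prop :=
  (∀ x, 0 ≤ b x) ∧ ∃ (C : ℝ) (d : ℕ), 0 ≤ C ∧
    ∀ i j, b (i, j) ≤ C * (1 + (j:ℝ)) ^ d * θ ^ ((i:ℤ) - j).natAbs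

theorem KB.bcl {θ : ℝ} (hθ : 0 < θ) : BCl (KB θ) where
  add := by
    rintro b c ⟨hb0, C, d, hC, hb⟩ ⟨hc0, C', d', hC', hc⟩
    refine ⟨fun x => add_nonneg (hb0 x) (hc0 x), C + C', d + d', by positivity, fun i j => ?_⟩
    have hj : (1:ℝ) ≤ 1 + j := by have : (0:ℝ) ≤ j := by positivity
                                  linarith
    have h1 : (1 + (j:ℝ)) ^ d ≤ (1 + (j:ℝ)) ^ (d + d') := pow_le_pow_right₀ hj (by omega)
    have h2 : (1 + (j:ℝ)) ^ d' ≤ (1 + (j:ℝ)) ^ (d + d') := pow_le_pow_right₀ hj (by omega)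
    have h3 : (0:ℝ) ≤ θ ^ ((i:ℤ) - j).natAbs := by positivity
    calc b (i,j) + c (i,j) ≤ _ := add_le_add (hb i j) (hc i j)
      _ ≤ C * (1 + (j:ℝ)) ^ (d + d') * θ ^ ((i:ℤ) - j).natAbs
          + C' * (1 + (j:ℝ)) ^ (d + d') * θ ^ ((i:ℤ) - j).natAbs := by gcongr
      _ = _ := by ring
  smul := by
    rintro r b hr ⟨hb0, C, d, hC, hb⟩
    refine ⟨fun x => mul_nonneg hr (hb0 x), r * C, d, by positivity, fun i j => ?_⟩
    rw [mul_assoc, mul_assoc, ← mul_assoc C]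
    exact mul_le_mul_of_nonneg_left (hb i j) hr
  nonneg := fun b hb => hb.1
  ne := ⟨fun _ => 0, fun _ => le_rfl, 0, 0, le_rfl, fun i j => by simp⟩

/-- product bound for kernel applied to a vector -/
theorem KB.apply {θ : ℝ} (hθ : 0 < θ) (hθ1 : θ < 1) {b : ℕ × ℕ → ℝ} (hb : KB θ b) {v : ℕ → ℝ}
    (hv : VB v) : ∃ C ν : ℝ, 0 ≤ C ∧ 0 < ν ∧ ν < 1 ∧ ∀ i j, b (i, j) * v j ≤ C * ν ^ i * ν ^ j := by
  obtain ⟨hb0, C, d, hC, hb⟩ := hb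
  obtain ⟨hv0, D, σ, hD, s0, s1, hv⟩ := hv
  obtain ⟨E, τ, hE, t0, t1, h⟩ := polyexp s0 s1 d
  obtain ⟨ν, n0, n1, hν⟩ := exists_sqrt_lt (lt_max_of_lt_left hθ : 0 < max θ τ) (max_lt hθ1 t1)
  refine ⟨C * D * E, ν, by positivity, n0, n1, fun i j => ?_⟩
  set r := ((i:ℤ) - j).natAbs with hr
  have e1 : θ ^ r ≤ (max θ τ) ^ r := pow_le_pow_left₀ hθ.le (le_max_left _ _) _
  have e2 : τ ^ j ≤ (max θ τ) ^ j := pow_le_pow_left₀ t0.le (le_max_right _ _) _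
  have e3 : (max θ τ) ^ r * (max θ τ) ^ j ≤ ν ^ i * ν ^ j := by
    rw [← pow_add, ← hν, ← pow_two, ← pow_mul, ← pow_add]
    exact pow_le_pow_of_le_one n0.le n1.le (by omega)
  calc b (i,j) * v j ≤ (C * (1 + (j:ℝ)) ^ d * θ ^ r) * (D * σ ^ j) :=
        mul_le_mul (hb i j) (hv j) (hv0 j) (by positivity)
    _ = C * D * θ ^ r * ((1 + (j:ℝ)) ^ d * σ ^ j) := by ring
    _ ≤ C * D * θ ^ r * (E * τ ^ j) := mul_le_mul_of_nonneg_left (h j) (by positivity)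
    _ = C * D * E * (θ ^ r * τ ^ j) := by ring
    _ ≤ C * D * E * (ν ^ i * ν ^ j) := by
        refine mul_le_mul_of_nonneg_left (le_trans ?_ e3) (by positivity)
        exact mul_le_mul e1 e2 (by positivity) (by positivity)
    _ = _ := by ring

theorem KB.summable {θ : ℝ} (hθ : 0 < θ) (hθ1 : θ < 1) {b : ℕ × ℕ → ℝ} (hb : KB θ b) {v : ℕ → ℝ}
    (hv : VB v) {f : ℕ × ℕ → ℝ} {y : ℕ → ℝ} (hf : ∀ x, |f x| ≤ b x) (hy : ∀ j, |y j| ≤ v j) (i : ℕ) :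
    Summable (fun j => f (i, j) * y j) := by
  obtain ⟨C, ν, hC, n0, n1, h⟩ := hb.apply hθ hθ1 hv
  refine Summable.of_norm_bounded ((summable_geometric_of_lt_one n0.le n1).mul_left (C * ν ^ i)) ?_
  intro j
  rw [Real.norm_eq_abs, abs_mul]
  exact (mul_le_mul (hf _) (hy _) (abs_nonneg _) (hb.1 _)).trans (h i j)

theorem HExp.kernel_apply {θ : ℝ} (hθ : 0 < θ) (hθ1 : θ < 1) {v y : ℕ → ℝ} (hv : VB v)
    (hy : ∀ j, |y j| ≤ v j) {K : ℕ} {G : ℕ → ℕ × ℕ → ℝ} (hG : HExp (KB θ) K G) :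
    HExp VB K (fun n i => ∑' j, G n (i, j) * y j) := by
  refine HExp.map (KB.bcl hθ) (fun f i => ∑' j, f (i, j) * y j) ?_ ?_ hG
  · intro b hb
    obtain ⟨C, ν, hC, n0, n1, h⟩ := hb.apply hθ hθ1 hv
    refine ⟨_, VB.exp (C * (1 - ν)⁻¹) ν (mul_nonneg hC (inv_nonneg.2 (by linarith))) n0 n1, ?_⟩
    intro f hf i
    have := tsum_of_norm_bounded (f := fun j => f (i, j) * y j)
      ((hasSum_geometric_of_lt_one n0.le n1).mul_left (C * ν ^ i)) (by
        intro j
        rw [Real.norm_eq_abs, abs_mul]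
        exact (mul_le_mul (hf _) (hy _) (abs_nonneg _) (hb.1 _)).trans (h i j))
    rw [Real.norm_eq_abs] at this
    refine this.trans (le_of_eq (by ring))
  · intro r b f c hb hf hc i
    show ∑' j, r * (f (i, j) - c (i, j)) * y j = r * (∑' j, f (i, j) * y j - ∑' j, c (i, j) * y j)
    rw [← (KB.summable hθ hθ1 hb hv hf hy i).tsum_sub (KB.summable hθ hθ1 hb hv hc hy i), ← tsum_mul_left]
    congr 1; funext j; ring


theorem row_sum_le {g : ℕ → ℝ} {S : ℝ} (hg : ∀ r, 0 ≤ g r) (hS : HasSum g S) (i N : ℕ) :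
    ∑ j ∈ Finset.range N, g ((i:ℤ) - j).natAbs ≤ 2 * S := by
  have key : ∀ (s : Finset ℕ), (∀ a ∈ s, ∀ b ∈ s, ((i:ℤ) - a).natAbs = ((i:ℤ) - b).natAbs → a = b) →
      ∑ j ∈ s, g ((i:ℤ) - j).natAbs ≤ S := by
    intro s hs
    rw [← Finset.sum_image (f := g) (g := fun j : ℕ => ((i:ℤ) - j).natAbs) (s := s)
      (fun a ha b hb h => hs a ha b hb h)]
    exact sum_le_hasSum _ (fun r _ => hg r) hS
  rw [← Finset.sum_filter_add_sum_filter_not (Finset.range N) (fun j => j ≤ i)]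
  have h1 := key ((Finset.range N).filter (fun j => j ≤ i)) (by
    intro a ha b hb h; simp at ha hb; omega)
  have h2 := key ((Finset.range N).filter (fun j => ¬ j ≤ i)) (by
    intro a ha b hb h; simp at ha hb; omega)
  linarith

theorem schur_le {g : ℕ → ℝ} {S : ℝ} (hg : ∀ r, 0 ≤ g r) (hS : HasSum g S) (N : ℕ) (z : ℕ → ℝ) :
    ∑ i ∈ Finset.range N, ∑ j ∈ Finset.range N, |z i| * |z j| * g ((i:ℤ) - j).natAbs ≤
      2 * S * ∑ i ∈ Finset.range N, z i ^ 2 := by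
  have sym : ∀ i j : ℕ, ((i:ℤ) - j).natAbs = ((j:ℤ) - i).natAbs := fun i j => by omega
  have h1 : ∑ i ∈ Finset.range N, ∑ j ∈ Finset.range N, z i ^ 2 * g ((i:ℤ) - j).natAbs ≤
      2 * S * ∑ i ∈ Finset.range N, z i ^ 2 := by
    rw [Finset.mul_sum]
    refine Finset.sum_le_sum fun i _ => ?_
    rw [← Finset.mul_sum]
    nlinarith [row_sum_le hg hS i N, sq_nonneg (z i)]
  have h2 : ∑ i ∈ Finset.range N, ∑ j ∈ Finset.range N, z j ^ 2 * g ((i:ℤ) - j).natAbs ≤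
      2 * S * ∑ i ∈ Finset.range N, z i ^ 2 := by
    rw [Finset.sum_comm]
    simpa only [sym] using h1
  have h3 : ∑ i ∈ Finset.range N, ∑ j ∈ Finset.range N, |z i| * |z j| * g ((i:ℤ) - j).natAbs ≤
     ∑ i ∈ Finset.range N, ∑ j ∈ Finset.range N, (1/2 * (z i ^ 2 * g ((i:ℤ) - j).natAbs) +
       1/2 * (z j ^ 2 * g ((i:ℤ) - j).natAbs)) := by
    refine Finset.sum_le_sum fun i _ => Finset.sum_le_sum fun j _ => ?_
    have : |z i| * |z j| ≤ 1/2 * z i ^ 2 + 1/2 * z j ^ 2 := by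
      nlinarith [sq_nonneg (|z i| - |z j|), sq_abs (z i), sq_abs (z j)]
    nlinarith [hg ((i:ℤ) - j).natAbs]
  simp only [Finset.sum_add_distrib, ← Finset.mul_sum] at h1 h2 h3
  linarith

theorem one_sub_zpow_le {s : ℝ} (s0 : 0 < s) (s1 : s < 1) (i j : ℕ) :
    |1 - s ^ j / s ^ i| ≤ (s⁻¹) ^ ((i:ℤ) - j).natAbs - 1 := by
  rcases le_total i j with h | h
  · obtain ⟨r, rfl⟩ := Nat.exists_eq_add_of_le h
    have e : ((i:ℤ) - (i + r : ℕ)).natAbs = r := by omega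
    have e2 : s ^ (i + r) / s ^ i = s ^ r := by rw [pow_add]; field_simp
    have hp : 0 < s ^ r := by positivity
    have hp1 : s ^ r ≤ 1 := pow_le_one₀ s0.le s1.le
    rw [e, e2, abs_of_nonneg (by linarith), inv_pow]
    have : (s ^ r) * (s ^ r)⁻¹ = 1 := mul_inv_cancel₀ hp.ne'
    have : 0 < (s^r)⁻¹ := by positivity
    nlinarith [sq_nonneg (s ^ r - 1), sq_nonneg ((s^r)⁻¹ - 1)]
  · obtain ⟨r, rfl⟩ := Nat.exists_eq_add_of_le h
    have e : (((j + r : ℕ):ℤ) - j).natAbs = r := by omega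
    have e2 : s ^ j / s ^ (j + r) = (s⁻¹) ^ r := by rw [pow_add, inv_pow]; field_simp
    have : 1 ≤ (s⁻¹) ^ r := one_le_pow₀ ((one_le_inv₀ s0).2 s1.le)
    rw [e, e2, abs_sub_comm, abs_of_nonneg (by linarith)]

theorem combes_thomas {C θ c σ F : ℝ} (hC : 0 ≤ C) (hθ : 0 < θ) (hθ1 : θ < 1) (hc : 0 < c)
    (hσ : 0 < σ) (hσ1 : σ < 1) (hF : 0 ≤ F) :
    ∃ C' s : ℝ, 0 ≤ C' ∧ 0 < s ∧ s < 1 ∧ ∀ (n : ℕ) (G : ℕ → ℕ → ℝ) (y e : ℕ → ℝ),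
      (∀ i j, |G i j| ≤ C * θ ^ ((i:ℤ) - j).natAbs) →
      (∀ z : ℕ → ℝ, c * ∑ i ∈ Finset.range (n+1), z i ^ 2 ≤
        ∑ i ∈ Finset.range (n+1), ∑ j ∈ Finset.range (n+1), z i * G i j * z j) →
      (∀ i ≤ n, ∑ j ∈ Finset.range (n+1), G i j * y j = e i) →
      (∀ i, |e i| ≤ F * σ ^ i) → ∀ i ≤ n, |y i| ≤ C' * s ^ i := by
  have hlim : Tendsto (fun s : ℝ => 2 * (C * ((1 - θ * s⁻¹)⁻¹ - (1 - θ)⁻¹))) (nhds 1) (nhds 0) := by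
    have : ContinuousAt (fun s : ℝ => 2 * (C * ((1 - θ * s⁻¹)⁻¹ - (1 - θ)⁻¹))) 1 := by
      have h1 : ContinuousAt (fun s : ℝ => s⁻¹) 1 := continuousAt_inv₀ one_ne_zero
      have h2 : ContinuousAt (fun s : ℝ => (1 - θ * s⁻¹)⁻¹) 1 := by
        refine ContinuousAt.inv₀ (by fun_prop) ?_
        simp; linarith
      fun_prop
    have h := this.tendsto
    simpa using h
  obtain ⟨s, hs, hsσ, hsθ, hs1⟩ : ∃ s : ℝ, 2 * (C * ((1 - θ * s⁻¹)⁻¹ - (1 - θ)⁻¹)) < c / 2 ∧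
      σ < s ∧ θ < s ∧ s < 1 := by
    have e1 : ∀ᶠ s in nhdsWithin (1:ℝ) (Iio 1), 2 * (C * ((1 - θ * s⁻¹)⁻¹ - (1 - θ)⁻¹)) < c / 2 :=
      (hlim.eventually (gt_mem_nhds (by positivity))).filter_mono nhdsWithin_le_nhds
    have e2 : ∀ᶠ s in nhdsWithin (1:ℝ) (Iio 1), σ < s :=
      (lt_mem_nhds hσ1).filter_mono nhdsWithin_le_nhds
    have e3 : ∀ᶠ s in nhdsWithin (1:ℝ) (Iio 1), θ < s :=
      (lt_mem_nhds hθ1).filter_mono nhdsWithin_le_nhds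
    have e4 : ∀ᶠ s in nhdsWithin (1:ℝ) (Iio 1), s < 1 := eventually_mem_nhdsWithin
    exact (e1.and (e2.and (e3.and e4))).exists
  have s0 : 0 < s := hσ.trans hsσ
  set S := C * ((1 - θ * s⁻¹)⁻¹ - (1 - θ)⁻¹) with hSdef
  set g : ℕ → ℝ := fun r => C * ((θ * s⁻¹) ^ r - θ ^ r) with hg
  have hq : θ * s⁻¹ < 1 := by rw [← div_eq_mul_inv, div_lt_one s0]; exact hsθ
  have hgS : HasSum g S := by
    refine HasSum.mul_left C ?_
    exact (hasSum_geometric_of_lt_one (by positivity) hq).sub (hasSum_geometric_of_lt_one hθ.le hθ1)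
  have hge : ∀ r, g r = C * θ ^ r * ((s⁻¹) ^ r - 1) := fun r => by simp only [hg, mul_pow]; ring
  have hg0 : ∀ r, 0 ≤ g r := fun r => by
    rw [hge]
    have : 1 ≤ (s⁻¹) ^ r := one_le_pow₀ ((one_le_inv₀ s0).2 hs1.le)
    exact mul_nonneg (by positivity) (by linarith)
  set q := (σ / s) ^ 2 with hqd
  have q0 : 0 ≤ q := by positivity
  have q1 : q < 1 := by
    have : σ / s < 1 := (div_lt_one s0).2 hsσ
    have h0 : 0 < σ / s := by positivity
    rw [hqd]; nlinarith
  set M := 4 * F ^ 2 / c ^ 2 * (1 - q)⁻¹ with hM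
  have hM0 : 0 ≤ M := mul_nonneg (by positivity) (inv_nonneg.2 (by linarith))
  refine ⟨√M, s, Real.sqrt_nonneg _, s0, hs1, ?_⟩
  intro n G y e hG hform heq he i hi
  set R := Finset.range (n+1) with hR
  set z : ℕ → ℝ := fun i => y i / s ^ i with hz
  have hy : ∀ j, y j = z j * s ^ j := fun j => by
    simp only [hz]; field_simp
  have hid : ∑ i ∈ R, ∑ j ∈ R, z i * G i j * z j = ∑ i ∈ R, z i * (e i / s ^ i) +
      ∑ i ∈ R, ∑ j ∈ R, z i * G i j * z j * (1 - s ^ j / s ^ i) := by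
    rw [← Finset.sum_add_distrib]
    refine Finset.sum_congr rfl fun i hi => ?_
    rw [← heq i (by simp [hR] at hi; omega), Finset.sum_div, Finset.mul_sum, ← Finset.sum_add_distrib]
    refine Finset.sum_congr rfl fun j hj => ?_
    rw [hy j]; ring
  have b1 : ∑ i ∈ R, ∑ j ∈ R, z i * G i j * z j * (1 - s ^ j / s ^ i) ≤ 2 * S * ∑ i ∈ R, z i ^ 2 := by
    refine le_trans (Finset.sum_le_sum fun i _ => Finset.sum_le_sum fun j _ => ?_) (schur_le hg0 hgS (n+1) z)
    refine (le_abs_self _).trans ?_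
    rw [abs_mul, abs_mul, abs_mul, hge]
    have h1 := hG i j
    have h2 := one_sub_zpow_le s0 hs1 i j
    calc |z i| * |G i j| * |z j| * |1 - s ^ j / s ^ i|
        ≤ |z i| * (C * θ ^ ((i:ℤ) - j).natAbs) * |z j| * ((s⁻¹) ^ ((i:ℤ) - j).natAbs - 1) := by gcongr
      _ = _ := by ring
  have b2 : ∑ i ∈ R, z i * (e i / s ^ i) ≤ c / 4 * ∑ i ∈ R, z i ^ 2 + F ^ 2 / c * (1 - q)⁻¹ := by
    have : ∑ i ∈ R, z i * (e i / s ^ i) ≤ ∑ i ∈ R, (c / 4 * z i ^ 2 + F ^ 2 / c * q ^ i) := by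
      refine Finset.sum_le_sum fun i _ => ?_
      have h1 : (e i / s ^ i) ^ 2 ≤ F ^ 2 * q ^ i := by
        have h2 : |e i / s ^ i| ≤ F * (σ / s) ^ i := by
          rw [abs_div, abs_of_pos (pow_pos s0 i), div_pow, ← mul_div_assoc]
          exact div_le_div_of_nonneg_right (he i) (by positivity)
        rw [← sq_abs, hqd, ← pow_mul, mul_comm 2 i, pow_mul, ← mul_pow]
        exact pow_le_pow_left₀ (abs_nonneg _) h2 2
      have h3 : z i * (e i / s ^ i) ≤ c / 4 * z i ^ 2 + (e i / s ^ i) ^ 2 / c := by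
        have : c / 4 * z i ^ 2 + (e i / s ^ i) ^ 2 / c - z i * (e i / s ^ i)
          = (c * z i / 2 - e i / s ^ i) ^ 2 / c := by field_simp; ring
        have : 0 ≤ (c * z i / 2 - e i / s ^ i) ^ 2 / c := by positivity
        linarith
      have h4 : (e i / s ^ i) ^ 2 / c ≤ F ^ 2 * q ^ i / c := div_le_div_of_nonneg_right h1 hc.le
      have h5 : F ^ 2 * q ^ i / c = F ^ 2 / c * q ^ i := by ring
      linarith
    refine this.trans ?_
    rw [Finset.sum_add_distrib, ← Finset.mul_sum, ← Finset.mul_sum]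
    have := sum_le_hasSum R (fun i _ => pow_nonneg q0 i) (hasSum_geometric_of_lt_one q0 q1)
    have := mul_le_mul_of_nonneg_left this (show 0 ≤ F ^ 2 / c by positivity)
    linarith
  have hz0 : 0 ≤ ∑ i ∈ R, z i ^ 2 := Finset.sum_nonneg fun i _ => sq_nonneg _
  have hf := hform z
  have b3 : ∑ i ∈ R, z i ^ 2 ≤ M := by
    have h1 : c / 4 * ∑ i ∈ R, z i ^ 2 ≤ F ^ 2 / c * (1 - q)⁻¹ := by nlinarith
    have h2 : M = 4 / c * (F ^ 2 / c * (1 - q)⁻¹) := by rw [hM]; field_simp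
    have h3 : ∑ i ∈ R, z i ^ 2 = 4 / c * (c / 4 * ∑ i ∈ R, z i ^ 2) := by field_simp
    rw [h2, h3]
    exact mul_le_mul_of_nonneg_left h1 (by positivity)
  have b4 : z i ^ 2 ≤ M := le_trans (Finset.single_le_sum (f := fun i => z i ^ 2)
    (fun i _ => sq_nonneg _) (by simp [hR]; omega)) b3
  rw [hy i, abs_mul, abs_of_pos (pow_pos s0 i)]
  exact mul_le_mul_of_nonneg_right (Real.abs_le_sqrt b4) (by positivity)

/-- the solve lemma -/
theorem solve_exp {C θ c : ℝ} (hC : 0 ≤ C) (hθ : 0 < θ) (hθ1 : θ < 1) (hc : 0 < c)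
    (G : ℕ → ℕ × ℕ → ℝ) (hG : ∀ n i j, |G n (i, j)| ≤ C * θ ^ ((i:ℤ) - j).natAbs)
    (hG0 : ∀ n i j, n < i ∨ n < j → G n (i, j) = 0)
    (hform : ∀ n (z : ℕ → ℝ), c * ∑ i ∈ Finset.range (n+1), z i ^ 2 ≤
        ∑ i ∈ Finset.range (n+1), ∑ j ∈ Finset.range (n+1), z i * G n (i, j) * z j)
    (hGe : ∀ K, HExp (KB θ) K G) (K : ℕ) :
    ∀ (y e : ℕ → ℕ → ℝ), (∀ n, 1 ≤ n → ∀ i, ∑' j, G n (i, j) * y n j = e n i) →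
      HExp VB K e → (∃ b, VB b ∧ ∀ n, 1 ≤ n → ∀ i, n < i → |y n i| ≤ b i) → HExp VB K y := by
  have hfin : ∀ n i (y : ℕ → ℝ), ∑' j, G n (i, j) * y j = ∑ j ∈ Finset.range (n+1), G n (i,j) * y j := by
    intro n i y
    refine tsum_eq_sum fun j hj => ?_
    rw [hG0 n i j (Or.inr (by simpa using hj)), zero_mul]
  induction K with
  | zero =>
    rintro y e heq ⟨b, ⟨hb0, F, σ, hF, s0, s1, hb⟩, he⟩ ⟨b', hb', hy⟩
    obtain ⟨C', s, hC', hs0, hs1, hct⟩ := combes_thomas hC hθ hθ1 hc s0 s1 hF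
    refine ⟨_, VB.bcl.add _ _ (VB.exp C' s hC' hs0 hs1) hb', fun n hn i => ?_⟩
    have hp : 0 ≤ C' * s ^ i := by positivity
    have hq := hb'.1 i
    rcases Nat.lt_or_ge n i with h | h
    · have := hy n hn i h
      show |y n i| ≤ C' * s ^ i + b' i
      linarith
    · have := hct n (fun i j => G n (i, j)) (y n) (e n) (hG n) (hform n)
        (fun i _ => by rw [← heq n hn i, hfin]) (fun i => (he n hn i).trans (hb i)) i h
      show |y n i| ≤ C' * s ^ i + b' i
      linarith
  | succ K ih =>
    rintro y e heq he ⟨b', hb', hy⟩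
    have hB := VB.bcl
    -- bound for y
    have hy0 : HExp VB 0 y := by
      obtain ⟨b, ⟨hb0, F, σ, hF, s0, s1, hb⟩, he⟩ := he.toZero hB
      obtain ⟨C', s, hC', hs0, hs1, hct⟩ := combes_thomas hC hθ hθ1 hc s0 s1 hF
      refine ⟨_, VB.bcl.add _ _ (VB.exp C' s hC' hs0 hs1) hb', fun n hn i => ?_⟩
      have hp : 0 ≤ C' * s ^ i := by positivity
      have hq := hb'.1 i
      show |y n i| ≤ C' * s ^ i + b' i
      rcases Nat.lt_or_ge n i with h | h
      · have := hy n hn i h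
        linarith
      · have := hct n (fun i j => G n (i, j)) (y n) (e n) (hG n) (hform n)
          (fun i _ => by rw [← heq n hn i, hfin]) (fun i => (he n hn i).trans (hb i)) i h
        linarith
    obtain ⟨v, hv, hyv⟩ := hy0
    have hU : ((hyperfilter ℕ : Ultrafilter ℕ) : Filter ℕ) ≤ atTop := Nat.hyperfilter_le_atTop
    have hev : ∀ᶠ n in ((hyperfilter ℕ : Ultrafilter ℕ) : Filter ℕ), 1 ≤ n :=
      (eventually_ge_atTop 1).filter_mono hU
    have hlim : ∀ i, ∃ l ∈ Icc (-v i) (v i),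
        Tendsto (fun n => y n i) (hyperfilter ℕ : Ultrafilter ℕ) (nhds l) := by
      intro i
      obtain ⟨l, hl, h⟩ := (isCompact_Icc (a := -v i) (b := v i)).ultrafilter_le_nhds
        ((hyperfilter ℕ).map (fun n => y n i)) (by
          rw [Ultrafilter.coe_map, le_principal_iff, mem_map]
          filter_upwards [hev] with n hn
          exact abs_le.1 (hyv n hn i))
      exact ⟨l, hl, h⟩
    choose y0 hy0 hy0l using hlim
    have hy0v : ∀ i, |y0 i| ≤ v i := fun i => abs_le.2 (hy0 i)
    -- limit of G
    obtain ⟨G0, -, hG1⟩ := hGe 1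
    have hG0l := fun x => HExp.tendsto_of (KB.bcl hθ) hG1 x
    obtain ⟨bG, hbG, hGb⟩ := hGe 0
    obtain ⟨CC, ν, hCC, n0, n1, happ⟩ := hbG.apply hθ hθ1 hv
    have he' := he
    obtain ⟨e0, -, hee⟩ := he'
    have he0l := fun x => HExp.tendsto_of hB hee x
    have hdom : ∀ (l : Filter ℕ), l ≤ atTop → ∀ (u : ℕ → ℕ → ℝ), (∀ n, 1 ≤ n → ∀ j, |u n j| ≤ v j) →
        (∀ j, Tendsto (fun n => u n j) l (nhds (y0 j))) → ∀ i,
        Tendsto (fun n => ∑' j, G n (i, j) * u n j) l (nhds (∑' j, G0 (i, j) * y0 j)) := by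
      intro l hl u hu hul i
      refine tendsto_tsum_of_dominated_convergence (bound := fun j => CC * ν ^ i * ν ^ j)
        ((summable_geometric_of_lt_one n0.le n1).mul_left _) ?_ ?_
      · intro j
        exact ((hG0l (i, j)).mono_left hl).mul (hul j)
      · filter_upwards [(eventually_ge_atTop 1).filter_mono hl] with n hn j
        rw [Real.norm_eq_abs, abs_mul]
        exact (mul_le_mul (hGb n hn _) (hu n hn _) (abs_nonneg _) (hbG.1 _)).trans (happ i j)
    have hT : ∀ i, ∑' j, G0 (i, j) * y0 j = e0 i := by
      intro i
      refine tendsto_nhds_unique (hdom _ hU y hyv hy0l i) ?_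
      refine ((he0l i).mono_left hU).congr' ?_
      filter_upwards [hev] with n hn
      exact (heq n hn i).symm
    -- expansion of G y0
    have hg := HExp.kernel_apply hθ hθ1 hv hy0v (hGe (K + 1))
    have hgl : ∀ i, Tendsto (fun n => ∑' j, G n (i, j) * y0 j) atTop (nhds (e0 i)) := by
      intro i
      rw [← hT i]
      exact hdom atTop le_rfl (fun _ => y0) (fun _ _ => hy0v) (fun j => tendsto_const_nhds) i
    have hg1 := HExp.shift_of_tendsto hB hg hgl
    refine ⟨y0, ⟨v, hv, hy0v⟩, ?_⟩
    refine ih (fun n i => (n:ℝ) * (y n i - y0 i))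
      (fun n i => (n:ℝ) * (e n i - ∑' j, G n (i, j) * y0 j)) ?_ ?_ ?_
    · intro n hn i
      show ∑' j, G n (i, j) * ((n:ℝ) * (y n j - y0 j)) = (n:ℝ) * (e n i - ∑' j, G n (i, j) * y0 j)
      rw [← heq n hn i, hfin n i (y n), hfin n i y0, hfin n i, ← Finset.sum_sub_distrib, Finset.mul_sum]
      exact Finset.sum_congr rfl fun j _ => by ring
    · exact (hee.sub hB hg1).congr fun n hn i => by ring
    · refine ⟨_, (hB.add _ _ hb' hv).mul_nat, fun n hn i hi => ?_⟩
      show |(n:ℝ) * (y n i - y0 i)| ≤ (1 + (i:ℝ)) * (b' i + v i)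
      have hni : (n:ℝ) ≤ 1 + i := by
        have : (n:ℝ) ≤ i := by exact_mod_cast hi.le
        linarith
      rw [abs_mul, Nat.abs_cast]
      refine mul_le_mul hni ?_ (abs_nonneg _) (by positivity)
      exact (abs_sub _ _).trans (add_le_add (hy n hn i hi) (hy0v i))


def kerT (c : ℕ → ℝ) (f : X3 → ℝ) (x : ℕ × ℕ) : ℝ :=
  ∑' m : ℕ, if ((x.1:ℤ) - x.2).natAbs ≤ m then c m * f (m, (x.1:ℤ), (x.2:ℤ)) else 0

theorem kerT_bound {C θ : ℝ} (hC : 0 ≤ C) (hθ : 0 < θ) (hθ1 : θ < 1) {c : ℕ → ℝ}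
    (hc : ∀ m, |c m| ≤ C * (θ * θ) ^ m) {b : X3 → ℝ} {D : ℝ} {d : ℕ} (hD : 0 ≤ D)
    (hb : ∀ x, b x ≤ D * phi3 x ^ d) :
    ∃ E : ℝ, 0 ≤ E ∧ ∃ g : ℕ → ℝ, ∃ S : ℝ, HasSum g S ∧ 0 ≤ S ∧ ∀ f : X3 → ℝ, (∀ x, |f x| ≤ b x) → ∀ x : ℕ × ℕ, ∀ m,
      ‖if ((x.1:ℤ) - x.2).natAbs ≤ m then c m * f (m, (x.1:ℤ), (x.2:ℤ)) else 0‖ ≤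
        E * (1 + (x.2:ℝ)) ^ d * θ ^ ((x.1:ℤ) - x.2).natAbs * g m := by
  obtain ⟨M, τ, hM, t0, t1, h⟩ := polyexp hθ hθ1 d
  refine ⟨C * D * 2 ^ d * M, by positivity, fun m => τ ^ m, _, hasSum_geometric_of_lt_one t0.le t1,
    inv_nonneg.2 (by linarith), ?_⟩
  intro f hf x m
  obtain ⟨i, j⟩ := x
  simp only
  split_ifs with hm
  · rw [norm_mul, Real.norm_eq_abs, Real.norm_eq_abs]
    have h1 : phi3 (m, (i:ℤ), (j:ℤ)) ≤ 2 * ((1 + (j:ℝ)) * (1 + (m:ℝ))) := by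
      have hij : (i:ℝ) ≤ j + m := by exact_mod_cast (by omega : i ≤ j + m)
      simp only [phi3, Int.cast_natCast, Nat.abs_cast]
      have : (0:ℝ) ≤ j := by positivity
      have : (0:ℝ) ≤ m := by positivity
      nlinarith [mul_nonneg (show (0:ℝ) ≤ j by positivity) (show (0:ℝ) ≤ m by positivity)]
    have h1' : 0 ≤ phi3 (m, (i:ℤ), (j:ℤ)) := by linarith [one_le_phi3 (m, (i:ℤ), (j:ℤ))]
    have h2 : |f (m, (i:ℤ), (j:ℤ))| ≤ D * (2 * ((1 + (j:ℝ)) * (1 + (m:ℝ)))) ^ d :=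
      (hf _).trans ((hb _).trans (mul_le_mul_of_nonneg_left (pow_le_pow_left₀ h1' h1 d) hD))
    have h3 : θ ^ m ≤ θ ^ ((i:ℤ) - j).natAbs := pow_le_pow_of_le_one hθ.le hθ1.le hm
    calc |c m| * |f (m, (i:ℤ), (j:ℤ))| ≤ (C * (θ * θ) ^ m) * (D * (2 * ((1 + (j:ℝ)) * (1 + (m:ℝ)))) ^ d) :=
          mul_le_mul (hc m) h2 (abs_nonneg _) (by positivity)
      _ = C * D * 2 ^ d * (1 + (j:ℝ)) ^ d * θ ^ m * ((1 + (m:ℝ)) ^ d * θ ^ m) := by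
          simp only [mul_pow]; ring
      _ ≤ C * D * 2 ^ d * (1 + (j:ℝ)) ^ d * θ ^ ((i:ℤ) - j).natAbs * (M * τ ^ m) :=
          mul_le_mul (mul_le_mul_of_nonneg_left h3 (by positivity)) (h m) (by positivity) (by positivity)
      _ = _ := by ring
  · rw [norm_zero]; positivity

theorem kernel_exp {C θ : ℝ} (hC : 0 ≤ C) (hθ : 0 < θ) (hθ1 : θ < 1) {c : ℕ → ℝ}
    (hc : ∀ m, |c m| ≤ C * (θ * θ) ^ m) {K : ℕ} {f : ℕ → X3 → ℝ} (hf : HExp (PBB phi3) K f) :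
    HExp (KB θ) K (fun n => kerT c (f n)) := by
  refine HExp.map (PBB.bcl one_le_phi3) (kerT c) ?_ ?_ hf
  · rintro b ⟨hb0, D, d, hD, hb⟩
    obtain ⟨E, hE, g, S, hS, hS0, h⟩ := kerT_bound hC hθ hθ1 hc hD hb
    refine ⟨fun x => E * S * (1 + (x.2:ℝ)) ^ d * θ ^ ((x.1:ℤ) - x.2).natAbs,
      ⟨fun x => by positivity, E * S, d, by positivity, fun i j => le_rfl⟩, ?_⟩
    intro f hf x
    have := tsum_of_norm_bounded (hS.mul_left _) (h f hf x)
    rw [Real.norm_eq_abs] at this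
    exact this.trans (le_of_eq (by ring))
  · rintro r b f g ⟨hb0, D, d, hD, hb⟩ hf hg x
    obtain ⟨E, hE, u, S, hS, hS0, h⟩ := kerT_bound hC hθ hθ1 hc hD hb
    have s1 := Summable.of_norm_bounded (hS.summable.mul_left _) (h f hf x)
    have s2 := Summable.of_norm_bounded (hS.summable.mul_left _) (h g hg x)
    unfold kerT
    rw [← s1.tsum_sub s2, ← tsum_mul_left]
    congr 1; funext m
    split_ifs <;> ring

theorem kerT_decay {C θ : ℝ} (hC : 0 ≤ C) (hθ : 0 < θ) (hθ1 : θ < 1) {c : ℕ → ℝ}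
    (hc : ∀ m, |c m| ≤ C * (θ * θ) ^ m) : ∃ C', 0 ≤ C' ∧ ∀ f : X3 → ℝ, (∀ x, |f x| ≤ 1) →
      ∀ i j, |kerT c f (i, j)| ≤ C' * θ ^ ((i:ℤ) - j).natAbs := by
  obtain ⟨E, hE, g, S, hS, hS0, h⟩ := kerT_bound (b := fun _ => 1) (D := 1) (d := 0) hC hθ hθ1 hc
    (by norm_num) (by intro x; simp)
  refine ⟨E * S, by positivity, fun f hf i j => ?_⟩
  have := tsum_of_norm_bounded (hS.mul_left _) (h f hf (i, j))
  rw [Real.norm_eq_abs] at this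
  exact this.trans (le_of_eq (by ring))


open Polynomial in
/-- monic orthogonal polynomials for a positive definite functional -/
structure OPS (Λ : ℝ[X] →ₗ[ℝ] ℝ) (P : ℕ → ℝ[X]) : Prop where
  pos : ∀ p : ℝ[X], p ≠ 0 → 0 < Λ (p * p)
  monic : ∀ n, (P n).Monic
  deg : ∀ n, (P n).natDegree = n
  orth : ∀ n, ∀ k < n, Λ (P n * X ^ k) = 0

open Polynomial in
/-- subleading coefficient -/
def sc (P : ℕ → ℝ[X]) (n : ℕ) : ℝ := (X * P n).coeff n

open Polynomial in
/-- third coefficient -/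
def tc (P : ℕ → ℝ[X]) (n : ℕ) : ℝ := (X * (X * P n)).coeff n

namespace OPS
open Polynomial

theorem orth_lt' {Λ : ℝ[X] →ₗ[ℝ] ℝ} {p : ℝ[X]} {n : ℕ} (h : ∀ k < n, Λ (p * X ^ k) = 0) {q : ℝ[X]}
    (hq : ∀ m, n ≤ m → q.coeff m = 0) : Λ (p * q) = 0 := by
  rw [q.as_sum_range_C_mul_X_pow' (n := max n (q.natDegree + 1)) (by
    have := le_max_right n (q.natDegree + 1); omega), Finset.mul_sum, map_sum]
  refine Finset.sum_eq_zero fun k hk => ?_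
  have : p * (C (q.coeff k) * X ^ k) = (q.coeff k) • (p * X ^ k) := by
    rw [smul_eq_C_mul]; ring
  rw [this, map_smul]
  rcases Nat.lt_or_ge k n with h1 | h1
  · rw [h k h1, smul_zero]
  · rw [hq k h1, zero_smul]

theorem exists_ops (Λ : ℝ[X] →ₗ[ℝ] ℝ) (hpos : ∀ p : ℝ[X], p ≠ 0 → 0 < Λ (p * p)) :
    ∃ P, OPS Λ P := by
  have key : ∀ n : ℕ, ∃ p : ℝ[X], p.Monic ∧ p.natDegree = n ∧ ∀ k < n, Λ (p * X ^ k) = 0 := by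
    intro n
    let B : (ℝ[X]_n) →ₗ[ℝ] Module.Dual ℝ (ℝ[X]_n) :=
      LinearMap.mk₂ ℝ (fun q r => Λ ((q:ℝ[X]) * (r:ℝ[X])))
        (fun a b c => by simp [add_mul]) (fun a b c => by simp)
        (fun a b c => by simp [mul_add]) (fun a b c => by simp)
    have hinj : Function.Injective B := by
      rw [← LinearMap.ker_eq_bot, LinearMap.ker_eq_bot']
      intro q hq
      by_contra h0
      have h1 : (q:ℝ[X]) ≠ 0 := fun h => h0 (Subtype.ext h)
      have h2 := hpos q h1
      have h3 : B q q = 0 := by rw [hq]; rfl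
      have h4 : B q q = Λ ((q:ℝ[X]) * q) := rfl
      rw [h4] at h3
      linarith
    have hfd : FiniteDimensional ℝ (ℝ[X]_n) :=
      Module.Finite.equiv (degreeLTEquiv ℝ n).symm
    have hsurj : Function.Surjective B :=
      (LinearMap.injective_iff_surjective_of_finrank_eq_finrank
        (Subspace.dual_finrank_eq (K := ℝ) (V := ℝ[X]_n)).symm).1 hinj
    let F : Module.Dual ℝ (ℝ[X]_n) := -(Λ.comp ((LinearMap.mulLeft ℝ (X^n : ℝ[X])).comp (Submodule.subtype _)))
    obtain ⟨q, hq⟩ := hsurj F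
    have hqd : (q:ℝ[X]).degree < n := mem_degreeLT.1 q.2
    refine ⟨X ^ n + (q : ℝ[X]), monic_X_pow_add hqd, ?_, fun k hk => ?_⟩
    · have : ((X : ℝ[X]) ^ n + (q:ℝ[X])).degree = n := by
        rw [degree_add_eq_left_of_degree_lt (by rw [degree_X_pow]; exact hqd), degree_X_pow]
      exact natDegree_eq_of_degree_eq_some this
    · have hm : (X ^ k : ℝ[X]) ∈ ℝ[X]_n := mem_degreeLT.2 (by
        rw [degree_X_pow]; exact_mod_cast hk)
      have h1 : B q ⟨X ^ k, hm⟩ = F ⟨X^k, hm⟩ := by rw [hq]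
      have h2 : Λ ((q:ℝ[X]) * X ^ k) = - Λ (X ^ n * X ^ k) := h1
      rw [add_mul, map_add, h2]; ring
  choose P h1 h2 h3 using key
  exact ⟨P, hpos, h1, h2, h3⟩

variable {Λ : ℝ[X] →ₗ[ℝ] ℝ} {P : ℕ → ℝ[X]}

theorem coeff_self (o : OPS Λ P) (n : ℕ) : (P n).coeff n = 1 := by
  have := o.monic n
  rw [Monic, leadingCoeff, o.deg] at this
  exact this

theorem coeff_gt (o : OPS Λ P) {n m : ℕ} (h : n < m) : (P n).coeff m = 0 :=
  coeff_eq_zero_of_natDegree_lt (by rw [o.deg]; exact h)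

theorem orth_lt (o : OPS Λ P) {n : ℕ} {q : ℝ[X]} (hq : ∀ m, n ≤ m → q.coeff m = 0) :
    Λ (P n * q) = 0 := orth_lt' (o.orth n) hq

theorem N_pos (o : OPS Λ P) (n : ℕ) : 0 < Λ (P n * P n) := o.pos _ (o.monic n).ne_zero

theorem orth_coeff (o : OPS Λ P) {n : ℕ} {q : ℝ[X]} (hq : ∀ m, n < m → q.coeff m = 0) :
    Λ (P n * q) = q.coeff n * Λ (P n * P n) := by
  have h := o.orth_lt (n := n) (q := q - C (q.coeff n) * P n) (by
    intro m hm
    rw [coeff_sub, coeff_C_mul]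
    rcases hm.eq_or_lt with h | h
    · rw [← h, o.coeff_self]; ring
    · rw [hq m h, o.coeff_gt h]; ring)
  rw [mul_sub, map_sub, show P n * (C (q.coeff n) * P n) = (q.coeff n) • (P n * P n) by
    rw [smul_eq_C_mul]; ring, map_smul, smul_eq_mul] at h
  linarith

theorem orth_ne (o : OPS Λ P) {n m : ℕ} (h : n ≠ m) : Λ (P n * P m) = 0 := by
  rcases Nat.lt_or_ge n m with h1 | h1
  · rw [mul_comm]; exact o.orth_lt fun k hk => o.coeff_gt (by omega)
  · exact o.orth_lt fun k hk => o.coeff_gt (by omega)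

theorem pos_nonneg (o : OPS Λ P) (q : ℝ[X]) : 0 ≤ Λ (q * q) := by
  by_cases h : q = 0
  · simp [h]
  · exact (o.pos q h).le

theorem minimal (o : OPS Λ P) {n : ℕ} {Q : ℝ[X]} (hQ : Q.coeff n = 1) (hQ' : ∀ m, n < m → Q.coeff m = 0) :
    Λ (P n * P n) ≤ Λ (Q * Q) := by
  have h := o.orth_lt (n := n) (q := Q - P n) (by
    intro m hm
    rw [coeff_sub]
    rcases hm.eq_or_lt with h | h
    · rw [← h, o.coeff_self, hQ]; ring
    · rw [hQ' m h, o.coeff_gt h]; ring)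
  have e : Q * Q = P n * P n + (P n * (Q - P n) + P n * (Q - P n)) + (Q - P n) * (Q - P n) := by ring
  rw [e, map_add, map_add, map_add, h]
  have := o.pos_nonneg (Q - P n)
  linarith

/-- zero test -/
theorem eq_zero_of (o : OPS Λ P) {n : ℕ} {q : ℝ[X]} (hq : ∀ m, n ≤ m → q.coeff m = 0)
    (h : ∀ k < n, Λ (P k * q) = 0) : q = 0 := by
  induction n with
  | zero => ext m; simpa using hq m (by omega)
  | succ n ih =>
    refine ih (fun m hm => ?_) (fun k hk => h k (by omega))
    rcases hm.eq_or_lt with h1 | h1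
    · have h2 := o.orth_coeff (n := n) (q := q) (fun m hm => hq m hm)
      rw [h n (by omega)] at h2
      rw [← h1]
      rcases mul_eq_zero.1 h2.symm with h3 | h3
      · exact h3
      · exact absurd h3 (o.N_pos n).ne'
    · exact hq m h1

theorem expand (o : OPS Λ P) {n : ℕ} {q : ℝ[X]} (hq : ∀ m, n ≤ m → q.coeff m = 0) :
    q = ∑ k ∈ Finset.range n, C (Λ (P k * q) / Λ (P k * P k)) * P k := by
  rw [← sub_eq_zero]
  refine o.eq_zero_of (n := n) ?_ ?_
  · intro m hm
    rw [coeff_sub, hq m hm, finsetSum_coeff, Finset.sum_eq_zero, sub_zero]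
    intro k hk
    rw [coeff_C_mul, o.coeff_gt (by simp at hk; omega), mul_zero]
  · intro k hk
    rw [mul_sub, map_sub, Finset.mul_sum, map_sum, Finset.sum_eq_single k]
    · rw [show P k * (C (Λ (P k * q) / Λ (P k * P k)) * P k) =
        (Λ (P k * q) / Λ (P k * P k)) • (P k * P k) by rw [smul_eq_C_mul]; ring, map_smul, smul_eq_mul,
        div_mul_cancel₀ _ (o.N_pos k).ne', sub_self]
    · intro j hj hjk
      rw [show P k * (C (Λ (P j * q) / Λ (P j * P j)) * P j) =
        (Λ (P j * q) / Λ (P j * P j)) • (P k * P j) by rw [smul_eq_C_mul]; ring, map_smul,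
        o.orth_ne hjk.symm, smul_zero]
    · intro h; simp at h; omega

theorem coeff_X_mul_P (o : OPS Λ P) {n m : ℕ} (h : n + 1 < m) : (X * P n).coeff m = 0 := by
  obtain ⟨m, rfl⟩ : ∃ k, m = k + 1 := ⟨m - 1, by omega⟩
  rw [coeff_X_mul]; exact o.coeff_gt (by omega)

theorem sc_succ (P : ℕ → ℝ[X]) (n : ℕ) : sc P (n + 1) = (P (n+1)).coeff n := coeff_X_mul _ _

theorem rem_coeff (o : OPS Λ P) {n m : ℕ} (h : n < m) : (X * P n - P (n+1)).coeff m = 0 := by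
  rw [coeff_sub]
  rcases (show n + 1 ≤ m by omega).eq_or_lt with h1 | h1
  · rw [← h1, coeff_X_mul, o.coeff_self, o.coeff_self, sub_self]
  · rw [o.coeff_X_mul_P h1, o.coeff_gt h1, sub_self]

theorem X_sq (o : OPS Λ P) (n : ℕ) :
    Λ (X * (P n * P n)) = (sc P n - sc P (n+1)) * Λ (P n * P n) := by
  have h := o.orth_coeff (n := n) (q := X * P n - P (n+1)) (fun m hm => o.rem_coeff hm)
  rw [mul_sub, map_sub, o.orth_ne (by omega : n ≠ n+1), sub_zero, coeff_sub, ← sc_succ P] at h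
  rw [show X * (P n * P n) = P n * (X * P n) by ring, h]; rfl

theorem X_pred (o : OPS Λ P) (n : ℕ) : Λ (P n * (X * P (n+1))) = Λ (P (n+1) * P (n+1)) := by
  rw [show P n * (X * P (n+1)) = P (n+1) * (X * P n) by ring,
    o.orth_coeff (fun m hm => o.coeff_X_mul_P hm), coeff_X_mul, o.coeff_self, one_mul]

/-- three term recurrence -/
theorem three_term (o : OPS Λ P) (n : ℕ) :
    X * P (n+1) = P (n+2) + C (sc P (n+1) - sc P (n+2)) * P (n+1)
      + C (Λ (P (n+1) * P (n+1)) / Λ (P n * P n)) * P n := by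
  have hC : ∀ (k : ℕ) (r : ℝ) (j : ℕ), Λ (P k * (C r * P j)) = r * Λ (P k * P j) := fun k r j => by
    rw [show P k * (C r * P j) = r • (P k * P j) by rw [smul_eq_C_mul]; ring, map_smul, smul_eq_mul]
  rw [← sub_eq_zero]
  refine o.eq_zero_of (n := n + 3) ?_ ?_
  · intro m hm
    simp only [coeff_sub, coeff_add, coeff_C_mul]
    rw [o.coeff_X_mul_P (by omega), o.coeff_gt (by omega), o.coeff_gt (by omega), o.coeff_gt (by omega)]
    ring
  · intro k hk
    rw [mul_sub, mul_add, mul_add, map_sub Λ, map_add Λ, map_add Λ, hC, hC]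
    have hN := (o.N_pos n).ne'
    rcases (by omega : k = n + 2 ∨ k = n + 1 ∨ k = n ∨ k < n) with h | h | h | h
    · subst h
      rw [o.orth_coeff (fun m hm => o.coeff_X_mul_P hm), coeff_X_mul, o.coeff_self,
        o.orth_ne (by omega : n + 2 ≠ n + 1), o.orth_ne (by omega : n + 2 ≠ n)]
      ring
    · subst h
      rw [show P (n+1) * (X * P (n+1)) = X * (P (n+1) * P (n+1)) by ring, o.X_sq,
        o.orth_ne (by omega : n + 1 ≠ n + 2), o.orth_ne (by omega : n + 1 ≠ n)]
      ring
    · subst h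
      rw [o.X_pred, o.orth_ne (by omega : k ≠ k + 2), o.orth_ne (by omega : k ≠ k + 1)]
      field_simp
      ring
    · rw [show P k * (X * P (n+1)) = P (n+1) * (X * P k) by ring,
        o.orth_lt (fun m hm => o.coeff_X_mul_P (by omega)), o.orth_ne (by omega : k ≠ n + 2),
        o.orth_ne (by omega : k ≠ n + 1), o.orth_ne (by omega : k ≠ n)]
      ring

theorem three_term_zero (o : OPS Λ P) : X * P 0 = P 1 + C (sc P 0 - sc P 1) * P 0 := by
  have h0 : P 0 = 1 := (o.monic 0).natDegree_eq_zero.1 (o.deg 0)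
  ext m
  rw [h0, mul_one, mul_one, coeff_add]
  rcases (by omega : m = 0 ∨ m = 1 ∨ 1 < m) with h | h | h
  · subst h
    have : sc P 1 = (P 1).coeff 0 := sc_succ P 0
    have h2 : sc P 0 = 0 := by simp [sc]
    rw [coeff_C_zero, this, h2]; simp
  · subst h
    rw [o.coeff_self]; simp
  · rw [o.coeff_gt h, coeff_X, coeff_C, if_neg (by omega), if_neg (by omega), add_zero]

/-- norm ratio through coefficients -/
theorem ratio_coeff (o : OPS Λ P) (n : ℕ) :
    Λ (P (n+1) * P (n+1)) / Λ (P n * P n) =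
      tc P (n+1) - tc P (n+2) - (sc P (n+1) - sc P (n+2)) * sc P (n+1) := by
  have h := congrArg (fun p => p.coeff n) (o.three_term n)
  simp only [coeff_add, coeff_C_mul, o.coeff_self, mul_one] at h
  have e1 : (X * P (n+1)).coeff n = tc P (n+1) := by
    rw [tc, coeff_X_mul]
  have e2 : (P (n+2)).coeff n = tc P (n+2) := by
    rw [tc, coeff_X_mul, coeff_X_mul]
  rw [e1, e2, ← sc_succ P] at h
  linarith

end OPS


section zidx
open Polynomial

def onp (Λ : ℝ[X] →ₗ[ℝ] ℝ) (P : ℕ → ℝ[X]) (n : ℕ) : ℝ[X] := C (√(Λ (P n * P n)))⁻¹ * P n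

def pZ (Λ : ℝ[X] →ₗ[ℝ] ℝ) (P : ℕ → ℝ[X]) (k : ℤ) : ℝ[X] := if 0 ≤ k then onp Λ P k.toNat else 0

def aN (Λ : ℝ[X] →ₗ[ℝ] ℝ) (P : ℕ → ℝ[X]) (n : ℕ) : ℝ :=
  √(Λ (P n * P n) / Λ (P (n-1) * P (n-1)))

def aZ (Λ : ℝ[X] →ₗ[ℝ] ℝ) (P : ℕ → ℝ[X]) (k : ℤ) : ℝ := if k ≤ 0 then 0 else aN Λ P k.toNat

def bZ (P : ℕ → ℝ[X]) (k : ℤ) : ℝ := if k < 0 then 0 else sc P k.toNat - sc P (k.toNat + 1)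

def tZ (Λ : ℝ[X] →ₗ[ℝ] ℝ) (P : ℕ → ℝ[X]) (m : ℕ) (p q : ℤ) : ℝ :=
  Λ (Chebyshev.T ℝ (m:ℤ) * (pZ Λ P p * pZ Λ P q))

variable {Λ : ℝ[X] →ₗ[ℝ] ℝ} {P : ℕ → ℝ[X]}

theorem C_mul_map (Λ : ℝ[X] →ₗ[ℝ] ℝ) (r : ℝ) (p : ℝ[X]) : Λ (C r * p) = r * Λ p := by
  rw [← smul_eq_C_mul, map_smul, smul_eq_mul]

theorem onp_rec (o : OPS Λ P) (n : ℕ) : X * onp Λ P (n+1) = C (aN Λ P (n+2)) * onp Λ P (n+2)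
    + C (sc P (n+1) - sc P (n+2)) * onp Λ P (n+1) + C (aN Λ P (n+1)) * onp Λ P n := by
  have h := o.three_term n
  have n0 := o.N_pos n
  have n1 := o.N_pos (n+1)
  have n2 := o.N_pos (n+2)
  have e1 : aN Λ P (n+2) * (√(Λ (P (n+2) * P (n+2))))⁻¹ = (√(Λ (P (n+1) * P (n+1))))⁻¹ := by
    rw [aN, show n + 2 - 1 = n + 1 by omega, Real.sqrt_div n2.le]
    have := Real.sqrt_pos.2 n2
    field_simp
  have e2 : aN Λ P (n+1) * (√(Λ (P n * P n)))⁻¹ = (√(Λ (P (n+1) * P (n+1))))⁻¹ *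
      (Λ (P (n+1) * P (n+1)) / Λ (P n * P n)) := by
    rw [aN, show n + 1 - 1 = n by omega, Real.sqrt_div n1.le]
    have h1 := Real.sqrt_pos.2 n1
    have h0 := Real.sqrt_pos.2 n0
    have q1 := Real.mul_self_sqrt n1.le
    have q0 := Real.mul_self_sqrt n0.le
    field_simp
    rw [Real.sq_sqrt n0.le, Real.sq_sqrt n1.le]
    ring
  unfold onp
  rw [← mul_assoc (C (aN Λ P (n+2))), ← C_mul, e1, ← mul_assoc (C (aN Λ P (n+1))), ← C_mul, e2, C_mul,
    show X * (C (√(Λ (P (n+1) * P (n+1))))⁻¹ * P (n+1)) = C (√(Λ (P (n+1) * P (n+1))))⁻¹ * (X * P (n+1)) by ring, h]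
  ring

theorem onp_rec_zero (o : OPS Λ P) : X * onp Λ P 0 = C (aN Λ P 1) * onp Λ P 1
    + C (sc P 0 - sc P 1) * onp Λ P 0 := by
  have h := o.three_term_zero
  have n1 := o.N_pos 0
  have n2 := o.N_pos 1
  have e1 : aN Λ P 1 * (√(Λ (P 1 * P 1)))⁻¹ = (√(Λ (P 0 * P 0)))⁻¹ := by
    rw [aN, show 1 - 1 = 0 by omega, Real.sqrt_div n2.le]
    have := Real.sqrt_pos.2 n2
    field_simp
  unfold onp
  rw [← mul_assoc (C (aN Λ P 1)), ← C_mul, e1,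
    show X * (C (√(Λ (P 0 * P 0)))⁻¹ * P 0) = C (√(Λ (P 0 * P 0)))⁻¹ * (X * P 0) by ring, h]
  ring

theorem pZ_nat (n : ℕ) : pZ Λ P (n:ℤ) = onp Λ P n := by simp [pZ]
theorem pZ_neg {k : ℤ} (h : k < 0) : pZ Λ P k = 0 := by simp [pZ, h]

theorem pZ_rec (o : OPS Λ P) (k : ℤ) : X * pZ Λ P k = C (aZ Λ P (k+1)) * pZ Λ P (k+1)
    + C (bZ P k) * pZ Λ P k + C (aZ Λ P k) * pZ Λ P (k-1) := by
  rcases (by omega : k < -1 ∨ k = -1 ∨ k = 0 ∨ 0 < k) with h | h | h | h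
  · rw [pZ_neg (k := k) (by omega), pZ_neg (k := k + 1) (by omega), pZ_neg (k := k - 1) (by omega)]; simp
  · subst h
    rw [pZ_neg (k := -1) (by omega), pZ_neg (k := -1 - 1) (by omega)]; simp [aZ]
  · subst h
    have h1 : pZ Λ P (0 + 1) = onp Λ P 1 := pZ_nat 1
    have h0 : pZ Λ P 0 = onp Λ P 0 := pZ_nat 0
    rw [h1, h0, pZ_neg (k := 0 - 1) (by omega), onp_rec_zero o]
    simp [aZ, bZ]
  · obtain ⟨n, rfl⟩ : ∃ n : ℕ, k = ((n + 1 : ℕ):ℤ) := ⟨(k-1).toNat, by omega⟩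
    rw [show (((n+1:ℕ):ℤ) + 1) = ((n + 2 : ℕ):ℤ) by push_cast; ring,
      show (((n+1:ℕ):ℤ) - 1) = ((n : ℕ):ℤ) by push_cast; ring, pZ_nat, pZ_nat, pZ_nat, onp_rec o n]
    have e1 : aZ Λ P ((n+2:ℕ):ℤ) = aN Λ P (n+2) := by
      rw [aZ, if_neg (by push_cast; omega), Int.toNat_natCast]
    have e2 : aZ Λ P ((n+1:ℕ):ℤ) = aN Λ P (n+1) := by
      rw [aZ, if_neg (by push_cast; omega), Int.toNat_natCast]
    have e3 : bZ P ((n+1:ℕ):ℤ) = sc P (n+1) - sc P (n+2) := by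
      rw [bZ, if_neg (by omega), Int.toNat_natCast]
    rw [e1, e2, e3]

theorem onp_onp (o : OPS Λ P) (i j : ℕ) : Λ (onp Λ P i * onp Λ P j) = if i = j then 1 else 0 := by
  rw [show onp Λ P i * onp Λ P j = C (√(Λ (P i * P i)))⁻¹ * (C (√(Λ (P j * P j)))⁻¹ * (P i * P j)) by
    unfold onp; ring, C_mul_map, C_mul_map]
  split_ifs with h
  · subst h
    have n1 := o.N_pos i
    have := Real.mul_self_sqrt n1.le
    have h1 := Real.sqrt_pos.2 n1
    field_simp
    rw [Real.sq_sqrt n1.le]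
  · rw [o.orth_ne h]; ring

theorem tZ_zero (o : OPS Λ P) (p q : ℤ) : tZ Λ P 0 p q = if p = q ∧ 0 ≤ p then 1 else 0 := by
  rw [tZ, Nat.cast_zero, Chebyshev.T_zero, one_mul]
  by_cases hp : 0 ≤ p
  · by_cases hq : 0 ≤ q
    · obtain ⟨i, rfl⟩ := Int.eq_ofNat_of_zero_le hp
      obtain ⟨j, rfl⟩ := Int.eq_ofNat_of_zero_le hq
      rw [pZ_nat, pZ_nat, onp_onp o]
      simp
    · rw [pZ_neg (k := q) (by omega), mul_zero, map_zero, if_neg (by omega)]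
  · rw [pZ_neg (k := p) (by omega), zero_mul, map_zero, if_neg (by omega)]

theorem tZ_X (o : OPS Λ P) (f : ℝ[X]) (p q : ℤ) : Λ (X * f * (pZ Λ P p * pZ Λ P q)) =
    aZ Λ P (p+1) * Λ (f * (pZ Λ P (p+1) * pZ Λ P q)) + bZ P p * Λ (f * (pZ Λ P p * pZ Λ P q))
      + aZ Λ P p * Λ (f * (pZ Λ P (p-1) * pZ Λ P q)) := by
  rw [show X * f * (pZ Λ P p * pZ Λ P q) = f * ((X * pZ Λ P p) * pZ Λ P q) by ring, pZ_rec o,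
    ← C_mul_map, ← C_mul_map, ← C_mul_map, ← map_add, ← map_add]
  congr 1; ring

theorem tZ_one (o : OPS Λ P) (p q : ℤ) : tZ Λ P 1 p q = aZ Λ P (p+1) * tZ Λ P 0 (p+1) q
    + bZ P p * tZ Λ P 0 p q + aZ Λ P p * tZ Λ P 0 (p-1) q := by
  have := tZ_X o 1 p q
  simpa [tZ] using this

theorem tZ_rec (o : OPS Λ P) (m : ℕ) (p q : ℤ) : tZ Λ P (m+2) p q = 2 * aZ Λ P (p+1) * tZ Λ P (m+1) (p+1) q
    + 2 * bZ P p * tZ Λ P (m+1) p q + 2 * aZ Λ P p * tZ Λ P (m+1) (p-1) q - tZ Λ P m p q := by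
  have h := tZ_X o (Chebyshev.T ℝ ((m:ℤ)+1)) p q
  simp only [tZ]
  push_cast
  rw [Chebyshev.T_add_two, sub_mul, map_sub,
    show 2 * X * Chebyshev.T ℝ ((m:ℤ)+1) * (pZ Λ P p * pZ Λ P q) =
      C 2 * (X * Chebyshev.T ℝ ((m:ℤ)+1) * (pZ Λ P p * pZ Λ P q)) by
        rw [show (C (2:ℝ) : ℝ[X]) = 2 from rfl]; ring, C_mul_map, h]
  ring

theorem tZ_bd (o : OPS Λ P) (hT : ∀ (m : ℕ) (q : ℝ[X]), |Λ (Chebyshev.T ℝ (m:ℤ) * (q * q))| ≤ Λ (q * q))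
    (m : ℕ) (p q : ℤ) : |tZ Λ P m p q| ≤ 1 := by
  have hself : ∀ k, Λ (pZ Λ P k * pZ Λ P k) ≤ 1 := by
    intro k
    have := tZ_zero o k k
    rw [tZ, Nat.cast_zero, Chebyshev.T_zero, one_mul] at this
    rw [this]; split_ifs <;> norm_num
  set f := pZ Λ P p
  set g := pZ Λ P q
  have e : tZ Λ P m p q = (Λ (Chebyshev.T ℝ (m:ℤ) * ((f+g)*(f+g))) - Λ (Chebyshev.T ℝ (m:ℤ) * ((f-g)*(f-g)))) / 4 := by
    rw [← map_sub, eq_div_iff (by norm_num), mul_comm, tZ, ← C_mul_map,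
      show (C (4:ℝ) : ℝ[X]) = 4 from rfl]
    congr 1; ring
  have h1 := abs_le.1 (hT m (f+g))
  have h2 := abs_le.1 (hT m (f-g))
  have h3 : Λ ((f+g)*(f+g)) + Λ ((f-g)*(f-g)) = 2 * (Λ (f*f) + Λ (g*g)) := by
    rw [← map_add, ← map_add, ← C_mul_map, show (C (2:ℝ) : ℝ[X]) = 2 from rfl]
    congr 1; ring
  have h4 := hself p
  have h5 := hself q
  rw [e, abs_le]
  constructor <;> linarith [h1.1, h1.2, h2.1, h2.2]

theorem natDegree_T_le (m : ℕ) : (Chebyshev.T ℝ (m:ℤ)).natDegree ≤ m := by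
  simp

theorem tZ_symm (m : ℕ) (p q : ℤ) : tZ Λ P m p q = tZ Λ P m q p := by
  unfold tZ; congr 1; ring

theorem tZ_vanish (o : OPS Λ P) (m : ℕ) (p q : ℤ) (h : m < (p - q).natAbs) : tZ Λ P m p q = 0 := by
  wlog hpq : p ≤ q generalizing p q
  · rw [tZ_symm]; exact this q p (by omega) (by omega)
  by_cases hp : 0 ≤ p
  · obtain ⟨i, rfl⟩ := Int.eq_ofNat_of_zero_le hp
    obtain ⟨j, rfl⟩ := Int.eq_ofNat_of_zero_le (hp.trans hpq)
    rw [tZ, pZ_nat, pZ_nat, show Chebyshev.T ℝ (m:ℤ) * (onp Λ P i * onp Λ P j) =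
      C (√(Λ (P j * P j)))⁻¹ * (P j * (Chebyshev.T ℝ (m:ℤ) * onp Λ P i)) by
        rw [show onp Λ P j = C (√(Λ (P j * P j)))⁻¹ * P j from rfl]; ring, C_mul_map, o.orth_lt (q := Chebyshev.T ℝ (m:ℤ) * onp Λ P i), mul_zero]
    intro k hk
    refine coeff_eq_zero_of_natDegree_lt ?_
    have h1 := natDegree_T_le m
    have h2 : (onp Λ P i).natDegree ≤ i := (natDegree_C_mul_le _ _).trans (o.deg i).le
    have h3 := natDegree_mul_le (p := Chebyshev.T ℝ (m:ℤ)) (q := onp Λ P i)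
    omega
  · rw [tZ, pZ_neg (k := p) (by omega)]; simp

end zidx


theorem HExp.eval {K : ℕ} {f : ℕ → ℕ → ℝ} (h : HExp VB K f) (i : ℕ) : SExp K (fun n => f n i) := by
  refine HExp.map VB.bcl (B' := PBB (fun _ : Unit => (1:ℝ))) (fun f _ => f i) ?_ (by intros; rfl) h
  intro b hb
  exact ⟨fun _ => b i, sB_const _ (hb.1 i), fun f hf _ => hf i⟩

theorem SExp.lower {f : ℕ → ℝ} {L : ℝ} (hL : 0 < L) (h : Tendsto f atTop (nhds L))
    (hpos : ∀ n, 1 ≤ n → 0 < f n) : ∃ δ > 0, ∀ n, 1 ≤ n → δ ≤ f n := by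
  obtain ⟨N, hN⟩ := eventually_atTop.1 (h.eventually (lt_mem_nhds (half_lt_self hL)))
  have : ∀ M : ℕ, ∃ δ > 0, ∀ n, 1 ≤ n → n < M → δ ≤ f n := by
    intro M
    induction M with
    | zero => exact ⟨1, one_pos, fun n _ h => by omega⟩
    | succ M ih =>
      obtain ⟨δ, h0, hδ⟩ := ih
      by_cases hM : 1 ≤ M
      · refine ⟨min δ (f M), lt_min h0 (hpos M hM), fun n h1 h2 => ?_⟩
        rcases (by omega : n < M ∨ n = M) with h | h
        · exact (min_le_left _ _).trans (hδ n h1 h)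
        · rw [h]; exact min_le_right _ _
      · exact ⟨1, one_pos, fun n _ h => by omega⟩
  obtain ⟨δ, h0, hδ⟩ := this N
  refine ⟨min δ (L/2), lt_min h0 (by positivity), fun n h1 => ?_⟩
  rcases Nat.lt_or_ge n N with h | h
  · exact (min_le_left _ _).trans (hδ n h1 h)
  · exact (min_le_right _ _).trans (hN n h).le

theorem tendsto_const_div_sq (D : ℝ) : Tendsto (fun n : ℕ => D / (n:ℝ) ^ 2) atTop (nhds 0) :=
  tendsto_const_nhds.div_atTop ((tendsto_pow_atTop (by norm_num)).comp tendsto_natCast_atTop_atTop)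

section core
open Polynomial
variable {Λ0 Λh : ℝ[X] →ₗ[ℝ] ℝ} {P0 P : ℕ → ℝ[X]}

theorem onp_coeff_ge (o : OPS Λ0 P0) {n m : ℕ} (h : n < m) : (onp Λ0 P0 n).coeff m = 0 := by
  rw [onp, coeff_C_mul, o.coeff_gt h, mul_zero]

theorem Ph_expand (o0 : OPS Λ0 P0) (o : OPS Λh P) (n : ℕ) :
    ∑ j ∈ Finset.range (n+1), C (Λ0 (P n * onp Λ0 P0 (n - j))) * onp Λ0 P0 (n - j) = P n := by
  have h := o0.expand (n := n + 1) (q := P n) (fun m hm => o.coeff_gt (by omega))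
  rw [← Finset.sum_range_reflect] at h
  conv_rhs => rw [h]
  refine Finset.sum_congr rfl fun j hj => ?_
  rw [show n + 1 - 1 - j = n - j by omega]
  have hN := o0.N_pos (n - j)
  rw [onp, show P n * (C (√(Λ0 (P0 (n-j) * P0 (n-j))))⁻¹ * P0 (n-j)) =
    C (√(Λ0 (P0 (n-j) * P0 (n-j))))⁻¹ * (P0 (n-j) * P n) by ring, C_mul_map, ← mul_assoc, ← C_mul]
  congr 2
  have h1 := Real.sqrt_pos.2 hN
  field_simp
  rw [Real.sq_sqrt hN.le]; ring

theorem core (o0 : OPS Λ0 P0) (o : OPS Λh P)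
    (hT : ∀ (m : ℕ) (q : ℝ[X]), |Λ0 (Chebyshev.T ℝ (m:ℤ) * (q * q))| ≤ Λ0 (q * q))
    (ha : ∀ K, SExp K (aN Λ0 P0)) (hs : ∀ K, SExp K (sc P0))
    (hal : Tendsto (aN Λ0 P0) atTop (nhds (1/2)))
    {c : ℕ → ℝ} {C θ : ℝ} (hC : 0 ≤ C) (hθ : 0 < θ) (hθ1 : θ < 1) (hc : ∀ m, |c m| ≤ C * (θ * θ) ^ m)
    (hsum : ∀ q : ℝ[X], HasSum (fun m : ℕ => c m * Λ0 (Chebyshev.T ℝ (m:ℤ) * q)) (Λh q))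
    {cl cu : ℝ} (hcl : 0 < cl) (hcu : 0 < cu) (hl : ∀ q : ℝ[X], cl * Λ0 (q * q) ≤ Λh (q * q))
    (hu : ∀ q : ℝ[X], Λh (q * q) ≤ cu * Λ0 (q * q)) :
    (∀ K, SExp K (fun n => Λ0 (P0 n * P0 n) / Λh (P n * P n))) ∧
    (∀ K, SExp K (sc P)) ∧ ∀ n, cu⁻¹ ≤ Λ0 (P0 n * P0 n) / Λh (P n * P n) := by
  have hlow : ∀ n, cu⁻¹ ≤ Λ0 (P0 n * P0 n) / Λh (P n * P n) := by
    intro n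
    have h1 := o.minimal (n := n) (Q := P0 n) (o0.coeff_self n) (fun m hm => o0.coeff_gt hm)
    have h2 := hu (P0 n)
    rw [le_div_iff₀ (o.N_pos n), inv_mul_le_iff₀ hcu]
    linarith
  -- wave expansion
  have hb : ∀ K, SExp K (fun n : ℕ => bZ P0 (n:ℤ)) := by
    intro K
    refine ((hs K).sub (hs K).succ_shift).congr fun n hn => ?_
    rw [bZ, if_neg (by omega), Int.toNat_natCast]
  have hbl : Tendsto (fun n : ℕ => bZ P0 (n:ℤ)) atTop (nhds 0) := by
    obtain ⟨l, hl⟩ := SExp.succ_iff.1 (hs 1)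
    have h1 := SExp.tendsto hl
    have h2 := h1.sub ((tendsto_add_atTop_iff_nat 1).2 h1)
    rw [sub_self] at h2
    refine h2.congr fun n => ?_
    rw [bZ, if_neg (by omega), Int.toNat_natCast]
  have haZ : ∀ n : ℕ, 1 ≤ n → aZ Λ0 P0 (n:ℤ) = aN Λ0 P0 n := fun n hn => by
    rw [aZ, if_neg (by omega), Int.toNat_natCast]
  have hw := wave_exp (aZ Λ0 P0) (bZ P0) (tZ Λ0 P0)
    (fun K => (ha K).congr fun n hn => (haZ n hn).symm)
    (fun p hp => by rw [aZ, if_pos hp]) hb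
    ⟨|bZ P0 0|, fun p hp => by
      rcases hp.eq_or_lt with h | h
      · rw [h]
      · rw [bZ, if_pos h, abs_zero]; exact abs_nonneg _⟩
    (hal.congr' (by filter_upwards [eventually_ge_atTop 1] with n hn using (haZ n hn).symm)) hbl
    (tZ_zero o0) (tZ_one o0) (tZ_rec o0) (tZ_bd o0 hT)
  set f : ℕ → X3 → ℝ := fun n x => tZ Λ0 P0 x.1 ((n:ℤ)-x.2.1) ((n:ℤ)-x.2.2) with hf
  set G : ℕ → ℕ × ℕ → ℝ := fun n => kerT c (f n) with hGd
  have hGe : ∀ K, HExp (KB θ) K G := fun K => kernel_exp hC hθ hθ1 hc (hw K)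
  obtain ⟨C', hC', hdec⟩ := kerT_decay hC hθ hθ1 hc
  have hG : ∀ n i j, |G n (i, j)| ≤ C' * θ ^ ((i:ℤ) - j).natAbs := fun n i j =>
    hdec (f n) (fun x => tZ_bd o0 hT _ _ _) i j
  have hGv : ∀ n i j, G n (i, j) = Λh (pZ Λ0 P0 ((n:ℤ) - i) * pZ Λ0 P0 ((n:ℤ) - j)) := by
    intro n i j
    rw [← (hsum _).tsum_eq]
    simp only [hGd, kerT]
    congr 1; funext m
    split_ifs with h
    · rfl
    · have h0 := tZ_vanish o0 m ((n:ℤ) - i) ((n:ℤ) - j) (by omega)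
      rw [tZ] at h0
      rw [h0, mul_zero]
  have hpn : ∀ n i : ℕ, i ≤ n → pZ Λ0 P0 ((n:ℤ) - i) = onp Λ0 P0 (n - i) := fun n i h => by
    rw [← Nat.cast_sub h, pZ_nat]
  have hG0 : ∀ n i j, n < i ∨ n < j → G n (i, j) = 0 := by
    intro n i j h
    rw [hGv]
    rcases h with h | h
    · rw [pZ_neg (k := (n:ℤ) - i) (by omega), zero_mul, map_zero]
    · rw [pZ_neg (k := (n:ℤ) - j) (by omega), mul_zero, map_zero]
  have hquad : ∀ (Λ : ℝ[X] →ₗ[ℝ] ℝ) (n : ℕ) (z : ℕ → ℝ) (u : ℕ → ℝ[X]),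
      Λ ((∑ i ∈ Finset.range (n+1), Polynomial.C (z i) * u i) * (∑ i ∈ Finset.range (n+1), Polynomial.C (z i) * u i)) =
      ∑ i ∈ Finset.range (n+1), ∑ j ∈ Finset.range (n+1), z i * Λ (u i * u j) * z j := by
    intro Λ n z u
    rw [Finset.sum_mul_sum, map_sum]
    refine Finset.sum_congr rfl fun i _ => ?_
    rw [map_sum]
    refine Finset.sum_congr rfl fun j _ => ?_
    rw [show Polynomial.C (z i) * u i * (Polynomial.C (z j) * u j) = Polynomial.C (z i) * (Polynomial.C (z j) * (u i * u j)) by ring,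
      C_mul_map, C_mul_map]; ring
  have hform : ∀ n (z : ℕ → ℝ), cl * ∑ i ∈ Finset.range (n+1), z i ^ 2 ≤
        ∑ i ∈ Finset.range (n+1), ∑ j ∈ Finset.range (n+1), z i * G n (i, j) * z j := by
    intro n z
    have h1 := hl (∑ i ∈ Finset.range (n+1), Polynomial.C (z i) * onp Λ0 P0 (n - i))
    rw [hquad, hquad] at h1
    have e1 : ∑ i ∈ Finset.range (n+1), ∑ j ∈ Finset.range (n+1),
        z i * Λ0 (onp Λ0 P0 (n - i) * onp Λ0 P0 (n - j)) * z j = ∑ i ∈ Finset.range (n+1), z i ^ 2 := by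
      refine Finset.sum_congr rfl fun i hi => ?_
      rw [Finset.sum_eq_single i]
      · rw [onp_onp o0, if_pos rfl]; ring
      · intro j hj hji
        simp only [Finset.mem_range] at hi hj
        rw [onp_onp o0, if_neg (by omega)]; ring
      · intro h; exact absurd hi h
    rw [e1] at h1
    refine h1.trans (le_of_eq ?_)
    refine Finset.sum_congr rfl fun i hi => Finset.sum_congr rfl fun j hj => ?_
    simp only [Finset.mem_range] at hi hj
    rw [hGv, hpn n i (by omega), hpn n j (by omega)]
  set κ : ℕ → ℝ := fun n => √(Λ0 (P0 n * P0 n)) / Λh (P n * P n) with hκ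
  set y : ℕ → ℕ → ℝ := fun n i => Λ0 (P n * pZ Λ0 P0 ((n:ℤ) - i)) * κ n with hy
  have hsq : ∀ n, 0 < √(Λ0 (P0 n * P0 n)) := fun n => Real.sqrt_pos.2 (o0.N_pos n)
  have hyeq : ∀ n, 1 ≤ n → ∀ i, ∑' j, G n (i, j) * y n j = (fun _ i => if i = 0 then (1:ℝ) else 0 : ℕ → ℕ → ℝ) n i := by
    intro n _ i
    rw [tsum_eq_sum (s := Finset.range (n+1)) (fun j hj => by
      rw [hG0 n i j (Or.inr (by simpa using hj)), zero_mul])]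
    have e1 : ∑ j ∈ Finset.range (n+1), G n (i, j) * y n j = Λh (pZ Λ0 P0 ((n:ℤ) - i) * P n) * κ n := by
      conv_rhs => rw [← Ph_expand o0 o n, Finset.mul_sum, map_sum, Finset.sum_mul]
      refine Finset.sum_congr rfl fun j hj => ?_
      simp only [Finset.mem_range] at hj
      rw [hGv, hy]
      simp only
      rw [hpn n j (by omega), show pZ Λ0 P0 ((n:ℤ) - i) * (Polynomial.C (Λ0 (P n * onp Λ0 P0 (n - j))) * onp Λ0 P0 (n - j))
        = Polynomial.C (Λ0 (P n * onp Λ0 P0 (n - j))) * (pZ Λ0 P0 ((n:ℤ) - i) * onp Λ0 P0 (n - j)) by ring, C_mul_map]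
      ring
    rw [e1]
    show _ = if i = 0 then (1:ℝ) else 0
    split_ifs with h
    · subst h
      rw [hpn n 0 (by omega), Nat.sub_zero, mul_comm (onp Λ0 P0 n),
        o.orth_coeff (fun m hm => onp_coeff_ge o0 hm), onp, coeff_C_mul, o0.coeff_self]
      have h1 := hsq n
      have h2 := o.N_pos n
      simp only [hκ]
      field_simp
    · by_cases hin : i ≤ n
      · rw [hpn n i hin, mul_comm (onp Λ0 P0 _), o.orth_lt (fun m hm => onp_coeff_ge o0 (by omega)), zero_mul]
      · rw [pZ_neg (k := (n:ℤ) - i) (by omega), zero_mul, map_zero, zero_mul]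
  have hye : ∀ K, HExp VB K y := by
    intro K
    refine solve_exp hC' hθ hθ1 hcl G hG hG0 hform hGe K y _ hyeq ?_ ?_
    · refine HExp.const VB.bcl (VB.exp 1 (1/2) (by norm_num) (by norm_num) (by norm_num)) ?_ K
      intro i
      show |if i = 0 then (1:ℝ) else 0| ≤ 1 * (1/2) ^ i
      split_ifs with h
      · subst h; simp
      · rw [abs_zero]; positivity
    · refine ⟨_, VB.exp 1 (1/2) (by norm_num) (by norm_num) (by norm_num), fun n hn i hi => ?_⟩
      simp only [hy]
      rw [pZ_neg (k := (n:ℤ) - i) (by omega), mul_zero, map_zero, zero_mul, abs_zero]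
      positivity
  have hy0 : ∀ n, y n 0 = Λ0 (P0 n * P0 n) / Λh (P n * P n) := by
    intro n
    simp only [hy, hκ]
    rw [hpn n 0 (by omega), Nat.sub_zero, onp, show P n * (Polynomial.C (√(Λ0 (P0 n * P0 n)))⁻¹ * P0 n) =
      Polynomial.C (√(Λ0 (P0 n * P0 n)))⁻¹ * (P0 n * P n) by ring, C_mul_map,
      o0.orth_coeff (fun m hm => o.coeff_gt hm), o.coeff_self]
    have h1 := hsq n
    have h2 := o.N_pos n
    field_simp
  have hy1 : ∀ n, 1 ≤ n → aN Λ0 P0 n * y n 1 = (sc P n - sc P0 n) * y n 0 := by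
    intro n hn
    rw [hy0]
    obtain ⟨k, rfl⟩ : ∃ k, n = k + 1 := ⟨n - 1, by omega⟩
    simp only [hy, hκ]
    rw [hpn (k+1) 1 (by omega), show k + 1 - 1 = k by omega, onp,
      show P (k+1) * (Polynomial.C (√(Λ0 (P0 k * P0 k)))⁻¹ * P0 k) =
      Polynomial.C (√(Λ0 (P0 k * P0 k)))⁻¹ * (P0 k * (P (k+1) - P0 (k+1)) + P0 k * P0 (k+1)) by ring, C_mul_map,
      map_add, o0.orth_ne (by omega : k ≠ k + 1), o0.orth_coeff (n := k) (q := P (k+1) - P0 (k+1)) (fun m hm => by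
        rw [coeff_sub]
        rcases (by omega : m = k + 1 ∨ k + 1 < m) with h | h
        · rw [h, o.coeff_self, o0.coeff_self, sub_self]
        · rw [o.coeff_gt h, o0.coeff_gt h, sub_self]), coeff_sub, ← OPS.sc_succ P, ← OPS.sc_succ P0, aN,
      show k + 1 - 1 = k by omega, Real.sqrt_div (o0.N_pos _).le]
    have h1 := hsq k
    have h1' := hsq (k+1)
    have h2 := o.N_pos (k+1)
    have q1 := Real.sq_sqrt (o0.N_pos k).le
    have q2 := Real.sq_sqrt (o0.N_pos (k+1)).le
    field_simp
    rw [q1, q2]; ring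
  have r0 : ∀ K, SExp K (fun n => y n 0) := fun K => (hye K).eval 0
  refine ⟨fun K => (r0 K).congr fun n hn => hy0 n, fun K => ?_, hlow⟩
  have hinv := SExp.inv (inv_pos.2 hcu) (r0 K) (fun n _ => by rw [hy0]; exact hlow n)
  refine ((hs K).add (((ha K).mul ((hye K).eval 1)).mul hinv)).congr fun n hn => ?_
  have hne : y n 0 ≠ 0 := by
    have := hlow n
    rw [← hy0] at this
    have h3 := inv_pos.2 hcu
    exact (lt_of_lt_of_le h3 this).ne'
  rw [hy1 n hn, mul_assoc, mul_inv_cancel₀ hne]; ring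

theorem core2 (o0 : OPS Λ0 P0) (o : OPS Λh P)
    (hT : ∀ (m : ℕ) (q : ℝ[X]), |Λ0 (Chebyshev.T ℝ (m:ℤ) * (q * q))| ≤ Λ0 (q * q))
    (ha : ∀ K, SExp K (aN Λ0 P0)) (hs : ∀ K, SExp K (sc P0))
    (ha2 : ∃ D, ∀ n : ℕ, 1 ≤ n → |aN Λ0 P0 n ^ 2 - 1/4| ≤ D / (n:ℝ) ^ 2)
    {c : ℕ → ℝ} {C θ : ℝ} (hC : 0 ≤ C) (hθ : 0 < θ) (hθ1 : θ < 1) (hc : ∀ m, |c m| ≤ C * (θ * θ) ^ m)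
    (hsum : ∀ q : ℝ[X], HasSum (fun m : ℕ => c m * Λ0 (Chebyshev.T ℝ (m:ℤ) * q)) (Λh q))
    {cl cu : ℝ} (hcl : 0 < cl) (hcu : 0 < cu) (hl : ∀ q : ℝ[X], cl * Λ0 (q * q) ≤ Λh (q * q))
    (hu : ∀ q : ℝ[X], Λh (q * q) ≤ cu * Λ0 (q * q)) :
    ∃ A B : ℕ → ℝ, ∀ l : ℕ, 1 ≤ l → ∃ C > (0:ℝ), ∀ n : ℕ, 1 ≤ n →
      |aN Λh P n - 1/2 - ∑ k ∈ Finset.Icc 2 l, A k / (n : ℝ) ^ k| ≤ C / (n : ℝ) ^ (l + 1) ∧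
      |(sc P n - sc P (n+1)) - ∑ k ∈ Finset.Icc 2 l, B k / (n : ℝ) ^ k| ≤ C / (n : ℝ) ^ (l + 1) := by
  have hann : ∀ n, 0 ≤ aN Λ0 P0 n := fun n => Real.sqrt_nonneg _
  obtain ⟨D, hD⟩ := ha2
  have hal2 : Tendsto (fun n => aN Λ0 P0 n ^ 2) atTop (nhds (1/4)) := by
    rw [tendsto_iff_norm_sub_tendsto_zero]
    refine squeeze_zero' (Eventually.of_forall fun _ => norm_nonneg _) ?_
      (tendsto_const_div_sq D)
    filter_upwards [eventually_ge_atTop 1] with n hn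
    exact hD n hn
  have hal : Tendsto (aN Λ0 P0) atTop (nhds (1/2)) := by
    have := (Real.continuous_sqrt.tendsto _).comp hal2
    rw [show √(1/4:ℝ) = 1/2 by
      rw [show (1/4:ℝ) = (1/2)^2 by norm_num]; exact Real.sqrt_sq (by norm_num)] at this
    exact this.congr fun n => Real.sqrt_sq (hann n)
  obtain ⟨hy, hsP, hlow⟩ := core o0 o hT ha hs hal hC hθ hθ1 hc hsum hcl hcu hl hu
  set y : ℕ → ℝ := fun n => Λ0 (P0 n * P0 n) / Λh (P n * P n) with hyd
  have hcu' := inv_pos.2 hcu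
  have hypos : ∀ n, 0 < y n := fun n => lt_of_lt_of_le hcu' (hlow n)
  have hinv : ∀ K, SExp K (fun n => (y n)⁻¹) := fun K => SExp.inv hcu' (hy K) (fun n _ => hlow n)
  have hyp : ∀ K, SExp K (fun n => y (n-1)) := fun K => (hy K).pred_shift
  -- squared coefficient
  set F : ℕ → ℝ := fun n => aN Λ0 P0 n ^ 2 * (y (n-1) * (y n)⁻¹) with hF
  have hFe : ∀ K, SExp K F := fun K =>
    (((ha K).mul (ha K)).mul ((hyp K).mul (hinv K))).congr fun n _ => by simp only [hF]; ring
  have hFa : ∀ n, aN Λh P n = √(F n) := by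
    intro n
    simp only [hF, hyd, aN]
    rw [Real.sq_sqrt (div_nonneg (o0.N_pos _).le (o0.N_pos _).le)]
    congr 1
    have h1 := o0.N_pos n
    have h2 := o0.N_pos (n-1)
    have h3 := o.N_pos n
    have h4 := o.N_pos (n-1)
    field_simp
  obtain ⟨E, hE⟩ := SExp.diff (hyp 2)
  obtain ⟨M, hM⟩ := SExp.zero_iff.1 (hinv 0)
  have hF2 : ∃ D, ∀ n : ℕ, 1 ≤ n → |F n - 1/4| ≤ D / (n:ℝ) ^ 2 := by
    obtain ⟨A, hA⟩ := SExp.zero_iff.1 (ha 0)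
    refine ⟨D + A ^ 2 * (E * M), fun n hn => ?_⟩
    have h1 := hD n hn
    have h2 := hE n hn
    have h3 := hM n hn
    have h4 := hA n hn
    simp only [Nat.add_sub_cancel] at h2
    have e : F n - 1/4 = (aN Λ0 P0 n ^ 2 - 1/4) + aN Λ0 P0 n ^ 2 * ((y (n-1) - y n) * (y n)⁻¹) := by
      have := (hypos n).ne'
      simp only [hF]
      field_simp
      ring
    rw [e]
    refine (abs_add_le _ _).trans ?_
    rw [add_div]
    refine add_le_add h1 ?_
    rw [abs_mul, abs_mul, abs_pow]
    have hE0 : 0 ≤ E / (n:ℝ)^2 := (abs_nonneg _).trans h2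
    calc |aN Λ0 P0 n| ^ 2 * (|y (n-1) - y n| * |(y n)⁻¹|) ≤ A ^ 2 * (E / (n:ℝ)^2 * M) :=
          mul_le_mul (pow_le_pow_left₀ (abs_nonneg _) h4 2)
            (mul_le_mul h2 h3 (abs_nonneg _) hE0) (by positivity) (by positivity)
      _ = _ := by ring
  obtain ⟨D', hD'⟩ := hF2
  have hFl : Tendsto F atTop (nhds (1/4)) := by
    rw [tendsto_iff_norm_sub_tendsto_zero]
    refine squeeze_zero' (Eventually.of_forall fun _ => norm_nonneg _) ?_
      (tendsto_const_div_sq D')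
    filter_upwards [eventually_ge_atTop 1] with n hn
    exact hD' n hn
  have hFpos : ∀ n, 1 ≤ n → 0 < F n := by
    intro n hn
    have : 0 < aN Λ0 P0 n := Real.sqrt_pos.2 (div_pos (o0.N_pos _) (o0.N_pos _))
    have h1 := hypos n
    have h2 := hypos (n-1)
    simp only [hF]; positivity
  obtain ⟨δ, hδ, hδF⟩ := SExp.lower (by norm_num) hFl hFpos
  have hae : ∀ K, SExp K (aN Λh P) := fun K =>
    (SExp.sqrt hδ (hFe K) hδF).congr fun n _ => (hFa n).symm
  obtain ⟨A, hA⟩ := SExp.final (L := 1/2) hae ⟨2 * D', fun n hn => by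
    have h1 := hD' n hn
    have h2 : 0 ≤ √(F n) := Real.sqrt_nonneg _
    have h3 := Real.sq_sqrt (hFpos n hn).le
    rw [hFa]
    have h4 : |F n - 1/4| = |√(F n) - 1/2| * (√(F n) + 1/2) := by
      rw [← abs_of_nonneg (show 0 ≤ √(F n) + 1/2 by positivity), ← abs_mul]
      congr 1; nlinarith
    have h5 : 2 * D' / (n:ℝ)^2 = 2 * (D' / (n:ℝ)^2) := by ring
    rw [h5]
    nlinarith [abs_nonneg (√(F n) - 1/2)]⟩
  obtain ⟨B, hB⟩ := SExp.final (f := fun n => sc P n - sc P (n+1)) (L := 0)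
    (fun K => (hsP K).sub (hsP K).succ_shift) (by
      obtain ⟨E, hE⟩ := SExp.diff (hsP 2)
      exact ⟨E, fun n hn => by rw [sub_zero]; exact hE n hn⟩)
  refine ⟨A, B, fun l hl => ?_⟩
  obtain ⟨C1, h1⟩ := hA l hl
  obtain ⟨C2, h2⟩ := hB l hl
  refine ⟨max 1 (max C1 C2), lt_max_of_lt_left one_pos, fun n hn => ⟨?_, ?_⟩⟩
  · exact (h1 n hn).trans (div_le_div_of_nonneg_right ((le_max_left _ _).trans (le_max_right _ _)) (by positivity))
  · have := h2 n hn
    rw [sub_zero] at this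
    exact this.trans (div_le_div_of_nonneg_right ((le_max_right _ _).trans (le_max_right _ _)) (by positivity))

end core


section jac
open Polynomial

/-- the Jacobi differential operator -/
def jop (α β : ℝ) (p : ℝ[X]) : ℝ[X] :=
  derivative (derivative p) - X * (X * derivative (derivative p)) + C (β - α) * derivative p
    - C (α + β + 2) * (X * derivative p)

theorem coeff_X_der (p : ℝ[X]) (m : ℕ) : (X * derivative p).coeff m = m * p.coeff m := by
  cases m with
  | zero => simp
  | succ m => rw [coeff_X_mul, coeff_derivative]; push_cast; ring

theorem coeff_XX_der (p : ℝ[X]) (m : ℕ) :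
    (X * (X * derivative (derivative p))).coeff m = m * (m - 1) * p.coeff m := by
  cases m with
  | zero => simp
  | succ m =>
    rw [coeff_X_mul, coeff_X_der, coeff_derivative]; push_cast; ring

theorem jop_coeff (α β : ℝ) (p : ℝ[X]) (m : ℕ) :
    (jop α β p).coeff m = (m + 2) * (m + 1) * p.coeff (m + 2) + (β - α) * (m + 1) * p.coeff (m + 1)
      - m * (m + α + β + 1) * p.coeff m := by
  rw [jop, coeff_sub, coeff_add, coeff_sub, coeff_C_mul, coeff_C_mul, coeff_X_der, coeff_XX_der,
    coeff_derivative, coeff_derivative, coeff_derivative]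
  push_cast; ring

variable {Λ : ℝ[X] →ₗ[ℝ] ℝ} {P : ℕ → ℝ[X]}

theorem jac_eigen {α β : ℝ} (o : OPS Λ P) (hL : ∀ p q, Λ (jop α β p * q) = Λ (p * jop α β q)) (n : ℕ) :
    jop α β (P n) + C (n * (n + α + β + 1)) * P n = 0 := by
  refine o.eq_zero_of (n := n) ?_ ?_
  · intro m hm
    rw [coeff_add, coeff_C_mul, jop_coeff]
    rcases hm.eq_or_lt with rfl | h
    · rw [o.coeff_gt (by omega : n < n + 2), o.coeff_gt (by omega : n < n + 1)]; ring
    · rw [o.coeff_gt (by omega : n < m + 2), o.coeff_gt (by omega : n < m + 1), o.coeff_gt h]; ring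
  · intro k hk
    rw [mul_add, map_add, ← hL, mul_comm (jop _ _ _), o.orth_lt (n := n) (q := jop α β (P k)),
      show P k * (C ((n:ℝ) * (n + α + β + 1)) * P n) = C ((n:ℝ) * (n + α + β + 1)) * (P k * P n) by ring,
      C_mul_map, o.orth_ne (by omega), mul_zero, add_zero]
    intro m hm
    rw [jop_coeff, o.coeff_gt (by omega : k < m + 2), o.coeff_gt (by omega : k < m + 1),
      o.coeff_gt (by omega : k < m)]
    ring

theorem jac_sc {α β : ℝ} (o : OPS Λ P) (hL : ∀ p q, Λ (jop α β p * q) = Λ (p * jop α β q)) (n : ℕ)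
    (hn : 1 ≤ n) : sc P n * (2 * n + α + β) = n * (α - β) := by
  obtain ⟨k, rfl⟩ : ∃ k, n = k + 1 := ⟨n - 1, by omega⟩
  have h := congrArg (fun p => p.coeff k) (jac_eigen o hL (k+1))
  simp only [coeff_add, coeff_C_mul, jop_coeff, coeff_zero, o.coeff_self,
    o.coeff_gt (by omega : k + 1 < k + 2)] at h
  rw [OPS.sc_succ]
  push_cast at h ⊢
  linear_combination h

theorem jac_tc {α β : ℝ} (o : OPS Λ P) (hL : ∀ p q, Λ (jop α β p * q) = Λ (p * jop α β q)) (n : ℕ)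
    (hn : 2 ≤ n) : tc P n * (4 * n - 2 + 2 * (α + β)) + (n - 1) * (β - α) * sc P n + n * (n - 1) = 0 := by
  obtain ⟨k, rfl⟩ : ∃ k, n = k + 2 := ⟨n - 2, by omega⟩
  have h := congrArg (fun p => p.coeff k) (jac_eigen o hL (k+2))
  simp only [coeff_add, coeff_C_mul, jop_coeff, coeff_zero, o.coeff_self] at h
  have : tc P (k+2) = (P (k+2)).coeff k := by rw [tc, coeff_X_mul, coeff_X_mul]
  rw [OPS.sc_succ, this]
  push_cast at h ⊢
  linear_combination h

theorem SExp_inv_nat (K : ℕ) (c : ℝ) : SExp K (fun n => c / n) := (SExp.const K c).div_nat.pred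

theorem jac_base {α β : ℝ} (hα : -1 < α) (hβ : -1 < β) (o : OPS Λ P)
    (hL : ∀ p q, Λ (jop α β p * q) = Λ (p * jop α β q)) :
    (∀ K, SExp K (aN Λ P)) ∧ (∀ K, SExp K (sc P)) ∧
    ∃ D, ∀ n : ℕ, 1 ≤ n → |aN Λ P n ^ 2 - 1/4| ≤ D / (n:ℝ) ^ 2 := by
  have h1n : ∀ c : ℝ, Tendsto (fun n : ℕ => c / (n:ℝ)) atTop (nhds 0) :=
    fun c => tendsto_const_nhds.div_atTop tendsto_natCast_atTop_atTop
  have hs : ∀ K, SExp K (sc P) := by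
    have hp : ∀ n : ℕ, 1 ≤ n → 0 < 2 + (α + β) / (n:ℝ) := by
      intro n hn
      have hn1 : (1:ℝ) ≤ n := by exact_mod_cast hn
      rw [show 2 + (α + β) / (n:ℝ) = (2 * n + (α + β)) / n by field_simp]
      apply div_pos <;> linarith
    obtain ⟨δ, hδ, hd⟩ := SExp.lower (f := fun n : ℕ => 2 + (α + β) / (n:ℝ)) (L := 2) (by norm_num)
      (by simpa using (h1n (α + β)).const_add 2) hp
    intro K
    refine (((((SExp.const K 2).add (SExp_inv_nat K (α + β))).inv hδ hd)).smul (α - β)).congr ?_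
    intro n hn
    have h := jac_sc o hL n hn
    have hn1 : (1:ℝ) ≤ n := by exact_mod_cast hn
    have hq := hp n hn
    have : (n:ℝ) ≠ 0 := by positivity
    show (α - β) * (2 + (α + β) / (n:ℝ))⁻¹ = sc P n
    rw [← div_eq_mul_inv, div_eq_iff hq.ne']
    field_simp
    linear_combination -h
  -- tc
  set g : ℕ → ℝ := fun n => tc P n + n / 4 with hg
  have hge : ∀ K, SExp K g := by
    set d : ℕ → ℝ := fun n => if n ≤ 1 then 1 else 4 + (2 * (α + β) - 2) / (n:ℝ) with hd
    have hde : ∀ K, SExp K d := fun K =>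
      SExp.congr_large 1 ((SExp.const K 4).add (SExp_inv_nat K (2 * (α + β) - 2)))
        (fun n hn => by simp only [hd]; rw [if_neg (by omega)])
    have hp : ∀ n : ℕ, 1 ≤ n → 0 < d n := by
      intro n hn
      simp only [hd]
      split_ifs with h
      · norm_num
      · have hn1 : (2:ℝ) ≤ n := by exact_mod_cast (by omega : 2 ≤ n)
        rw [show 4 + (2 * (α + β) - 2) / (n:ℝ) = (4 * n + (2 * (α + β) - 2)) / n by field_simp]
        apply div_pos <;> linarith
    obtain ⟨δ, hδ, hdd⟩ := SExp.lower (f := d) (L := 4) (by norm_num) (by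
      have : Tendsto (fun n : ℕ => 4 + (2 * (α + β) - 2) / (n:ℝ)) atTop (nhds 4) := by
        simpa using (h1n (2 * (α + β) - 2)).const_add 4
      refine this.congr' ?_
      filter_upwards [eventually_gt_atTop 1] with n hn
      simp only [hd]; rw [if_neg (by omega)]) hp
    intro K
    refine SExp.congr_large 1 (((((SExp.const K 1).sub (SExp_inv_nat K 1)).mul (hs K)).smul (α - β)).add
      (SExp.const K ((1 + α + β) / 2)) |>.mul ((hde K).inv hδ hdd)) ?_
    intro n hn
    have h := jac_tc o hL n hn
    have hq := hp n (by omega)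
    show tc P n + n / 4 = ((α - β) * ((1 - 1 / n) * sc P n) + (1 + α + β) / 2) * (d n)⁻¹
    rw [← div_eq_mul_inv, eq_div_iff hq.ne']
    simp only [hd]; rw [if_neg (by omega)]
    have : (n:ℝ) ≠ 0 := by
      have : 0 < n := by omega
      positivity
    field_simp
    linear_combination 8 * h
  have hsq : ∀ n, 1 ≤ n → aN Λ P n ^ 2 = 1/4 + (g n - g (n+1)) - (sc P n - sc P (n+1)) * sc P n := by
    intro n hn
    obtain ⟨k, rfl⟩ : ∃ k, n = k + 1 := ⟨n - 1, by omega⟩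
    have h := o.ratio_coeff k
    rw [aN, Real.sq_sqrt (div_nonneg (o.N_pos _).le (o.N_pos _).le), Nat.add_sub_cancel, h]
    simp only [hg]; push_cast; ring
  have hD : ∃ D, ∀ n : ℕ, 1 ≤ n → |aN Λ P n ^ 2 - 1/4| ≤ D / (n:ℝ) ^ 2 := by
    obtain ⟨E1, hE1⟩ := SExp.diff (hge 2)
    obtain ⟨E2, hE2⟩ := SExp.diff (hs 2)
    obtain ⟨M, hM⟩ := SExp.zero_iff.1 (hs 0)
    refine ⟨E1 + E2 * M, fun n hn => ?_⟩
    rw [hsq n hn, show 1/4 + (g n - g (n+1)) - (sc P n - sc P (n+1)) * sc P n - 1/4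
      = (g n - g (n+1)) - (sc P n - sc P (n+1)) * sc P n by ring]
    refine (abs_sub _ _).trans ?_
    rw [abs_mul, add_div]
    refine add_le_add (hE1 n hn) ?_
    have := mul_le_mul (hE2 n hn) (hM n hn) (abs_nonneg _) ((abs_nonneg _).trans (hE2 n hn))
    rw [mul_div_right_comm]; exact this
  refine ⟨?_, hs, hD⟩
  obtain ⟨D, hD⟩ := hD
  have hl : Tendsto (fun n => aN Λ P n ^ 2) atTop (nhds (1/4)) := by
    rw [tendsto_iff_norm_sub_tendsto_zero]
    refine squeeze_zero' (Eventually.of_forall fun _ => norm_nonneg _) ?_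
      (tendsto_const_div_sq D)
    filter_upwards [eventually_ge_atTop 1] with n hn
    exact hD n hn
  have hpos : ∀ n, 0 < aN Λ P n := fun n => Real.sqrt_pos.2 (div_pos (o.N_pos _) (o.N_pos _))
  obtain ⟨δ, hδ, hd⟩ := SExp.lower (by norm_num) hl (fun n _ => pow_pos (hpos n) 2)
  intro K
  have he : SExp K (fun n => aN Λ P n ^ 2) :=
    ((SExp.const K (1/4)).add ((hge K).sub (hge K).succ_shift)).sub
      (((hs K).sub (hs K).succ_shift).mul (hs K)) |>.congr fun n hn => (hsq n hn).symm
  exact (SExp.sqrt hδ he hd).congr fun n _ => Real.sqrt_sq (hpos n).le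

end jac


section wt
open Polynomial

theorem ii_poly {v : ℝ → ℝ} (hv : IntervalIntegrable v volume (-1) 1) (p : ℝ[X]) :
    IntervalIntegrable (fun x => p.eval x * v x) volume (-1) 1 :=
  hv.continuousOn_mul p.continuous.continuousOn

/-- functional of integration against a weight -/
def Lam (v : ℝ → ℝ) (hv : IntervalIntegrable v volume (-1) 1) : ℝ[X] →ₗ[ℝ] ℝ where
  toFun p := ∫ x in (-1:ℝ)..1, p.eval x * v x
  map_add' p q := by
    rw [← intervalIntegral.integral_add (ii_poly hv p) (ii_poly hv q)]
    congr 1; ext x; simp [add_mul]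
  map_smul' r p := by
    rw [RingHom.id_apply, smul_eq_mul, ← intervalIntegral.integral_const_mul]
    congr 1; ext x; simp [mul_assoc]

theorem Lam_apply {v : ℝ → ℝ} (hv : IntervalIntegrable v volume (-1) 1) (p : ℝ[X]) :
    Lam v hv p = ∫ x in (-1:ℝ)..1, p.eval x * v x := rfl

theorem Lam_pos {v : ℝ → ℝ} (hv : IntervalIntegrable v volume (-1) 1)
    (hpos : ∀ x ∈ Ioo (-1:ℝ) 1, 0 < v x) (p : ℝ[X]) (hp : p ≠ 0) : 0 < Lam v hv (p * p) := by
  rw [Lam_apply, intervalIntegral.integral_of_le (by norm_num), integral_Ioc_eq_integral_Ioo]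
  have hi : IntegrableOn (fun x => (p * p).eval x * v x) (Ioo (-1) 1) := by
    have := ii_poly hv (p * p)
    rw [intervalIntegrable_iff_integrableOn_Ioo_of_le (by norm_num)] at this
    exact this
  rw [setIntegral_pos_iff_support_of_nonneg_ae ?_ hi]
  · have hsub : Ioo (-1:ℝ) 1 \ (p.roots.toFinset : Set ℝ) ⊆
        Function.support (fun x => (p * p).eval x * v x) ∩ Ioo (-1) 1 := by
      rintro x ⟨hx, hx'⟩
      refine ⟨?_, hx⟩
      have : p.eval x ≠ 0 := by
        intro h; apply hx'; simp [hp, h]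
      have h2 := hpos x hx
      simp only [Function.mem_support, eval_mul]
      positivity
    refine lt_of_lt_of_le ?_ (measure_mono hsub)
    rw [measure_sdiff_null ((Finset.finite_toSet _).measure_zero _)]
    simp
  · filter_upwards [ae_restrict_mem measurableSet_Ioo] with x hx
    have := hpos x hx
    simp only [eval_mul, Pi.zero_apply]
    have h2 := mul_self_nonneg (p.eval x)
    positivity

/-- Jacobi weight -/
def w0 (α β : ℝ) (x : ℝ) : ℝ := (1 - x) ^ α * (1 + x) ^ β

theorem w0_pos {α β x : ℝ} (hx : x ∈ Ioo (-1:ℝ) 1) : 0 < w0 α β x :=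
  mul_pos (Real.rpow_pos_of_pos (by linarith [hx.2]) _) (Real.rpow_pos_of_pos (by linarith [hx.1]) _)

theorem w0_int {α β : ℝ} (hα : -1 < α) (hβ : -1 < β) :
    IntervalIntegrable (w0 α β) volume (-1) 1 := by
  refine IntervalIntegrable.trans (b := 0) ?_ ?_
  · have h := (intervalIntegral.intervalIntegrable_rpow' (a := 0) (b := 1) hβ).comp_add_left 1
    norm_num at h
    refine h.continuousOn_mul (g := fun x => (1 - x) ^ α) ?_
    intro x hx
    rw [uIcc_of_le (by norm_num)] at hx
    exact ((Real.continuousAt_rpow_const _ _ (Or.inl (by linarith [hx.2]))).comp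
      (f := fun x : ℝ => 1 - x) (by fun_prop)).continuousWithinAt
  · have h := (intervalIntegral.intervalIntegrable_rpow' (a := 0) (b := 1) hα).comp_sub_left 1
    norm_num at h
    have h := h.symm
    refine h.mul_continuousOn (g := fun x => (1 + x) ^ β) ?_
    intro x hx
    rw [uIcc_of_le (by norm_num)] at hx
    exact ((Real.continuousAt_rpow_const _ _ (Or.inl (by linarith [hx.1]))).comp
      (f := fun x : ℝ => 1 + x) (by fun_prop)).continuousWithinAt

theorem jop_symm {α β : ℝ} (hα : -1 < α) (hβ : -1 < β) (p q : ℝ[X]) :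
    Lam (w0 α β) (w0_int hα hβ) (jop α β p * q) = Lam (w0 α β) (w0_int hα hβ) (p * jop α β q) := by
  rw [← sub_eq_zero, ← map_sub, Lam_apply]
  set W : ℝ[X] := derivative p * q - p * derivative q with hW
  have h := intervalIntegral.integral_eq_sub_of_hasDerivAt_of_le (a := -1) (b := 1)
    (f := fun x : ℝ => (1 - x) ^ (α + 1) * (1 + x) ^ (β + 1) * W.eval x)
    (f' := fun x => (jop α β p * q - p * jop α β q).eval x * w0 α β x) (by norm_num) ?_ ?_
    (ii_poly (w0_int hα hβ) _)
  · rw [h]; simp [Real.zero_rpow (by linarith : α + 1 ≠ 0), Real.zero_rpow (by linarith : β + 1 ≠ 0)]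
  · refine Continuous.continuousOn (((Continuous.rpow_const (by fun_prop) ?_).mul
      (Continuous.rpow_const (by fun_prop) ?_)).mul W.continuous)
    · intro x; right; linarith
    · intro x; right; linarith
  · intro x hx
    have h1 : (1 - x) ≠ 0 := by linarith [hx.2]
    have h2 : (1 + x) ≠ 0 := by linarith [hx.1]
    have d1 : HasDerivAt (fun x : ℝ => (1 - x) ^ (α + 1)) (-1 * (α + 1) * (1 - x) ^ (α + 1 - 1)) x :=
      ((hasDerivAt_id x).const_sub 1).rpow_const (Or.inl h1)
    have d2 : HasDerivAt (fun x : ℝ => (1 + x) ^ (β + 1)) (1 * (β + 1) * (1 + x) ^ (β + 1 - 1)) x :=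
      ((hasDerivAt_id x).const_add 1).rpow_const (Or.inl h2)
    refine ((d1.mul d2).mul (W.hasDerivAt x)).congr_deriv ?_
    simp only [Pi.mul_apply]
    simp only [w0, add_sub_cancel_right]
    rw [Real.rpow_add_one h1, Real.rpow_add_one h2]
    simp only [jop, hW, eval_sub, eval_mul, eval_add, eval_X, eval_C, derivative_sub, derivative_mul]
    ring

end wt



section cheb

theorem _root_.HasSum.congr_fun' {f g : ℕ → ℝ} {s : ℝ} (h : HasSum f s) (hfg : ∀ n, g n = f n) : HasSum g s := by
  rw [show g = f from funext hfg]; exact h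

instance factTwoPi : Fact (0 < 2 * Real.pi) := ⟨Real.two_pi_pos⟩

theorem cheb_annulus {U : Set ℂ} (hU : IsOpen U) (hs : seg ⊆ U) :
    ∃ r : ℝ, 1 < r ∧ ∀ z : ℂ, 1 ≤ ‖z‖ → ‖z‖ ≤ r → (z + z⁻¹) / 2 ∈ U := by
  have hJ : ContinuousOn (fun z : ℂ => (z + z⁻¹) / 2) {0}ᶜ := by
    intro z hz
    have : z ≠ 0 := hz
    exact ((continuousAt_id.add (continuousAt_inv₀ this)).div_const 2).continuousWithinAt
  have hV := hJ.isOpen_inter_preimage isOpen_compl_singleton hU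
  obtain ⟨δ, hδ, hsub⟩ := (isCompact_sphere (0:ℂ) 1).exists_cthickening_subset_open hV (by
    intro z hz
    have h1 : ‖z‖ = 1 := by simpa using hz
    refine ⟨by intro h; rw [mem_singleton_iff] at h; simp [h] at h1, hs ⟨z.re, ?_, ?_⟩⟩
    · have := Complex.abs_re_le_norm z
      rw [h1, abs_le] at this; exact this
    · show (z.re : ℂ) = (z + z⁻¹) / 2
      rw [Complex.inv_eq_conj h1, Complex.add_conj]; push_cast; ring)
  refine ⟨1 + δ, by linarith, fun z h1 h2 => ?_⟩
  have hz : z ≠ 0 := by intro h; simp [h] at h1; linarith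
  refine (hsub (Metric.mem_cthickening_of_dist_le z (z / ‖z‖) δ _ ?_ ?_)).2
  · have : ‖z‖ ≠ 0 := by linarith
    simp [this]
  · have h0 : (‖z‖:ℂ) ≠ 0 := by exact_mod_cast (by linarith : ‖z‖ ≠ 0)
    rw [dist_eq_norm, show z - z / ‖z‖ = ((‖z‖ - 1 : ℝ) : ℂ) * (z / ‖z‖) by push_cast; field_simp,
      norm_mul, norm_div, Complex.norm_real, Complex.norm_real, norm_norm, div_self (by linarith), mul_one,
      Real.norm_eq_abs, abs_of_nonneg (by linarith)]
    linarith

/-- h composed with cosine on the circle -/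
def hcos {U : Set ℂ} {h : ℂ → ℂ} (hs : seg ⊆ U) (hc : ContinuousOn h U) : C(AddCircle (2 * Real.pi), ℂ) where
  toFun t := h ((Real.Angle.cos t : ℝ) : ℂ)
  continuous_toFun := by
    refine hc.comp_continuous (Complex.continuous_ofReal.comp Real.Angle.continuous_cos) ?_
    intro t
    refine hs ⟨_, ?_, rfl⟩
    induction t using Real.Angle.induction_on with
    | _ x => exact ⟨Real.neg_one_le_cos x, Real.cos_le_one x⟩

theorem hcos_coe {U : Set ℂ} {h : ℂ → ℂ} (hs : seg ⊆ U) (hc : ContinuousOn h U) (x : ℝ) :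
    hcos hs hc (x : AddCircle (2 * Real.pi)) = h ((Real.cos x : ℝ) : ℂ) := rfl

theorem fourier_two_pi (n : ℤ) (x : ℝ) :
    (fourier n) (x : AddCircle (2 * Real.pi)) = Complex.exp (n * x * I) := by
  rw [fourier_coe_apply]
  congr 1
  have : (Real.pi : ℂ) ≠ 0 := by exact_mod_cast Real.pi_ne_zero
  push_cast
  field_simp

theorem hcos_symm {U : Set ℂ} {h : ℂ → ℂ} (hs : seg ⊆ U) (hc : ContinuousOn h U) (n : ℤ) :
    fourierCoeff (hcos hs hc) (-n) = fourierCoeff (hcos hs hc) n := by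
  rw [fourierCoeff_eq_intervalIntegral _ _ (-Real.pi), fourierCoeff_eq_intervalIntegral _ _ (-Real.pi),
    show -Real.pi + 2 * Real.pi = Real.pi by ring]
  congr 1
  have := intervalIntegral.integral_comp_neg (a := -Real.pi) (b := Real.pi)
    (fun x : ℝ => (fourier (-n)) (x : AddCircle (2 * Real.pi)) • hcos hs hc x)
  rw [neg_neg] at this
  rw [← this]
  congr 1; ext x
  rw [hcos_coe, hcos_coe, Real.cos_neg, fourier_two_pi, fourier_two_pi]
  push_cast
  congr 2; ring

theorem hcos_decay {U : Set ℂ} (hU : IsOpen U) {h : ℂ → ℂ} (hs : seg ⊆ U) (hd : DifferentiableOn ℂ h U) :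
    ∃ M r : ℝ, 0 ≤ M ∧ 1 < r ∧ ∀ n : ℕ, ‖fourierCoeff (hcos hs hd.continuousOn) n‖ ≤ M * (r⁻¹) ^ n := by
  obtain ⟨r, hr, hrU⟩ := cheb_annulus hU hs
  have hr0 : 0 < r := by linarith
  set F : ℂ → ℂ := fun z => h ((z + z⁻¹) / 2) with hF
  have hFd : ∀ z : ℂ, 1 ≤ ‖z‖ → ‖z‖ ≤ r → DifferentiableAt ℂ F z := by
    intro z h1 h2
    have hz : z ≠ 0 := by intro h; simp [h] at h1; linarith
    have := (hd.differentiableAt (hU.mem_nhds (hrU z h1 h2)))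
    exact DifferentiableAt.comp (g := h) (f := fun z : ℂ => (z + z⁻¹) / 2) z this
      ((differentiableAt_id.add (differentiableAt_inv hz)).div_const 2)
  obtain ⟨M, hM⟩ := (isCompact_sphere (0:ℂ) r).exists_bound_of_continuousOn (f := F) (by
    intro z hz
    have : ‖z‖ = r := by simpa using hz
    exact (hFd z (by linarith) this.le).continuousAt.continuousWithinAt)
  have hM0 : 0 ≤ M := (norm_nonneg _).trans (hM r (by simp [abs_of_pos hr0]))
  refine ⟨M, r, hM0, hr, fun n => ?_⟩
  have e1 : fourierCoeff (hcos hs hd.continuousOn) n =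
      (2 * Real.pi * I)⁻¹ * ∮ z in C(0, 1), F z * (z ^ (n+1))⁻¹ := by
    rw [fourierCoeff_eq_intervalIntegral _ _ 0, zero_add, circleIntegral, ← intervalIntegral.integral_const_mul,
      ← intervalIntegral.integral_smul]
    congr 1; ext x
    have hx : Complex.exp (x * I) ≠ 0 := Complex.exp_ne_zero _
    have hp : (Real.pi : ℂ) ≠ 0 := by exact_mod_cast Real.pi_ne_zero
    rw [hcos_coe, fourier_two_pi, deriv_circleMap]
    simp only [circleMap, hF, zero_add, Complex.ofReal_one, one_mul, smul_eq_mul]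
    rw [← Complex.exp_neg, show (Complex.exp (x * I) + Complex.exp (-(x * I))) / 2 = Complex.cos x by
      rw [Complex.cos, neg_mul], Complex.ofReal_cos, ← Complex.exp_nat_mul, ← Complex.exp_neg, real_smul]
    have : Complex.exp (((-(n:ℤ):ℤ):ℂ) * x * I) = Complex.exp (x * I) * Complex.exp (-(((n+1:ℕ):ℂ) * (x * I))) := by
      rw [← Complex.exp_add]; congr 1; push_cast; ring
    rw [this]
    push_cast
    field_simp
  have e2 : (∮ z in C(0, r), F z * (z ^ (n+1))⁻¹) = ∮ z in C(0, 1), F z * (z ^ (n+1))⁻¹ := by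
    have hdd : ∀ z : ℂ, 1 ≤ ‖z‖ → ‖z‖ ≤ r → DifferentiableAt ℂ (fun z => F z * (z ^ (n+1))⁻¹) z := by
      intro z h1 h2
      have hz : z ≠ 0 := by intro h; simp [h] at h1; linarith
      exact (hFd z h1 h2).mul ((differentiableAt_id.pow (n+1)).inv (pow_ne_zero _ hz))
    refine Complex.circleIntegral_eq_of_differentiable_on_annulus_off_countable one_pos hr.le
      (Set.countable_empty) ?_ ?_
    · intro z hz
      simp only [Set.mem_sdiff, Metric.mem_closedBall, dist_zero_right, Metric.mem_ball, not_lt] at hz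
      exact (hdd z hz.2 hz.1).continuousAt.continuousWithinAt
    · intro z hz
      simp only [Set.mem_sdiff, Metric.mem_closedBall, dist_zero_right, Metric.mem_ball, not_le] at hz
      exact hdd z hz.1.2.le hz.1.1.le
  rw [e1, ← e2, norm_mul]
  have hb := circleIntegral.norm_integral_le_of_norm_le_const (f := fun z => F z * (z ^ (n+1))⁻¹) (c := 0)
    (R := r) (C := M * (r ^ (n+1))⁻¹) hr0.le (by
      intro z hz
      have h1 : ‖z‖ = r := by simpa using hz
      rw [norm_mul, norm_inv, norm_pow, h1]
      exact mul_le_mul_of_nonneg_right (hM z hz) (by positivity))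
  have h2 : ‖(2 * Real.pi * I : ℂ)⁻¹‖ = (2 * Real.pi)⁻¹ := by
    simp [abs_of_pos Real.pi_pos]
  rw [h2]
  refine (mul_le_mul_of_nonneg_left hb (by positivity)).trans (le_of_eq ?_)
  have := Real.pi_pos
  rw [inv_pow]
  field_simp
  ring

open Polynomial in
theorem cheb_expand {U : Set ℂ} (hU : IsOpen U) {h : ℂ → ℂ} (hs : seg ⊆ U) (hd : DifferentiableOn ℂ h U) :
    ∃ (c : ℕ → ℝ) (C θ : ℝ), 0 ≤ C ∧ 0 < θ ∧ θ < 1 ∧ (∀ m, |c m| ≤ C * (θ * θ) ^ m) ∧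
      ∀ x ∈ Icc (-1:ℝ) 1, HasSum (fun m : ℕ => c m * (Chebyshev.T ℝ (m:ℤ)).eval x) (h x).re := by
  obtain ⟨M, r, hM, hr, hdec⟩ := hcos_decay hU hs hd
  set f := hcos hs hd.continuousOn with hf
  have hr0 : 0 < r := by linarith
  have hri : r⁻¹ < 1 := inv_lt_one_of_one_lt₀ hr
  set a : ℕ → ℂ := fun n => fourierCoeff f n with ha
  have hsum : Summable (fourierCoeff f) := by
    have h1 : Summable (fun n : ℕ => fourierCoeff f n) :=
      Summable.of_norm_bounded ((summable_geometric_of_lt_one (by positivity) hri).mul_left M) hdec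
    refine Summable.of_nat_of_neg h1 ?_
    simpa only [hf, hcos_symm] using h1
  refine ⟨fun m => 2 * (a m).re - if m = 0 then (a 0).re else 0, 3 * M, √(r⁻¹), by positivity,
    by positivity, ?_, ?_, ?_⟩
  · rw [Real.sqrt_lt' one_pos]; simpa using hri
  · intro m
    rw [Real.mul_self_sqrt (by positivity)]
    have h1 := (Complex.abs_re_le_norm (a m)).trans (hdec m)
    show |2 * (a m).re - if m = 0 then (a 0).re else 0| ≤ _
    split_ifs with h0
    · subst h0
      rw [show 2 * (a 0).re - (a 0).re = (a 0).re by ring]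
      refine h1.trans ?_
      simp only [pow_zero, mul_one]; linarith
    · rw [sub_zero, abs_mul, abs_two]
      have : 0 ≤ M * r⁻¹ ^ m := by positivity
      linarith
  · intro x hx
    obtain ⟨t, rfl⟩ : ∃ t, Real.cos t = x := ⟨Real.arccos x, Real.cos_arccos hx.1 hx.2⟩
    have h1 := (has_pointwise_sum_fourier_series_of_summable hsum (t : AddCircle (2 * Real.pi))).nat_add_neg
    have h2 := Complex.hasSum_re h1
    have h3 := h2.sub (hasSum_ite_eq (0:ℕ) (a 0).re)
    have hval : (h ((Real.cos t : ℝ) : ℂ)).re = (f t + fourierCoeff f 0 • (fourier 0) (t : AddCircle (2 * Real.pi))).re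
        - (a 0).re := by
      rw [hf, hcos_coe, ← hf, fourier_zero]; simp [ha]
    rw [hval]
    refine h3.congr_fun' fun m => ?_
    have e : (fourierCoeff f (m:ℤ) • (fourier (m:ℤ)) (t : AddCircle (2 * Real.pi)) +
        fourierCoeff f (-(m:ℤ)) • (fourier (-(m:ℤ))) (t : AddCircle (2 * Real.pi)))
        = a m * ((2 * Real.cos (m * t) : ℝ) : ℂ) := by
      rw [hf, hcos_symm, ← hf, fourier_two_pi, fourier_two_pi]
      push_cast
      rw [Complex.two_cos]
      simp only [ha, smul_eq_mul]
      rw [← mul_add]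
      congr 3
      ring
    rw [e, Complex.re_mul_ofReal, Chebyshev.T_real_cos]
    by_cases h0 : m = 0
    · subst h0; simp; ring
    · simp [h0]; ring

end cheb


section fin
open Polynomial

theorem ii_congr_Ioo {f g : ℝ → ℝ} (h : ∀ x ∈ Ioo (-1:ℝ) 1, f x = g x) :
    ∫ x in (-1:ℝ)..1, f x = ∫ x in (-1:ℝ)..1, g x := by
  rw [intervalIntegral.integral_of_le (by norm_num), intervalIntegral.integral_of_le (by norm_num),
    integral_Ioc_eq_integral_Ioo, integral_Ioc_eq_integral_Ioo]
  exact setIntegral_congr_fun measurableSet_Ioo h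

theorem Lam_mono {u v : ℝ → ℝ} (hu : IntervalIntegrable u volume (-1) 1)
    (hv : IntervalIntegrable v volume (-1) 1) (p q : ℝ[X])
    (h : ∀ x ∈ Ioo (-1:ℝ) 1, p.eval x * u x ≤ q.eval x * v x) : Lam u hu p ≤ Lam v hv q :=
  intervalIntegral.integral_mono_on_of_le_Ioo (by norm_num) (ii_poly hu p) (ii_poly hv q) h

theorem Lam_T {v : ℝ → ℝ} (hv : IntervalIntegrable v volume (-1) 1)
    (hpos : ∀ x ∈ Ioo (-1:ℝ) 1, 0 < v x) (m : ℕ) (q : ℝ[X]) :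
    |Lam v hv (Chebyshev.T ℝ (m:ℤ) * (q * q))| ≤ Lam v hv (q * q) := by
  have key : ∀ x ∈ Ioo (-1:ℝ) 1, |(Chebyshev.T ℝ (m:ℤ) * (q * q)).eval x * v x| ≤ (q * q).eval x * v x := by
    intro x hx
    have h1 := Chebyshev.abs_eval_T_real_le_one (m:ℤ) (abs_le.2 ⟨hx.1.le, hx.2.le⟩)
    have h2 : 0 ≤ (q * q).eval x * v x := by
      rw [eval_mul]; exact mul_nonneg (mul_self_nonneg _) (hpos x hx).le
    rw [eval_mul, mul_assoc, abs_mul, abs_of_nonneg h2]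
    exact mul_le_of_le_one_left h2 h1
  rw [abs_le, ← map_neg]
  constructor
  · refine Lam_mono hv hv _ _ fun x hx => ?_
    have := (abs_le.1 (key x hx)).1
    rw [eval_neg, neg_mul]; exact this
  · exact Lam_mono hv hv _ _ fun x hx => (abs_le.1 (key x hx)).2

theorem Lam_hasSum {v g : ℝ → ℝ} (hv : IntervalIntegrable v volume (-1) 1)
    (hvg : IntervalIntegrable (fun x => v x * g x) volume (-1) 1)
    {c : ℕ → ℝ} {C θ : ℝ} (hθ : 0 < θ) (hθ1 : θ < 1)
    (hc : ∀ m, |c m| ≤ C * (θ * θ) ^ m)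
    (hs : ∀ x ∈ Icc (-1:ℝ) 1, HasSum (fun m : ℕ => c m * (Chebyshev.T ℝ (m:ℤ)).eval x) (g x)) (q : ℝ[X]) :
    HasSum (fun m : ℕ => c m * Lam v hv (Chebyshev.T ℝ (m:ℤ) * q)) (Lam (fun x => v x * g x) hvg q) := by
  have hgeo : Summable (fun m : ℕ => C * (θ * θ) ^ m) :=
    (summable_geometric_of_lt_one (by positivity) (by nlinarith)).mul_left C
  have := intervalIntegral.hasSum_integral_of_dominated_convergence (a := -1) (b := 1) (μ := volume)
    (F := fun (m : ℕ) x => c m * ((Chebyshev.T ℝ (m:ℤ) * q).eval x * v x))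
    (f := fun x => q.eval x * (v x * g x))
    (fun m x => C * (θ * θ) ^ m * |q.eval x * v x|) ?_ ?_ ?_ ?_ ?_
  · refine this.congr_fun' fun m => ?_
    rw [intervalIntegral.integral_const_mul, Lam_apply]
  · intro m
    exact (intervalIntegrable_iff.1 ((ii_poly hv (Chebyshev.T ℝ (m:ℤ) * q)).const_mul (c m))).aestronglyMeasurable
  · intro m
    refine Eventually.of_forall fun x hx => ?_
    rw [uIoc_of_le (by norm_num)] at hx
    have h1 := Chebyshev.abs_eval_T_real_le_one (m:ℤ) (abs_le.2 ⟨hx.1.le, hx.2⟩)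
    rw [Real.norm_eq_abs, abs_mul, eval_mul, mul_assoc, abs_mul (eval _ _)]
    refine mul_le_mul (hc m) (mul_le_of_le_one_left (abs_nonneg _) h1) (by positivity)
      ((abs_nonneg _).trans (hc m))
  · exact Eventually.of_forall fun x hx => hgeo.mul_right _
  · simp_rw [tsum_mul_right]
    exact (ii_poly hv q).abs.const_mul _
  · refine Eventually.of_forall fun x hx => ?_
    rw [uIoc_of_le (by norm_num)] at hx
    have h1 := (hs x ⟨hx.1.le, hx.2⟩).mul_left (q.eval x * v x)
    rw [mul_assoc] at h1
    refine h1.congr_fun' fun m => ?_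
    rw [eval_mul]; ring

end fin

theorem stmt8
    (α β : ℝ) (hα : -1 < α) (hβ : -1 < β)
    (U : Set ℂ) (hUopen : IsOpen U) (hUseg : seg ⊆ U)
    (h : ℂ → ℂ) (hh : AnalyticOn ℂ h U)
    (hhre : ∀ z ∈ U, 0 < (h z).re)
    (hhreal : ∀ x ∈ Set.Icc (-1:ℝ) 1, (h (x:ℂ)).im = 0)
    (w : ℝ → ℝ)
    (hw : ∀ x ∈ Set.Ioo (-1:ℝ) 1, w x = (1 - x) ^ α * (1 + x) ^ β * (h (x:ℂ)).re)
    (P : ℕ → Polynomial ℝ)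
    (hPmonic : ∀ n, (P n).Monic)
    (hPdeg : ∀ n, (P n).natDegree = n)
    (hPorth : ∀ n, ∀ k < n, ∫ x in (-1:ℝ)..1, (P n).eval x * x ^ k * w x = 0)
    (γ : ℕ → ℝ)
    (hγ : ∀ n, γ n = (∫ x in (-1:ℝ)..1, (P n).eval x ^ 2 * w x) ^ (-(1/2) : ℝ))
    (hγpos : ∀ n, 0 < γ n)
    (b : ℕ → ℝ)
    (hb : ∀ n, b n = (∫ x in (-1:ℝ)..1, x * (P n).eval x ^ 2 * w x) /
      ∫ x in (-1:ℝ)..1, (P n).eval x ^ 2 * w x)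
    :
    ∃ A B : ℕ → ℝ, ∀ ℓ : ℕ, 1 ≤ ℓ → ∃ C > (0:ℝ), ∀ n : ℕ, 1 ≤ n →
      |γ (n - 1) / γ n - 1/2 - ∑ k ∈ Finset.Icc 2 ℓ, A k / (n : ℝ) ^ k|
        ≤ C / (n : ℝ) ^ (ℓ + 1) ∧
      |b n - ∑ k ∈ Finset.Icc 2 ℓ, B k / (n : ℝ) ^ k| ≤ C / (n : ℝ) ^ (ℓ + 1) := by
  have hd := hh.differentiableOn
  obtain ⟨c, C, θ, hC, hθ, hθ1, hc, hs⟩ := cheb_expand hUopen hUseg hd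
  have hgc : ContinuousOn (fun x : ℝ => (h (x:ℂ)).re) (Icc (-1) 1) := by
    refine Complex.continuous_re.comp_continuousOn (hd.continuousOn.comp
      Complex.continuous_ofReal.continuousOn ?_)
    intro x hx
    exact hUseg ⟨x, hx, rfl⟩
  have hgpos : ∀ x ∈ Icc (-1:ℝ) 1, 0 < (h (x:ℂ)).re := fun x hx => hhre _ (hUseg ⟨x, hx, rfl⟩)
  have hv0 := w0_int hα hβ
  have hv : IntervalIntegrable (fun x => w0 α β x * (h (x:ℂ)).re) volume (-1) 1 :=
    hv0.mul_continuousOn (by rw [uIcc_of_le (by norm_num)]; exact hgc)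
  have hv0pos : ∀ x ∈ Ioo (-1:ℝ) 1, 0 < w0 α β x := fun x hx => w0_pos hx
  have hvpos : ∀ x ∈ Ioo (-1:ℝ) 1, 0 < w0 α β x * (h (x:ℂ)).re :=
    fun x hx => mul_pos (w0_pos hx) (hgpos x (Ioo_subset_Icc_self hx))
  have hwi : ∀ p : Polynomial ℝ, ∫ x in (-1:ℝ)..1, p.eval x * w x = Lam _ hv p := by
    intro p
    rw [Lam_apply]
    refine ii_congr_Ioo fun x hx => ?_
    rw [hw x hx, w0]
  have hN : ∀ n, ∫ x in (-1:ℝ)..1, (P n).eval x ^ 2 * w x = Lam _ hv (P n * P n) := by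
    intro n
    rw [← hwi]; simp only [Polynomial.eval_mul, pow_two]
  have o : OPS (Lam _ hv) P := by
    refine ⟨Lam_pos hv hvpos, hPmonic, hPdeg, fun n k hk => ?_⟩
    rw [← hwi, ← hPorth n k hk]
    simp only [Polynomial.eval_mul, Polynomial.eval_pow, Polynomial.eval_X]
  obtain ⟨P0, o0⟩ := OPS.exists_ops (Lam _ hv0) (Lam_pos hv0 hv0pos)
  obtain ⟨ha, hsc, ha2⟩ := jac_base hα hβ o0 (jop_symm hα hβ)
  obtain ⟨x1, hx1, hmin⟩ := isCompact_Icc.exists_isMinOn (nonempty_Icc.2 (by norm_num : (-1:ℝ) ≤ 1)) hgc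
  obtain ⟨x2, hx2, hmax⟩ := isCompact_Icc.exists_isMaxOn (nonempty_Icc.2 (by norm_num : (-1:ℝ) ≤ 1)) hgc
  obtain ⟨A, B, hAB⟩ := core2 o0 o (Lam_T hv0 hv0pos) ha hsc ha2 hC hθ hθ1 hc
    (Lam_hasSum hv0 hv hθ hθ1 hc hs) (hgpos x1 hx1) (hgpos x2 hx2)
    (by
      intro q
      rw [← C_mul_map]
      refine Lam_mono hv0 hv _ _ fun x hx => ?_
      have h1 : (h (x1:ℂ)).re ≤ (h (x:ℂ)).re := hmin (Ioo_subset_Icc_self hx)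
      have h2 : 0 ≤ (q * q).eval x * w0 α β x := by
        rw [Polynomial.eval_mul]; exact mul_nonneg (mul_self_nonneg _) (w0_pos hx).le
      rw [Polynomial.eval_mul, Polynomial.eval_C]
      nlinarith)
    (by
      intro q
      rw [← C_mul_map]
      refine Lam_mono hv hv0 _ _ fun x hx => ?_
      have h1 : (h (x:ℂ)).re ≤ (h (x2:ℂ)).re := hmax (Ioo_subset_Icc_self hx)
      have h2 : 0 ≤ (q * q).eval x * w0 α β x := by
        rw [Polynomial.eval_mul]; exact mul_nonneg (mul_self_nonneg _) (w0_pos hx).le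
      rw [Polynomial.eval_mul (p := Polynomial.C _), Polynomial.eval_C]
      nlinarith)
  have hga : ∀ n, γ (n - 1) / γ n = aN (Lam _ hv) P n := by
    intro n
    have h1 := o.N_pos n
    have h2 := o.N_pos (n - 1)
    rw [hγ, hγ, hN, hN, aN, Real.rpow_neg h1.le, Real.rpow_neg h2.le, ← Real.sqrt_eq_rpow,
      ← Real.sqrt_eq_rpow, Real.sqrt_div h1.le]
    field_simp
  have hbn : ∀ n, b n = sc P n - sc P (n + 1) := by
    intro n
    have h1 := o.N_pos n
    rw [hb, hN, div_eq_iff h1.ne', ← o.X_sq, ← hwi]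
    congr 1; ext x
    simp only [Polynomial.eval_mul, Polynomial.eval_X]; ring
  refine ⟨A, B, fun l hl => ?_⟩
  obtain ⟨D, hD, hD'⟩ := hAB l hl
  refine ⟨D, hD, fun n hn => ?_⟩
  rw [hga, hbn]
  exact hD' n hn
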